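/- α(M) = dim_k Soc(H^d_m(M)) if and only if M is Cohen-Macaulay. -/

import Mathlib

open IsLocalRing

universe u

namespace Paper

variable (R : Type u) [CommRing R]

/-- `dim_{R/I} Soc_I(N)` where `Soc_I(N) = (0 :_N I)`. -/
noncomputable def socDim (I : Ideal R) (N : Type u) [AddCommGroup N] [Module R N] : ℕ :=
  Module.finrank (R ⧸ I) (Submodule.torsionBySet R N (I : Set R))

/-- Krull dimension of a module (`⊥` for the zero module). -/
noncomputable def mdim (M : Type u) [AddCommGroup M] [Module R M] : WithBot (WithTop ℕ) :=
  ringKrullDim (R ⧸ Module.annihilator R M)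

/-- The index of reducibility of an ideal `q` on `M`: `dim_k Soc (M/qM)`. -/
noncomputable def ir [IsLocalRing R] (M : Type u) [AddCommGroup M] [Module R M]
    (q : Ideal R) : ℕ :=
  socDim R (maximalIdeal R) (M ⧸ (q • ⊤ : Submodule R M))

/-- `dim_k Soc (H^i_m(M))`. -/
noncomputable def socH [IsLocalRing R] (M : Type u) [AddCommGroup M] [Module R M] (i : ℕ) : ℕ :=
  socDim R (maximalIdeal R) ((localCohomology (maximalIdeal R) i).obj (ModuleCat.of R M))

/-- A system of parameters of `M` (of length `d`): `d` elements of the maximal ideal such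
that the quotient has finite length. -/
def IsSOP [IsLocalRing R] (M : Type u) [AddCommGroup M] [Module R M] (d : ℕ)
    (x : Fin d → R) : Prop :=
  (∀ i, x i ∈ maximalIdeal R) ∧
    IsFiniteLength R (M ⧸ (Ideal.span (Set.range x) • ⊤ : Submodule R M))

/-- A parameter element: an element occurring in some system of parameters of `M`. -/
def IsParamElement [IsLocalRing R] (M : Type u) [AddCommGroup M] [Module R M] (d : ℕ)
    (a : R) : Prop :=
  ∃ x : Fin d → R, IsSOP R M d x ∧ ∃ i, x i = a

/-- The ideal `b(M) = ⋂ Ann (0 :_{M/(x_1,...,x_{i-1})M} x_i)`, the intersection running over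
all systems of parameters `x_1, ..., x_d` of `M`. -/
noncomputable def bIdeal [IsLocalRing R] (M : Type u) [AddCommGroup M] [Module R M]
    (d : ℕ) : Ideal R :=
  ⨅ (x : Fin d → R) (_ : IsSOP R M d x) (i : Fin d),
    Module.annihilator R
      (Submodule.torsionBy R (M ⧸ (Ideal.span (x '' {j | j < i}) • ⊤ : Submodule R M)) (x i))

/-- A C-system of parameters: `x_i ∈ b(M/(x_{i+1},...,x_d)M)^3` for all `i`. -/
def IsCSOP [IsLocalRing R] (M : Type u) [AddCommGroup M] [Module R M] (d : ℕ)
    (x : Fin d → R) : Prop :=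
  IsSOP R M d x ∧ ∀ i : Fin d,
    x i ∈ (bIdeal R (M ⧸ (Ideal.span (x '' {j | i < j}) • ⊤ : Submodule R M)) ((i : ℕ) + 1)) ^ 3

/-- The depth of `M`: the supremum of the lengths of `M`-regular sequences contained in the
maximal ideal. -/
noncomputable def depth [IsLocalRing R] (M : Type u) [AddCommGroup M] [Module R M] :
    WithTop ℕ :=
  sSup {n : WithTop ℕ | ∃ rs : List R, (rs.length : WithTop ℕ) = n ∧
    (∀ r ∈ rs, r ∈ maximalIdeal R) ∧ RingTheory.Sequence.IsRegular M rs}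

/-- `M` is a Cohen-Macaulay module: `depth M = dim M`. -/
def IsCM [IsLocalRing R] (M : Type u) [AddCommGroup M] [Module R M] : Prop :=
  (depth R M : WithBot (WithTop ℕ)) = mdim R M

/-- A Cohen-Macaulay local ring. -/
def IsCMLocalRing (S : Type u) [CommRing S] [IsLocalRing S] : Prop :=
  IsNoetherianRing S ∧ IsCM S S

/-- `R` is a homomorphic image of a Cohen-Macaulay (Noetherian) local ring. -/
def IsQuotientOfCMLocalRing : Prop :=
  ∃ (S : Type u) (_ : CommRing S) (_ : IsLocalRing S),
    IsCMLocalRing S ∧ ∃ f : S →+* R, Function.Surjective f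

/-- The largest submodule of (the submodule) `N` whose dimension is strictly smaller than
that of `N`. -/
noncomputable def uComp (M : Type u) [AddCommGroup M] [Module R M] (N : Submodule R M) :
    Submodule R M :=
  sSup {P : Submodule R M | P ≤ N ∧ mdim R P < mdim R N}

/-- The unmixed component `U_M(0)` of `M`: the largest submodule of dimension `< dim M`. -/
noncomputable def unmixedComp (M : Type u) [AddCommGroup M] [Module R M] : Submodule R M :=
  uComp R M ⊤

/-- The 0-th local cohomology `H^0_m(M)` realized as the submodule of elements annihilated by
some power of the maximal ideal. -/
def H0sub [IsLocalRing R] (M : Type u) [AddCommGroup M] [Module R M] : Submodule R M :=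
  ⨆ n : ℕ, Submodule.torsionBySet R M (((maximalIdeal R) ^ n : Ideal R) : Set R)

/-- The quotient `P/N` of two submodules of `M`. -/
abbrev subQuot (M : Type u) [AddCommGroup M] [Module R M] (P N : Submodule R M) :=
  P ⧸ (Submodule.comap P.subtype N)

/-- `D_0 ⊆ D_1 ⊆ ⋯ ⊆ D_t = M` is the dimension filtration of `M`:
`D_t = M`, each `D_{i-1}` is the largest submodule of `D_i` of strictly smaller dimension,
and `D_0 = H^0_m(M)`. -/
def IsDimFiltration [IsLocalRing R] (M : Type u) [AddCommGroup M] [Module R M]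
    (t : ℕ) (D : Fin (t + 1) → Submodule R M) : Prop :=
  D (Fin.last t) = ⊤ ∧ (∀ i : Fin t, D i.castSucc = uComp R M (D i.succ)) ∧
    D 0 = H0sub R M

/-- `M` is sequentially Cohen-Macaulay: all quotients `D_i/D_{i-1}` of the dimension
filtration are Cohen-Macaulay. -/
def IsSeqCM [IsLocalRing R] (M : Type u) [AddCommGroup M] [Module R M] : Prop :=
  ∃ (t : ℕ) (D : Fin (t + 1) → Submodule R M), IsDimFiltration R M t D ∧
    ∀ i : Fin t, IsCM R (subQuot R M (D i.succ) (D i.castSucc))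

/-- `M` (of dimension `d`) is generalized Cohen-Macaulay: `H^i_m(M)` has finite length
for all `i < d`. -/
def IsGenCM [IsLocalRing R] (M : Type u) [AddCommGroup M] [Module R M] (d : ℕ) : Prop :=
  ∀ i < d, IsFiniteLength R ((localCohomology (maximalIdeal R) i).obj (ModuleCat.of R M))

/-- `α_n(M)`: the minimum of the indices of reducibility of parameter ideals of `M`
contained in `m^n`. -/
noncomputable def alphaN [IsLocalRing R] (M : Type u) [AddCommGroup M] [Module R M]
    (d n : ℕ) : ℕ :=
  sInf {r : ℕ | ∃ x : Fin d → R, IsSOP R M d x ∧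
    Ideal.span (Set.range x) ≤ (maximalIdeal R) ^ n ∧ r = ir R M (Ideal.span (Set.range x))}

/-- The limit value `α(M) = lim_n α_n(M)` (the supremum of the non-decreasing sequence). -/
noncomputable def alphaLim [IsLocalRing R] (M : Type u) [AddCommGroup M] [Module R M]
    (d : ℕ) : ℕ :=
  ⨆ n : ℕ, alphaN R M d (n + 1)

/-- `M` is unmixed: `dim R/p = dim M` for all associated primes `p`. -/
def IsUnmixed (M : Type u) [AddCommGroup M] [Module R M] : Prop :=
  ∀ p ∈ associatedPrimes R M, ringKrullDim (R ⧸ p) = mdim R M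

/-- Serre's condition `(S_2)` for a module. -/
def IsS2 (L : Type u) [AddCommGroup L] [Module R L] : Prop :=
  ∀ p : PrimeSpectrum R, p ∈ Module.support R L →
    min 2 (mdim (Localization.AtPrime p.asIdeal) (LocalizedModule p.asIdeal.primeCompl L)) ≤
      (depth (Localization.AtPrime p.asIdeal) (LocalizedModule p.asIdeal.primeCompl L) :
        WithBot (WithTop ℕ))

/-- `ι : M →ₗ[R] S` exhibits `S` as an `S_2`-ification of `M`. -/
def IsS2ification [IsLocalRing R] (M S : Type u) [AddCommGroup M] [Module R M]
    [AddCommGroup S] [Module R S] (ι : M →ₗ[R] S) : Prop :=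
  Function.Injective ι ∧ Module.Finite R S ∧ IsS2 R S ∧
    ∀ (p : Ideal R) [p.IsPrime], p ≠ maximalIdeal R →
      IsS2 (Localization.AtPrime p) (LocalizedModule p.primeCompl M) →
      Function.Surjective (IsLocalizedModule.map p.primeCompl
        (LocalizedModule.mkLinearMap p.primeCompl M)
        (LocalizedModule.mkLinearMap p.primeCompl S) ι)

end Paper

namespace LC
open CategoryTheory Limits Opposite
noncomputable section
variable {R : Type u} [CommRing R]

/-- representation relation between cocycles and homology in the opposite category -/
def opRep (K : ChainComplex (ModuleCat.{u} R)ᵒᵖ ℕ) (n : ℕ)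
    (z : (K.X n).unop) (e : (K.homology n).unop) : Prop :=
  ∃ c : (K.opcycles n).unop, (K.pOpcycles n).unop c = z ∧ (K.homologyι n).unop c = e

theorem opRep_add {K : ChainComplex (ModuleCat.{u} R)ᵒᵖ ℕ} {n : ℕ} {z z' e e'}
    (h : opRep K n z e) (h' : opRep K n z' e') : opRep K n (z + z') (e + e') := by
  obtain ⟨c, rfl, rfl⟩ := h
  obtain ⟨c', rfl, rfl⟩ := h'
  exact ⟨c + c', map_add _ _ _, map_add _ _ _⟩

theorem opRep_smul {K : ChainComplex (ModuleCat.{u} R)ᵒᵖ ℕ} {n : ℕ} {z e} (r : R)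
    (h : opRep K n z e) : opRep K n (r • z) (r • e) := by
  obtain ⟨c, rfl, rfl⟩ := h
  exact ⟨r • c, map_smul _ _ _, map_smul _ _ _⟩

theorem opRep_surj (K : ChainComplex (ModuleCat.{u} R)ᵒᵖ ℕ) (n : ℕ) (e) :
    ∃ z, opRep K n z e := by
  have : Epi (K.homologyι n).unop := inferInstance
  obtain ⟨c, hc⟩ := (ModuleCat.epi_iff_surjective _).1 this e
  exact ⟨_, c, rfl, hc⟩

theorem opRep_cocycle {K : ChainComplex (ModuleCat.{u} R)ᵒᵖ ℕ} {n : ℕ} {z e}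
    (h : opRep K n z e) : (K.d (n+1) n).unop z = 0 := by
  obtain ⟨c, rfl, rfl⟩ := h
  have := K.d_pOpcycles (n+1) n
  have h2 := congrArg Quiver.Hom.unop this
  rw [unop_comp] at h2
  exact congrArg (fun f => f.hom c) h2

theorem opRep_total {K : ChainComplex (ModuleCat.{u} R)ᵒᵖ ℕ} {n : ℕ} {z}
    (h : (K.d (n+1) n).unop z = 0) : ∃ e, opRep K n z e := by
  have := ShortComplex.exact_of_g_is_cokernel (ShortComplex.mk _ _ (K.d_pOpcycles (n+1) n))
    (K.opcyclesIsCokernel (n+1) n (by simp))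
  obtain ⟨c, hc⟩ := (ShortComplex.moduleCat_exact_iff _).1 this.unop z h
  exact ⟨_, c, hc, rfl⟩

theorem opRep_zero_iff {K : ChainComplex (ModuleCat.{u} R)ᵒᵖ ℕ} {n : ℕ} {z} :
    opRep K (n+1) z 0 ↔ ∃ w, (K.d (n+1) n).unop w = z := by
  have hp : K.pOpcycles (n+1) ≫ K.fromOpcycles (n+1) n = K.d (n+1) n := by simp
  have hp' := congrArg Quiver.Hom.unop hp
  rw [unop_comp] at hp'
  constructor
  · rintro ⟨c, rfl, hc⟩
    have := ShortComplex.exact_of_f_is_kernel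
      (ShortComplex.mk _ _ (K.homologyι_comp_fromOpcycles (n+1) n))
      (K.homologyIsKernel (n+1) n (by simp))
    obtain ⟨w, hw⟩ := (ShortComplex.moduleCat_exact_iff _).1 this.unop c hc
    refine ⟨w, ?_⟩
    rw [← hp', ← hw]; rfl
  · rintro ⟨w, rfl⟩
    refine ⟨(K.fromOpcycles (n+1) n).unop w, ?_, ?_⟩
    · rw [← hp']; rfl
    · have h2 := congrArg Quiver.Hom.unop (K.homologyι_comp_fromOpcycles (n+1) n)
      rw [unop_comp] at h2
      exact congrArg (fun f => f.hom w) h2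

theorem opRep_fun {K : ChainComplex (ModuleCat.{u} R)ᵒᵖ ℕ} {n : ℕ} {z e e'}
    (h : opRep K n z e) (h' : opRep K n z e') : e = e' := by
  obtain ⟨c, rfl, rfl⟩ := h
  obtain ⟨c', h1, rfl⟩ := h'
  have : Mono (K.pOpcycles n).unop := inferInstance
  rw [(ModuleCat.mono_iff_injective _).1 this h1]

theorem opRep_map {K L : ChainComplex (ModuleCat.{u} R)ᵒᵖ ℕ} (φ : K ⟶ L) {n : ℕ} {z e}
    (h : opRep L n z e) :
    opRep K n ((φ.f n).unop z) ((HomologicalComplex.homologyMap φ n).unop e) := by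
  obtain ⟨c, rfl, rfl⟩ := h
  refine ⟨(HomologicalComplex.opcyclesMap φ n).unop c, ?_, ?_⟩
  · have h2 := congrArg Quiver.Hom.unop (HomologicalComplex.p_opcyclesMap φ n)
    rw [unop_comp, unop_comp] at h2
    exact congrArg (fun f => f.hom c) h2
  · have h2 := congrArg Quiver.Hom.unop (HomologicalComplex.homologyι_naturality φ n)
    rw [unop_comp, unop_comp] at h2
    exact (congrArg (fun f => f.hom c) h2).symm

/-- the functor `Hom(-,Y)` into the opposite category -/
abbrev FY (Y : ModuleCat.{u} R) : ModuleCat.{u} R ⥤ (ModuleCat.{u} R)ᵒᵖ :=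
  ((linearYoneda R (ModuleCat.{u} R)).obj Y).rightOp

/-- `Ext` as an object. -/
abbrev ExtO (n : ℕ) (X Y : ModuleCat.{u} R) : ModuleCat.{u} R :=
  ((Ext R (ModuleCat.{u} R) n).obj (op X)).obj Y

abbrev KP {X : ModuleCat.{u} R} (P : ProjectiveResolution X) (Y : ModuleCat.{u} R) :
    ChainComplex (ModuleCat.{u} R)ᵒᵖ ℕ := ((FY Y).mapHomologicalComplex _).obj P.complex

def extIso {X : ModuleCat.{u} R} (P : ProjectiveResolution X) (Y : ModuleCat.{u} R) (n : ℕ) :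
    ((KP P Y).homology n).unop ≅ ExtO n X Y :=
  (P.isoLeftDerivedObj (FY Y) n).unop

def extRep {X Y : ModuleCat.{u} R} (P : ProjectiveResolution X) (n : ℕ)
    (f : P.complex.X n ⟶ Y) (e : ExtO n X Y) : Prop :=
  opRep (KP P Y) n (show (((KP P Y).X n).unop : Type u) from f) ((extIso P Y n).inv.hom e)

section
variable {X Y : ModuleCat.{u} R} {P : ProjectiveResolution X} {n : ℕ}

theorem extRep_add {f f' : P.complex.X n ⟶ Y} {e e'} (h : extRep P n f e) (h' : extRep P n f' e') :
    extRep P n (f + f') (e + e') := by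
  unfold extRep; rw [map_add]; exact opRep_add h h'

theorem extRep_smul {f : P.complex.X n ⟶ Y} {e} (r : R) (h : extRep P n f e) :
    extRep P n (r • f) (r • e) := by
  unfold extRep; rw [map_smul]; exact opRep_smul r h

theorem extRep_surj (e : ExtO n X Y) : ∃ f : P.complex.X n ⟶ Y, extRep P n f e :=
  opRep_surj (KP P Y) n _

theorem extRep_fun {f : P.complex.X n ⟶ Y} {e e'} (h : extRep P n f e) (h' : extRep P n f e') :
    e = e' := by
  have := opRep_fun h h'
  have h2 := congrArg (extIso P Y n).hom.hom this
  rwa [Iso.inv_hom_id_apply, Iso.inv_hom_id_apply] at h2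

theorem extRep_cocycle {f : P.complex.X n ⟶ Y} {e} (h : extRep P n f e) :
    P.complex.d (n+1) n ≫ f = 0 := opRep_cocycle h

theorem extRep_total {f : P.complex.X n ⟶ Y} (h : P.complex.d (n+1) n ≫ f = 0) :
    ∃ e, extRep P n f e := by
  obtain ⟨e, he⟩ := opRep_total (K := KP P Y) (n := n)
    (z := (show (((KP P Y).X n).unop : Type u) from f)) h
  refine ⟨(extIso P Y n).hom.hom e, ?_⟩
  unfold extRep
  rwa [Iso.hom_inv_id_apply]

theorem extRep_zero_iff {f : P.complex.X (n+1) ⟶ Y} :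
    extRep P (n+1) f 0 ↔ ∃ g : P.complex.X n ⟶ Y, P.complex.d (n+1) n ≫ g = f := by
  unfold extRep; rw [map_zero]; exact opRep_zero_iff

theorem extRep_map {X' : ModuleCat.{u} R} {P' : ProjectiveResolution X'} (a : X' ⟶ X)
    (φ : P'.complex ⟶ P.complex) (comm : φ.f 0 ≫ P.π.f 0 = P'.π.f 0 ≫ a)
    {f : P.complex.X n ⟶ Y} {e} (h : extRep P n f e) :
    extRep P' n (φ.f n ≫ f) (((Ext R (ModuleCat.{u} R) n).map a.op).app Y e) := by
  have h1 := opRep_map (((FY Y).mapHomologicalComplex _).map φ) h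
  unfold extRep
  have h2 := ProjectiveResolution.isoLeftDerivedObj_inv_naturality a P' P φ comm (FY Y) n
  have h3 := congrArg Quiver.Hom.unop h2
  rw [unop_comp, unop_comp] at h3
  have h4 := congrArg (fun f => f.hom e) h3
  convert h1 using 1
  · rfl
  · exact h4
end

/-- chosen projective resolution of `R / J^n` -/
abbrev PJ (J : Ideal R) (n : ℕ) : ProjectiveResolution (ModuleCat.of R (R ⧸ J ^ n)) :=
  projectiveResolution _

/-- transition map -/
abbrev tr (J : Ideal R) {n n' : ℕ} (h : n ≤ n') :
    ModuleCat.of R (R ⧸ J ^ n') ⟶ ModuleCat.of R (R ⧸ J ^ n) :=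
  ModuleCat.ofHom (Submodule.mapQ _ _ LinearMap.id (Ideal.pow_le_pow_right h))

/-- lift of the transition map -/
def ph (J : Ideal R) {n n' : ℕ} (h : n ≤ n') : (PJ J n').complex ⟶ (PJ J n).complex :=
  ProjectiveResolution.lift (tr J h) (PJ J n') (PJ J n)

theorem ph_comm (J : Ideal R) {n n' : ℕ} (h : n ≤ n') :
    (ph J h).f 0 ≫ (PJ J n).π.f 0 = (PJ J n').π.f 0 ≫ tr J h :=
  ProjectiveResolution.lift_commutes_zero _ _ _

/-- local cohomology as an object -/
abbrev LCO (J : Ideal R) (i : ℕ) (Y : ModuleCat.{u} R) : ModuleCat.{u} R :=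
  (localCohomology J i).obj Y

open localCohomology in
def lcι (J : Ideal R) (i n : ℕ) (Y : ModuleCat.{u} R) :
    ExtO i (ModuleCat.of R (R ⧸ J ^ n)) Y ⟶ LCO J i Y :=
  haveI := hasColimitDiagram.{u, 0} (idealPowersDiagram J) i
  (colimit.ι (diagram (idealPowersDiagram J) i) (op (op n))).app Y

open localCohomology in
theorem lcι_tr (J : Ideal R) (i : ℕ) {n n' : ℕ} (h : n ≤ n') (Y : ModuleCat.{u} R) (e) :
    lcι J i n' Y (((Ext R (ModuleCat.{u} R) i).map (tr J h).op).app Y e) = lcι J i n Y e := by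
  have := hasColimitDiagram.{u, 0} (idealPowersDiagram J) i
  have := colimit.w (diagram (idealPowersDiagram J) i)
    (show op (op n) ⟶ op (op n') from (homOfLE h).op.op)
  have h2 := congrArg (fun a => (a.app Y).hom e) this
  exact h2

theorem forget_pres : PreservesColimitsOfShape (ℕᵒᵖ)ᵒᵖ (forget (ModuleCat.{u} R)) :=
  have := preservesFilteredColimitsOfSize_shrink.{0, u, 0, u} (forget (ModuleCat.{u} R))
  PreservesFilteredColimitsOfSize.preserves_filtered_colimits _

open localCohomology in
theorem lcι_surj (J : Ideal R) (i : ℕ) (Y : ModuleCat.{u} R) (a : LCO J i Y) :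
    ∃ n e, lcι J i n Y e = a := by
  have := hasColimitDiagram.{u, 0} (idealPowersDiagram J) i
  have hc := isColimitOfPreserves ((evaluation _ _).obj Y)
    (colimit.isColimit (diagram (idealPowersDiagram J) i))
  have := forget_pres (R := R)
  obtain ⟨j, e, he⟩ := Concrete.isColimit_exists_rep _ hc a
  exact ⟨j.unop.unop, e, he⟩

open localCohomology in
theorem lcι_zero (J : Ideal R) (i : ℕ) (Y : ModuleCat.{u} R) {n e} (h : lcι J i n Y e = 0) :
    ∃ (n' : ℕ) (hn : n ≤ n'), ((Ext R (ModuleCat.{u} R) i).map (tr J hn).op).app Y e = 0 := by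
  have := hasColimitDiagram.{u, 0} (idealPowersDiagram J) i
  have hc := isColimitOfPreserves ((evaluation _ _).obj Y)
    (colimit.isColimit (diagram (idealPowersDiagram J) i))
  have h0 : lcι J i n Y e = lcι J i n Y 0 := by rw [h, map_zero]
  have := forget_pres (R := R)
  obtain ⟨j, f, hf⟩ := (IsColimit.eq_iff' hc (i := op (op n)) e 0).1 h0
  refine ⟨j.unop.unop, leOfHom f.unop.unop, ?_⟩
  rw [map_zero] at hf
  exact hf

/-- `a` in local cohomology is represented by the cocycle `f` on the resolution of `R/J^n`. -/
def Rep (J : Ideal R) (i : ℕ) {Y : ModuleCat.{u} R} (n : ℕ) (f : (PJ J n).complex.X i ⟶ Y)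
    (a : LCO J i Y) : Prop := ∃ e, extRep (PJ J n) i f e ∧ lcι J i n Y e = a

section
variable {J : Ideal R} {i : ℕ} {Y : ModuleCat.{u} R} {n : ℕ}

theorem Rep.add {f f' : (PJ J n).complex.X i ⟶ Y} {a a'} (h : Rep J i n f a) (h' : Rep J i n f' a') :
    Rep J i n (f + f') (a + a') := by
  obtain ⟨e, he, rfl⟩ := h
  obtain ⟨e', he', rfl⟩ := h'
  exact ⟨e + e', extRep_add he he', map_add _ _ _⟩

theorem Rep.smul {f : (PJ J n).complex.X i ⟶ Y} {a} (r : R) (h : Rep J i n f a) :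
    Rep J i n (r • f) (r • a) := by
  obtain ⟨e, he, rfl⟩ := h
  exact ⟨r • e, extRep_smul r he, map_smul _ _ _⟩

theorem Rep.zero : Rep J i n (0 : (PJ J n).complex.X i ⟶ Y) 0 := by
  obtain ⟨e, he⟩ := extRep_total (P := PJ J n) (n := i) (f := (0 : (PJ J n).complex.X i ⟶ Y))
    (by simp)
  have := Rep.smul (J := J) (0 : R) ⟨e, he, rfl⟩
  rwa [zero_smul, zero_smul] at this

theorem Rep.surj (a : LCO J i Y) : ∃ n f, Rep J i (Y := Y) n f a := by
  obtain ⟨n, e, rfl⟩ := lcι_surj J i Y a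
  obtain ⟨f, hf⟩ := extRep_surj (P := PJ J n) e
  exact ⟨n, f, e, hf, rfl⟩

theorem Rep.cocycle {f : (PJ J n).complex.X i ⟶ Y} {a} (h : Rep J i n f a) :
    (PJ J n).complex.d (i+1) i ≫ f = 0 := by
  obtain ⟨e, he, rfl⟩ := h
  exact extRep_cocycle he

theorem Rep.total {f : (PJ J n).complex.X i ⟶ Y}
    (h : (PJ J n).complex.d (i+1) i ≫ f = 0) : ∃ a, Rep J i n f a := by
  obtain ⟨e, he⟩ := extRep_total h
  exact ⟨_, e, he, rfl⟩

theorem Rep.fun {f : (PJ J n).complex.X i ⟶ Y} {a a'} (h : Rep J i n f a) (h' : Rep J i n f a') :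
    a = a' := by
  obtain ⟨e, he, rfl⟩ := h
  obtain ⟨e', he', rfl⟩ := h'
  rw [extRep_fun he he']

theorem Rep.lift {f : (PJ J n).complex.X i ⟶ Y} {a} (h : Rep J i n f a) {n' : ℕ} (hn : n ≤ n') :
    Rep J i n' ((ph J hn).f i ≫ f) a := by
  obtain ⟨e, he, rfl⟩ := h
  exact ⟨_, extRep_map _ _ (ph_comm J hn) he, lcι_tr J i hn Y e⟩

theorem Rep.bd (g : (PJ J n).complex.X i ⟶ Y) :
    Rep J (i+1) n ((PJ J n).complex.d (i+1) i ≫ g) 0 :=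
  ⟨0, extRep_zero_iff.2 ⟨g, rfl⟩, map_zero _⟩

theorem Rep.of_zero {f : (PJ J n).complex.X (i+1) ⟶ Y} (h : Rep J (i+1) n f 0) :
    ∃ (n' : ℕ) (hn : n ≤ n') (g : (PJ J n').complex.X i ⟶ Y),
      (PJ J n').complex.d (i+1) i ≫ g = (ph J hn).f (i+1) ≫ f := by
  obtain ⟨e, he, h0⟩ := h
  obtain ⟨n', hn, h1⟩ := lcι_zero _ _ _ h0
  have := extRep_map _ _ (ph_comm J hn) he
  rw [h1] at this
  obtain ⟨g, hg⟩ := extRep_zero_iff.1 this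
  exact ⟨n', hn, g, hg⟩
end
end
end LC

namespace LC
open CategoryTheory Limits Opposite
noncomputable section
variable {R : Type u} [CommRing R]

/-- a linear equivalence from a linear relation -/
theorem equivOfRel {A B : Type*} [AddCommGroup A] [AddCommGroup B] [Module R A] [Module R B]
    (T : Submodule R (A × B)) (N : Submodule R B) (h1 : ∀ a, ∃ b, (a, b) ∈ T)
    (h2 : ∀ b, ∃ a, (a, b) ∈ T) (h3 : ∀ b, (0, b) ∈ T → b ∈ N)
    (h4 : ∀ a b, (a, b) ∈ T → b ∈ N → a = 0) : Nonempty (A ≃ₗ[R] B ⧸ N) := by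
  have hfun : ∀ a b b', (a, b) ∈ T → (a, b') ∈ T → N.mkQ b = N.mkQ b' := by
    intro a b b' h h'
    have := T.sub_mem h h'
    simp only [Prod.mk_sub_mk, sub_self] at this
    exact (Submodule.Quotient.eq N).2 (h3 _ this)
  choose F hF using h1
  let φ : A →ₗ[R] B ⧸ N :=
    { toFun := fun a => N.mkQ (F a)
      map_add' := fun a a' => by
        rw [← map_add]
        exact hfun _ _ _ (hF _) (T.add_mem (hF a) (hF a'))
      map_smul' := fun r a => by
        rw [RingHom.id_apply, ← map_smul]
        exact hfun _ _ _ (hF _) (T.smul_mem r (hF a)) }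
  refine ⟨LinearEquiv.ofBijective φ ⟨?_, ?_⟩⟩
  · rw [injective_iff_map_eq_zero]
    intro a ha
    exact h4 a (F a) (hF a) ((Submodule.Quotient.mk_eq_zero N).1 ha)
  · intro q
    obtain ⟨b, rfl⟩ := N.mkQ_surjective q
    obtain ⟨a, ha⟩ := h2 b
    exact ⟨a, hfun _ _ _ (hF a) ha⟩

section shift
variable (J : Ideal R) (S : ShortComplex (ModuleCat.{u} R)) [Injective S.X₂]

def shiftRel (i : ℕ) : Submodule R (LCO J (i+1) S.X₁ × LCO J i S.X₃) where
  carrier := {p | ∃ n, ∃ f : (PJ J n).complex.X (i+1) ⟶ S.X₁, ∃ h : (PJ J n).complex.X i ⟶ S.X₃,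
    ∃ g : (PJ J n).complex.X i ⟶ S.X₂, Rep J (i+1) n f p.1 ∧ Rep J i n h p.2 ∧ g ≫ S.g = h ∧
      (PJ J n).complex.d (i+1) i ≫ g = f ≫ S.f}
  zero_mem' := ⟨0, 0, 0, 0, Rep.zero, Rep.zero, by simp, by simp⟩
  add_mem' := by
    rintro ⟨a, b⟩ ⟨a', b'⟩ ⟨n, f, h, g, h1, h2, h3, h4⟩ ⟨n', f', h', g', h1', h2', h3', h4'⟩
    have hn : n ≤ max n n' := le_max_left _ _
    have hn' : n' ≤ max n n' := le_max_right _ _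
    refine ⟨max n n', _, _, (ph J hn).f i ≫ g + (ph J hn').f i ≫ g', (h1.lift hn).add (h1'.lift hn'),
      (h2.lift hn).add (h2'.lift hn'), ?_, ?_⟩
    · simp [h3, h3']
    · simp only [Preadditive.comp_add, Preadditive.add_comp, Category.assoc, ← h4, ← h4']
      simp
  smul_mem' := by
    rintro r ⟨a, b⟩ ⟨n, f, h, g, h1, h2, h3, h4⟩
    exact ⟨n, _, _, r • g, h1.smul r, h2.smul r, by simp [h3], by simp [h4]⟩

theorem shift_equiv (hS : S.ShortExact) (i : ℕ) : Nonempty (LCO J (i+2) S.X₁ ≃ₗ[R] LCO J (i+1) S.X₃) := by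
  have : Mono S.f := hS.mono_f
  have : Epi S.g := hS.epi_g
  suffices h : Nonempty (LCO J (i+2) S.X₁ ≃ₗ[R]
      LCO J (i+1) S.X₃ ⧸ (⊥ : Submodule R (LCO J (i+1) S.X₃))) from
    ⟨h.some.trans (Submodule.quotEquivOfEqBot _ rfl)⟩
  refine equivOfRel (shiftRel J S (i+1)) ⊥ ?_ ?_ ?_ ?_
  · intro a
    obtain ⟨n, f, hf⟩ := Rep.surj a
    have hex := (PJ J n).exact_succ (i+1)
    let g := hex.descToInjective (f ≫ S.f) (by
      dsimp; rw [← Category.assoc, hf.cocycle, zero_comp])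
    have hg : (PJ J n).complex.d (i+2) (i+1) ≫ g = f ≫ S.f := hex.comp_descToInjective _ _
    have hc : (PJ J n).complex.d (i+2) (i+1) ≫ g ≫ S.g = 0 := by
      rw [← Category.assoc, hg, Category.assoc, S.zero, comp_zero]
    obtain ⟨b, hb⟩ := Rep.total hc
    exact ⟨b, n, f, _, g, hf, hb, rfl, hg⟩
  · intro b
    obtain ⟨n, h, hh⟩ := Rep.surj b
    let g := Projective.factorThru h S.g
    have hg : g ≫ S.g = h := Projective.factorThru_comp h S.g
    have hc : ((PJ J n).complex.d (i+2) (i+1) ≫ g) ≫ S.g = 0 := by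
      rw [Category.assoc, hg, hh.cocycle]
    let f := hS.exact.lift _ hc
    have hf : f ≫ S.f = (PJ J n).complex.d (i+2) (i+1) ≫ g := hS.exact.lift_f _ _
    have hfc : (PJ J n).complex.d (i+3) (i+2) ≫ f = 0 := by
      rw [← cancel_mono S.f, Category.assoc, hf]; simp
    obtain ⟨a, ha⟩ := Rep.total hfc
    exact ⟨a, n, f, h, g, ha, hh, hg, hf.symm⟩
  · rintro b ⟨n, f, h, g, h1, h2, h3, h4⟩
    obtain ⟨n', hn, u, hu⟩ := Rep.of_zero h1
    have h2' := h2.lift hn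
    have hex := (PJ J n').exact_succ i
    have hz : (PJ J n').complex.d (i+2) (i+1) ≫ ((ph J hn).f (i+1) ≫ g - u ≫ S.f) = 0 := by
      rw [Preadditive.comp_sub, ← Category.assoc _ u, hu, ← Category.assoc _ _ g,
        ← HomologicalComplex.Hom.comm, Category.assoc, h4, Category.assoc, sub_self]
    let w := hex.descToInjective _ hz
    have hw : (PJ J n').complex.d (i+1) i ≫ w = _ := hex.comp_descToInjective _ _
    have : (PJ J n').complex.d (i+1) i ≫ (w ≫ S.g) = (ph J hn).f (i+1) ≫ h := by
      rw [← Category.assoc, hw]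
      simp [h3]
    have hb := Rep.bd (J := J) (w ≫ S.g)
    rw [this] at hb
    exact h2'.fun hb
  · rintro a b ⟨n, f, h, g, h1, h2, h3, h4⟩ hb
    rw [Submodule.mem_bot] at hb
    dsimp only at h1 h2
    subst hb
    obtain ⟨n', hn, k, hk⟩ := Rep.of_zero h2
    let k' := Projective.factorThru k S.g
    have hk' : k' ≫ S.g = k := Projective.factorThru_comp k S.g
    have hz : ((ph J hn).f (i+1) ≫ g - (PJ J n').complex.d (i+1) i ≫ k') ≫ S.g = 0 := by
      simp [h3, hk', hk]
    let u := hS.exact.lift _ hz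
    have hu : u ≫ S.f = _ := hS.exact.lift_f _ _
    have h1' := h1.lift hn
    have : (PJ J n').complex.d (i+2) (i+1) ≫ u = (ph J hn).f (i+2) ≫ f := by
      rw [← cancel_mono S.f, Category.assoc, hu, Category.assoc, ← h4]
      simp
    have ha := Rep.bd (J := J) u
    rw [this] at ha
    exact h1'.fun ha

/-- torsion with respect to an ideal -/
def Gam (J : Ideal R) (Y : Type*) [AddCommGroup Y] [Module R Y] : Submodule R Y where
  carrier := {y | ∃ n : ℕ, ∀ a ∈ J ^ n, a • y = 0}
  zero_mem' := ⟨0, by simp⟩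
  add_mem' := by
    rintro y z ⟨n, hn⟩ ⟨m, hm⟩
    refine ⟨max n m, fun a ha => ?_⟩
    rw [smul_add, hn a (Ideal.pow_le_pow_right (le_max_left _ _) ha),
      hm a (Ideal.pow_le_pow_right (le_max_right _ _) ha), add_zero]
  smul_mem' := by
    rintro r y ⟨n, hn⟩
    exact ⟨n, fun a ha => by rw [smul_comm, hn a ha, smul_zero]⟩

/-- element evaluation of a map from `R/J^n` -/
abbrev ev1 {Y : ModuleCat.{u} R} {n : ℕ} (ψ : ModuleCat.of R (R ⧸ J ^ n) ⟶ Y) : Y :=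
  ψ.hom (Submodule.Quotient.mk 1)

theorem ev1_mem {J : Ideal R} {Y : ModuleCat.{u} R} {n : ℕ}
    (ψ : ModuleCat.of R (R ⧸ J ^ n) ⟶ Y) : ev1 J ψ ∈ Gam J Y := by
  refine ⟨n, fun a ha => ?_⟩
  rw [ev1, ← map_smul, ← Submodule.Quotient.mk_smul, smul_eq_mul, mul_one,
    (Submodule.Quotient.mk_eq_zero _).2 ha, map_zero]

theorem exists_ev1 {J : Ideal R} {Y : ModuleCat.{u} R} {n : ℕ} {y : Y} (h : ∀ a ∈ J ^ n, a • y = 0) :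
    ∃ ψ : ModuleCat.of R (R ⧸ J ^ n) ⟶ Y, ev1 J ψ = y := by
  refine ⟨ModuleCat.ofHom (Submodule.liftQ _ (LinearMap.toSpanSingleton R Y y) ?_), ?_⟩
  · intro a ha
    rw [LinearMap.mem_ker, LinearMap.toSpanSingleton_apply]
    exact h a ha
  · change (1 : R) • y = y
    rw [one_smul]

theorem ev1_inj {J : Ideal R} {Y : ModuleCat.{u} R} {n : ℕ}
    {ψ ψ' : ModuleCat.of R (R ⧸ J ^ n) ⟶ Y} (h : ev1 J ψ = ev1 J ψ') : ψ = ψ' := by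
  ext
  exact h

theorem ev1_tr {J : Ideal R} {Y : ModuleCat.{u} R} {n n' : ℕ} (hn : n ≤ n')
    (ψ : ModuleCat.of R (R ⧸ J ^ n) ⟶ Y) : ev1 J (tr J hn ≫ ψ) = ev1 J ψ := by
  simp [ev1]

theorem ev1_comp {J : Ideal R} {Y Z : ModuleCat.{u} R} {n : ℕ}
    (ψ : ModuleCat.of R (R ⧸ J ^ n) ⟶ Y) (g : Y ⟶ Z) : ev1 J (ψ ≫ g) = g.hom (ev1 J ψ) := by
  simp [ev1]

/-- augmentation -/
def aug (J : Ideal R) (n : ℕ) : (PJ J n).complex.X 0 ⟶ ModuleCat.of R (R ⧸ J ^ n) :=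
  (PJ J n).π.f 0

theorem ph_aug (J : Ideal R) {n n' : ℕ} (h : n ≤ n') :
    (ph J h).f 0 ≫ aug J n = aug J n' ≫ tr J h := ph_comm J h

theorem d_aug (J : Ideal R) (n : ℕ) : (PJ J n).complex.d 1 0 ≫ aug J n = 0 :=
  (PJ J n).complex_d_comp_π_f_zero

theorem aug_desc (J : Ideal R) (n : ℕ) {Y : ModuleCat.{u} R} (k : (PJ J n).complex.X 0 ⟶ Y)
    (hk : (PJ J n).complex.d 1 0 ≫ k = 0) :
    ∃ w : ModuleCat.of R (R ⧸ J ^ n) ⟶ Y, aug J n ≫ w = k :=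
  ⟨(PJ J n).exact₀.desc _ hk, (PJ J n).exact₀.g_desc _ hk⟩

instance (J : Ideal R) (n : ℕ) : Epi (aug J n) :=
  inferInstanceAs (Epi ((PJ J n).π.f 0))

def shiftRel0 : Submodule R (LCO J 1 S.X₁ × S.X₃) where
  carrier := {p | ∃ n, ∃ f : (PJ J n).complex.X 1 ⟶ S.X₁,
    ∃ ψ : ModuleCat.of R (R ⧸ J ^ n) ⟶ S.X₃,
    ∃ g : (PJ J n).complex.X 0 ⟶ S.X₂, Rep J 1 n f p.1 ∧ ev1 J ψ = p.2 ∧ g ≫ S.g = aug J n ≫ ψ ∧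
      (PJ J n).complex.d 1 0 ≫ g = f ≫ S.f}
  zero_mem' := ⟨0, 0, 0, 0, Rep.zero, by simp [ev1], by simp, by simp⟩
  add_mem' := by
    rintro ⟨a, b⟩ ⟨a', b'⟩ ⟨n, f, h, g, h1, h2, h3, h4⟩ ⟨n', f', h', g', h1', h2', h3', h4'⟩
    have hn : n ≤ max n n' := le_max_left _ _
    have hn' : n' ≤ max n n' := le_max_right _ _
    refine ⟨max n n', _, tr J hn ≫ h + tr J hn' ≫ h', (ph J hn).f 0 ≫ g + (ph J hn').f 0 ≫ g',
      (h1.lift hn).add (h1'.lift hn'), ?_, ?_, ?_⟩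
    · dsimp only at h2 h2' ⊢
      rw [Prod.snd_add, ← h2, ← h2', ← ev1_tr hn h, ← ev1_tr hn' h']
      simp [ev1]
    · rw [Preadditive.add_comp, Category.assoc, Category.assoc, h3, h3', Preadditive.comp_add,
        ← Category.assoc, ← Category.assoc, ← Category.assoc, ← Category.assoc, ph_aug, ph_aug]
    · simp only [Preadditive.comp_add, Preadditive.add_comp, Category.assoc, ← h4, ← h4']
      simp
  smul_mem' := by
    rintro r ⟨a, b⟩ ⟨n, f, h, g, h1, h2, h3, h4⟩
    exact ⟨n, _, r • h, r • g, h1.smul r, by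
      dsimp only at h2
      rw [Prod.smul_mk, ← h2]; rfl, by simp [h3], by simp [h4]⟩

theorem shift_equiv0 (hS : S.ShortExact) : Nonempty (LCO J 1 S.X₁ ≃ₗ[R] (Gam J S.X₃ ⧸
    (Submodule.comap (Gam J S.X₃).subtype (Submodule.map S.g.hom (Gam J S.X₂))))) := by
  have : Mono S.f := hS.mono_f
  have : Epi S.g := hS.epi_g
  have hgam : ∀ a b, (a, b) ∈ shiftRel0 J S → b ∈ Gam J S.X₃ := by
    rintro a b ⟨n, f, h, g, h1, h2, h3, h4⟩
    rw [← show ev1 J h = b from h2]; exact ev1_mem _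
  refine equivOfRel (Submodule.comap (LinearMap.prodMap LinearMap.id (Gam J S.X₃).subtype)
    (shiftRel0 J S)) _ ?_ ?_ ?_ ?_
  · intro a
    obtain ⟨n, f, hf⟩ := Rep.surj a
    have hex := (PJ J n).exact_succ 0
    let g := hex.descToInjective (f ≫ S.f) (by
      dsimp; rw [← Category.assoc, hf.cocycle, zero_comp])
    have hg : (PJ J n).complex.d 1 0 ≫ g = f ≫ S.f := hex.comp_descToInjective _ _
    have hc : (PJ J n).complex.d 1 0 ≫ g ≫ S.g = 0 := by
      rw [← Category.assoc, hg, Category.assoc, S.zero, comp_zero]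
    obtain ⟨ψ, hψ⟩ := aug_desc J n _ hc
    have hmem : (a, ev1 J ψ) ∈ shiftRel0 J S := ⟨n, f, ψ, g, hf, rfl, hψ.symm, hg⟩
    exact ⟨⟨_, hgam _ _ hmem⟩, hmem⟩
  · rintro ⟨b, n, hb⟩
    obtain ⟨ψ, rfl⟩ := exists_ev1 hb
    let g := Projective.factorThru (aug J n ≫ ψ) S.g
    have hg : g ≫ S.g = aug J n ≫ ψ := Projective.factorThru_comp _ S.g
    have hc : ((PJ J n).complex.d 1 0 ≫ g) ≫ S.g = 0 := by
      rw [Category.assoc, hg, ← Category.assoc, d_aug, zero_comp]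
    let f := hS.exact.lift _ hc
    have hf : f ≫ S.f = (PJ J n).complex.d 1 0 ≫ g := hS.exact.lift_f _ _
    have hfc : (PJ J n).complex.d 2 1 ≫ f = 0 := by
      rw [← cancel_mono S.f, Category.assoc, hf]; simp
    obtain ⟨a, ha⟩ := Rep.total hfc
    exact ⟨a, n, f, ψ, g, ha, rfl, hg, hf.symm⟩
  · rintro ⟨b, hbG⟩ ⟨n, f, h, g, h1, h2, h3, h4⟩
    obtain ⟨n', hn, u, hu⟩ := Rep.of_zero h1
    have hz : (PJ J n').complex.d 1 0 ≫ ((ph J hn).f 0 ≫ g - u ≫ S.f) = 0 := by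
      rw [Preadditive.comp_sub, ← Category.assoc _ u, hu, ← Category.assoc _ _ g,
        ← HomologicalComplex.Hom.comm, Category.assoc, h4, Category.assoc, sub_self]
    obtain ⟨w, hw⟩ := aug_desc J n' _ hz
    refine ⟨ev1 J w, ev1_mem w, ?_⟩
    change S.g.hom (ev1 J w) = b
    rw [← show ev1 J h = b from h2, ← ev1_comp, ← ev1_tr hn]
    congr 1
    rw [← cancel_epi (aug J n'), ← Category.assoc, hw]
    rw [← Category.assoc, ← ph_aug]
    simp [h3]
  · rintro a ⟨b, hbG⟩ ⟨n, f, h, g, h1, h2, h3, h4⟩ ⟨e, ⟨m, hm⟩, he⟩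
    have hn : n ≤ max n m := le_max_left _ _
    obtain ⟨ψ, rfl⟩ := exists_ev1 (n := max n m)
      (fun a ha => hm a (Ideal.pow_le_pow_right (le_max_right _ _) ha))
    have hψ : ψ ≫ S.g = tr J hn ≫ h := by
      apply ev1_inj
      rw [ev1_comp, ev1_tr]
      exact he.trans h2.symm
    have hz : ((ph J hn).f 0 ≫ g - aug J _ ≫ ψ) ≫ S.g = 0 := by
      rw [Preadditive.sub_comp, Category.assoc, Category.assoc, hψ, h3, ← Category.assoc,
        ← Category.assoc, ph_aug, sub_self]
    let u := hS.exact.lift _ hz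
    have hu : u ≫ S.f = _ := hS.exact.lift_f _ _
    have h1' := h1.lift hn
    have : (PJ J (max n m)).complex.d 1 0 ≫ u = (ph J hn).f 1 ≫ f := by
      rw [← cancel_mono S.f, Category.assoc, hu, Category.assoc, ← h4, Preadditive.comp_sub,
        ← Category.assoc _ _ ψ, d_aug]
      simp
    have ha := Rep.bd (J := J) u
    rw [this] at ha
    exact h1'.fun ha
end shift
end
end LC

namespace LC
open CategoryTheory Limits Opposite
noncomputable section
variable {R : Type u} [CommRing R]

theorem gam_mono_map {J : Ideal R} {Y Z : Type*} [AddCommGroup Y] [Module R Y] [AddCommGroup Z]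
    [Module R Z] (f : Y →ₗ[R] Z) {y : Y} (h : y ∈ Gam J Y) : f y ∈ Gam J Z := by
  obtain ⟨n, hn⟩ := h
  exact ⟨n, fun a ha => by rw [← map_smul, hn a ha, map_zero]⟩

theorem gam_of_inj {J : Ideal R} {Y Z : Type*} [AddCommGroup Y] [Module R Y] [AddCommGroup Z]
    [Module R Z] (f : Y →ₗ[R] Z) (hf : Function.Injective f) {y : Y} (h : f y ∈ Gam J Z) :
    y ∈ Gam J Y := by
  obtain ⟨n, hn⟩ := h
  exact ⟨n, fun a ha => hf (by rw [map_smul, hn a ha, map_zero])⟩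

theorem gam_of_pow_le {I J : Ideal R} {N : ℕ} (h : I ^ N ≤ J) (Y : Type*) [AddCommGroup Y]
    [Module R Y] : Gam J Y ≤ Gam I Y := by
  rintro y ⟨n, hn⟩
  refine ⟨N * n, fun a ha => hn a ?_⟩
  rw [pow_mul] at ha
  exact Ideal.pow_right_mono h n ha

theorem mem_gam_sup {J : Ideal R} {x : R} {Y : Type*} [AddCommGroup Y] [Module R Y] {y : Y} :
    y ∈ Gam (J ⊔ Ideal.span {x}) Y ↔ y ∈ Gam J Y ∧ ∃ b : ℕ, x ^ b • y = 0 := by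
  constructor
  · rintro ⟨n, hn⟩
    refine ⟨⟨n, fun a ha => hn a (Ideal.pow_right_mono le_sup_left n ha)⟩, n, hn _ ?_⟩
    exact Ideal.pow_mem_pow (Ideal.mem_sup_right (Ideal.mem_span_singleton_self x)) n
  · rintro ⟨⟨n, hn⟩, b, hb⟩
    refine ⟨n + b, fun a ha => ?_⟩
    have := Ideal.sup_pow_add_le_pow_sup_pow ha
    rw [Ideal.span_singleton_pow] at this
    obtain ⟨c, hc, e, he, rfl⟩ := Submodule.mem_sup.1 this
    obtain ⟨e, rfl⟩ := Ideal.mem_span_singleton'.1 he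
    rw [add_smul, hn c hc, mul_smul, hb, smul_zero, add_zero]

theorem gam_injective [IsNoetherianRing R] (J : Ideal R) (E : Type u) [AddCommGroup E] [Module R E]
    [hE : Module.Injective R E] : Module.Injective R (Gam J E) := by
  apply Module.Baer.injective
  intro I g
  -- uniform exponent
  obtain ⟨n, hn⟩ : ∃ n : ℕ, ∀ (y : I), ∀ a ∈ J ^ n, a • g y = 0 := by
    obtain ⟨s, hs⟩ := (Module.Finite.iff_fg.1 (inferInstance : Module.Finite R (LinearMap.range g)))
    have : ∀ t : Finset (Gam J E), ∃ n : ℕ, ∀ y ∈ t, ∀ a ∈ J ^ n, a • y = 0 := by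
      classical
      intro t
      induction t using Finset.induction with
      | empty => exact ⟨0, by simp⟩
      | insert y t hy ih =>
        obtain ⟨n, hn⟩ := ih
        obtain ⟨m, hm⟩ := y.2
        refine ⟨max n m, fun z hz a ha => ?_⟩
        rcases Finset.mem_insert.1 hz with rfl | hz
        · exact Subtype.ext (hm a (Ideal.pow_le_pow_right (le_max_right _ _) ha))
        · exact hn z hz a (Ideal.pow_le_pow_right (le_max_left _ _) ha)
    obtain ⟨n, hn⟩ := this s
    refine ⟨n, fun y a ha => ?_⟩
    have hy : g y ∈ Submodule.span R (s : Set (Gam J E)) := by rw [hs]; exact ⟨y, rfl⟩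
    refine Submodule.span_induction (p := fun z _ => a • z = 0) (fun z hz => hn z hz a ha) (smul_zero _)
      (fun z w _ _ h1 h2 => by rw [smul_add, h1, h2, add_zero])
      (fun r z _ h => by rw [smul_comm, h, smul_zero]) hy
  obtain ⟨k, hk⟩ := Ideal.exists_pow_inf_eq_pow_smul (M := R) J (I : Submodule R R)
  have hN : ∀ y ∈ J ^ (n + k), ∀ hy : y ∈ I, g ⟨y, hy⟩ = 0 := by
    intro y hyJ hy
    have h1 : y ∈ J ^ (n + k) • (⊤ : Submodule R R) ⊓ I := ⟨by simpa using hyJ, hy⟩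
    rw [hk _ (Nat.le_add_left k n), Nat.add_sub_cancel] at h1
    have h2 : y ∈ J ^ n • (I : Submodule R R) := Submodule.smul_mono le_rfl inf_le_right h1
    have h3 : ∀ z ∈ J ^ n • (I : Submodule R R), ∃ hz : z ∈ I, g ⟨z, hz⟩ = 0 := by
      intro z hz
      induction hz using Submodule.smul_induction_on' with
      | smul a ha b hb =>
        refine ⟨I.smul_mem _ hb, ?_⟩
        have : (⟨a • b, I.smul_mem a hb⟩ : I) = a • ⟨b, hb⟩ := rfl
        rw [this, map_smul]
        exact hn _ a ha
      | add z hz w hw h1 h2 =>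
        obtain ⟨hz', h1⟩ := h1
        obtain ⟨hw', h2⟩ := h2
        refine ⟨I.add_mem hz' hw', ?_⟩
        have : (⟨z + w, I.add_mem hz' hw'⟩ : I) = ⟨z, hz'⟩ + ⟨w, hw'⟩ := rfl
        rw [this, map_add, h1, h2, add_zero]
    exact (h3 y h2).2
  let q : Submodule R R := J ^ (n + k)
  let p : Submodule R I := Submodule.comap (Submodule.subtype I) q
  let f : (I ⧸ p) →ₗ[R] (R ⧸ q) := Submodule.mapQ p q (Submodule.subtype I) le_rfl
  have hf : Function.Injective f := by
    rw [← LinearMap.ker_eq_bot]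
    dsimp only [f]
    rw [Submodule.mapQ, Submodule.ker_liftQ_eq_bot]
    rintro y hy
    rw [LinearMap.mem_ker, LinearMap.comp_apply, Submodule.mkQ_apply, Submodule.Quotient.mk_eq_zero] at hy
    exact hy
  let g2 : (I ⧸ p) →ₗ[R] E := p.liftQ ((Gam J E).subtype ∘ₗ g) (by
    rintro ⟨y, hy⟩ hyp
    have := hN y hyp hy
    simp [this])
  obtain ⟨h, hh⟩ := hE.out f hf g2
  let g' : R →ₗ[R] E := h ∘ₗ q.mkQ
  have hg' : ∀ r, g' r ∈ Gam J E := by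
    intro r
    refine ⟨n + k, fun a ha => ?_⟩
    dsimp only [g', LinearMap.comp_apply]
    rw [← map_smul, ← map_smul]
    have : q.mkQ (a • r) = 0 := by
      rw [Submodule.mkQ_apply, Submodule.Quotient.mk_eq_zero]
      exact Ideal.mul_mem_right _ _ ha
    rw [this, map_zero]
  refine ⟨g'.codRestrict _ hg', fun y hy => ?_⟩
  apply Subtype.ext
  exact hh (p.mkQ ⟨y, hy⟩)

/-- quasi-divisibility -/
theorem qd [IsNoetherianRing R] {J : Ideal R} {E : Type u} [AddCommGroup E] [Module R E]
    [hE : Module.Injective R E] (x : R) (s : ℕ) {v : E} (hv : v ∈ Gam J E) :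
    ∃ v' ∈ Gam J E, ∃ b : ℕ, x ^ b • (x ^ s • v' - v) = 0 := by
  have hG := gam_injective J E
  obtain ⟨b, hb⟩ : ∃ b : ℕ, ∀ r : R, r * x ^ (b + s) = 0 → r * x ^ b = 0 := by
    let F : ℕ →o Submodule R R :=
      ⟨fun b => LinearMap.ker (LinearMap.toSpanSingleton R R (x ^ b)), by
        apply monotone_nat_of_le_succ
        intro n r hr
        simp only [LinearMap.mem_ker, LinearMap.toSpanSingleton_apply, smul_eq_mul] at hr ⊢
        rw [pow_succ, ← mul_assoc, hr, zero_mul]⟩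
    obtain ⟨b, hb⟩ := monotone_stabilizes_iff_noetherian.2 (inferInstance : IsNoetherian R R) F
    refine ⟨b, fun r hr => ?_⟩
    have h2 : r ∈ F (b + s) := by simpa [F] using hr
    rw [← hb _ (Nat.le_add_right b s)] at h2
    simpa [F] using h2
  let p : Submodule R R := LinearMap.ker (LinearMap.toSpanSingleton R R (x ^ (b + s)))
  let f : (R ⧸ p) →ₗ[R] R := p.liftQ (LinearMap.toSpanSingleton R R (x ^ (b + s))) le_rfl
  have hf : Function.Injective f := by
    rw [← LinearMap.ker_eq_bot]
    exact Submodule.ker_liftQ_eq_bot _ _ _ le_rfl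
  let g : (R ⧸ p) →ₗ[R] Gam J E := p.liftQ (LinearMap.toSpanSingleton R (Gam J E) (x ^ b • ⟨v, hv⟩))
    (by
      intro r hr
      simp only [p, LinearMap.mem_ker, LinearMap.toSpanSingleton_apply, smul_eq_mul] at hr ⊢
      rw [smul_smul, hb r hr, zero_smul])
  obtain ⟨h, hh⟩ := hG.out f hf g
  have h1 := hh (p.mkQ 1)
  have h2 : f (p.mkQ 1) = x ^ (b + s) :=
    (p.liftQ_apply _ _).trans (by rw [LinearMap.toSpanSingleton_apply, one_smul])
  have h3 : g (p.mkQ 1) = x ^ b • ⟨v, hv⟩ :=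
    (p.liftQ_apply _ _).trans (by rw [LinearMap.toSpanSingleton_apply, one_smul])
  rw [h2, h3, ← mul_one (x ^ (b + s)), ← smul_eq_mul, map_smul] at h1
  refine ⟨h 1, (h 1).2, b, ?_⟩
  have h4 := congrArg Subtype.val h1
  rw [smul_sub, smul_smul, ← pow_add, sub_eq_zero]
  exact h4

/-- An injective resolution with all terms torsion with respect to `a`. -/
structure Res (a : Ideal R) (M : Type u) [AddCommGroup M] [Module R M] where
  C : ℕ → ModuleCat.{u} R
  E : ℕ → ModuleCat.{u} R
  ι : ∀ k, C k →ₗ[R] E k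
  π : ∀ k, E k →ₗ[R] C (k+1)
  inj : ∀ k, Function.Injective (ι k)
  surj : ∀ k, Function.Surjective (π k)
  ex : ∀ k e, π k e = 0 ↔ ∃ c, ι k c = e
  injE : ∀ k, Module.Injective R (E k)
  torC : ∀ k c, c ∈ Gam a (C k)
  torE : ∀ k e, e ∈ Gam a (E k)
  e : M ≃ₗ[R] C 0
  
theorem exists_res [IsNoetherianRing R] (a : Ideal R) (M : Type u) [AddCommGroup M] [Module R M]
    (hM : ∀ m, m ∈ Gam a M) : Nonempty (Res a M) := by
  let E' : ModuleCat.{u} R → ModuleCat.{u} R := fun C =>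
    ModuleCat.of R (Gam a ((Injective.under C : ModuleCat.{u} R) : Type u))
  have hE' : ∀ C, Module.Injective R (E' C) := by
    intro C
    have : Module.Injective R (Injective.under C : ModuleCat.{u} R) :=
      (Module.injective_iff_injective_object R _).2 (inferInstance : Injective (Injective.under C))
    exact gam_injective a _
  have hu : ∀ C : ModuleCat.{u} R, Function.Injective (Injective.ι C) := fun C =>
    (ModuleCat.mono_iff_injective _).1 inferInstance
  let T := {C : ModuleCat.{u} R // ∀ c, c ∈ Gam a C}
  let ι' : ∀ C : T, C.1 →ₗ[R] E' C.1 := fun C =>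
    (Injective.ι C.1).hom.codRestrict _ (fun c => gam_mono_map _ (C.2 c))
  have torE' : ∀ C e, e ∈ Gam a (E' C) := by
    rintro C ⟨e, n, hn⟩
    exact ⟨n, fun a ha => Subtype.ext (hn a ha)⟩
  let nxt : T → T := fun C => ⟨ModuleCat.of R (E' C.1 ⧸ LinearMap.range (ι' C)), by
    intro c
    obtain ⟨e, rfl⟩ := Submodule.mkQ_surjective _ c
    exact gam_mono_map _ (torE' _ e)⟩
  let Cs : ℕ → T := fun k => nxt^[k] ⟨ModuleCat.of R M, hM⟩
  have hCs : ∀ k, Cs (k+1) = nxt (Cs k) := fun k => Function.iterate_succ_apply' _ _ _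
  let D : ∀ k, {p : E' (Cs k).1 →ₗ[R] (Cs (k+1)).1 // Function.Surjective p ∧
    ∀ e, p e = 0 ↔ ∃ c, ι' (Cs k) c = e} := fun k => by
      rw [hCs k]
      refine ⟨Submodule.mkQ _, Submodule.mkQ_surjective _, fun e => ?_⟩
      rw [Submodule.mkQ_apply, Submodule.Quotient.mk_eq_zero, LinearMap.mem_range]
  exact ⟨{
    C := fun k => (Cs k).1
    E := fun k => E' (Cs k).1
    ι := fun k => ι' (Cs k)
    π := fun k => (D k).1
    inj := fun k x y h => hu _ (congrArg Subtype.val h)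
    surj := fun k => (D k).2.1
    ex := fun k => (D k).2.2
    injE := fun k => hE' _
    torC := fun k => (Cs k).2
    torE := fun k => torE' _
    e := LinearEquiv.refl _ _ }⟩

end
end LC

namespace LC
open CategoryTheory Limits Opposite
noncomputable section
variable {R : Type u} [CommRing R]

/-- The submodule `(x_1^t, ..., x_d^t) M`. -/
def QQ (M : Type*) [AddCommGroup M] [Module R M] {d : ℕ} (x : Fin d → R) (t : ℕ) : Submodule R M :=
  Ideal.span (Set.range fun i => x i ^ t) • ⊤

/-- `H` together with `θ` is the direct limit of the modules `M/(x^t)M`. -/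
structure IsLim {M H : Type*} [AddCommGroup M] [Module R M] [AddCommGroup H] [Module R H]
    {d : ℕ} (x : Fin d → R) (θ : ℕ → M →ₗ[R] H) : Prop where
  surj : ∀ h, ∃ t m, θ t m = h
  step : ∀ t m, θ (t+1) ((∏ i, x i) • m) = θ t m
  ker : ∀ t m, θ t m = 0 ↔ ∃ s, (∏ i, x i) ^ s • m ∈ QQ M x (t + s)

section QQ
variable {M : Type*} [AddCommGroup M] [Module R M]

theorem cons_pow {d : ℕ} (a : R) (x : Fin d → R) (t : ℕ) :
    (fun i => (Fin.cons a x : Fin (d+1) → R) i ^ t) = Fin.cons (a ^ t) (fun i => x i ^ t) := by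
  funext i
  refine Fin.cases ?_ (fun i => ?_) i <;> simp

theorem mem_QQ_cons {d : ℕ} (a : R) (x : Fin d → R) (t : ℕ) (m : M) :
    m ∈ QQ M (Fin.cons a x : Fin (d+1) → R) t ↔ ∃ m1, m - a ^ t • m1 ∈ QQ M x t := by
  unfold QQ
  rw [cons_pow, Fin.range_cons, Ideal.span_insert, Submodule.sup_smul, Submodule.mem_sup]
  constructor
  · rintro ⟨y, hy, z, hz, rfl⟩
    rw [Submodule.ideal_span_singleton_smul] at hy
    obtain ⟨m1, -, rfl⟩ := (Submodule.mem_smul_pointwise_iff_exists _ _ _).1 hy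
    exact ⟨m1, by simpa using hz⟩
  · rintro ⟨m1, hm⟩
    refine ⟨a ^ t • m1, ?_, _, hm, by abel⟩
    exact Submodule.smul_mem_smul (Ideal.mem_span_singleton_self _) trivial

theorem smul_mem_QQ {d : ℕ} (x : Fin d → R) (t : ℕ) (i : Fin d) (m : M) :
    x i ^ t • m ∈ QQ M x t :=
  Submodule.smul_mem_smul (Ideal.subset_span ⟨i, rfl⟩) trivial

theorem mem_QQ_ind {d : ℕ} (x : Fin d → R) (t : ℕ) (N : Submodule R M)
    (h : ∀ i m, x i ^ t • m ∈ N) : QQ M x t ≤ N := by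
  unfold QQ
  rw [Submodule.smul_le]
  intro r hr m _
  induction hr using Submodule.span_induction with
  | mem r hr => obtain ⟨i, rfl⟩ := hr; exact h i m
  | zero => rw [zero_smul]; exact N.zero_mem
  | add r s _ _ h1 h2 => rw [add_smul]; exact N.add_mem h1 h2
  | smul c r _ h1 => rw [smul_assoc]; exact N.smul_mem _ h1

theorem prod_smul_QQ {d : ℕ} (x : Fin d → R) (u c : ℕ) {m : M} (h : m ∈ QQ M x u) :
    (∏ i, x i) ^ c • m ∈ QQ M x (u + c) := by
  have : QQ M x u ≤ Submodule.comap (LinearMap.lsmul R M ((∏ i, x i) ^ c)) (QQ M x (u+c)) := by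
    apply mem_QQ_ind
    intro i m
    change (∏ i, x i) ^ c • x i ^ u • m ∈ QQ M x (u + c)
    classical
    rw [← Finset.mul_prod_erase Finset.univ x (Finset.mem_univ i), mul_pow, smul_smul,
      show (x i ^ c * (∏ j ∈ Finset.univ.erase i, x j) ^ c) * x i ^ u
        = x i ^ (u + c) * (∏ j ∈ Finset.univ.erase i, x j) ^ c by ring, mul_smul]
    exact smul_mem_QQ x _ i _
  exact this h
end QQ

variable {M : Type u} [AddCommGroup M] [Module R M] {a : Ideal R} (ρ : Res a M)

def BB (J : Ideal R) : ∀ k, Submodule R (ρ.C k)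
  | 0 => ⊥
  | (k+1) => Submodule.map (ρ.π k) (Gam J (ρ.E k))

def VV (J : Ideal R) (k : ℕ) : Prop :=
  ∀ i, k ≤ i → ∀ z ∈ Gam J (ρ.C (i+1)), ∃ w ∈ Gam J (ρ.E i), ρ.π i w = z

theorem VV_base : VV ρ a 0 := by
  intro i _ z _
  obtain ⟨w, rfl⟩ := ρ.surj i z
  exact ⟨w, ρ.torE i w, rfl⟩

theorem piι (k : ℕ) (c : ρ.C k) : ρ.π k (ρ.ι k c) = 0 := (ρ.ex k _).2 ⟨c, rfl⟩

theorem VV_step [IsNoetherianRing R] {J : Ideal R} {k : ℕ} (h : VV ρ J k) (x : R) :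
    VV ρ (J ⊔ Ideal.span {x}) (k+1) := by
  intro i hi z hz
  obtain ⟨i, rfl⟩ : ∃ i', i = i' + 1 := ⟨i - 1, by omega⟩
  obtain ⟨hz, b, hb⟩ := mem_gam_sup.1 hz
  obtain ⟨w, hw, rfl⟩ := h (i+1) (by omega) z hz
  rw [← map_smul] at hb
  obtain ⟨c, hc⟩ := (ρ.ex _ _).1 hb
  have hcG : c ∈ Gam J (ρ.C (i+1)) := gam_of_inj (ρ.ι _) (ρ.inj _) (by
    rw [hc]; exact Submodule.smul_mem _ _ hw)
  obtain ⟨v, hv, rfl⟩ := h i (by omega) c hcG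
  have := ρ.injE i
  obtain ⟨v', hv', e, he⟩ := qd x b hv
  refine ⟨w - ρ.ι _ (ρ.π _ v'), mem_gam_sup.2 ⟨Submodule.sub_mem _ hw
    (gam_mono_map _ (gam_mono_map _ hv')), e + b, ?_⟩, ?_⟩
  · have h2 := congrArg (fun y => ρ.ι _ (ρ.π _ y)) he
    simp only [map_smul, map_sub, map_zero, hc] at h2
    rw [pow_add, mul_smul, smul_sub (x ^ b), ← neg_eq_zero, ← smul_neg, neg_sub]
    exact h2
  · rw [map_sub, piι, sub_zero]

/-- connecting relation -/
def TT (J : Ideal R) (x : R) (k s : ℕ) : Submodule R (ρ.C k × ρ.C (k+1)) where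
  carrier := {p | ∃ w ∈ Gam J (ρ.E k), ∃ a : ℕ, p.2 = ρ.π k w ∧ x ^ a • (x ^ s • w - ρ.ι k p.1) = 0}
  zero_mem' := ⟨0, Submodule.zero_mem _, 0, by simp⟩
  add_mem' := by
    rintro ⟨p, q⟩ ⟨p', q'⟩ ⟨w, hw, a, h1, h2⟩ ⟨w', hw', a', h1', h2'⟩
    dsimp only at h1 h2 h1' h2'
    refine ⟨w + w', Submodule.add_mem _ hw hw', a + a', ?_, ?_⟩
    · simp [h1, h1']
    · have e1 := congrArg (x ^ a' • ·) h2
      have e2 := congrArg (x ^ a • ·) h2'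
      simp only [smul_zero, smul_smul, ← pow_add] at e1 e2
      simp only [Prod.mk_add_mk, map_add, smul_add]
      rw [add_sub_add_comm, smul_add, add_comm a a', e1, add_comm a' a, e2, add_zero]
  smul_mem' := by
    rintro r ⟨p, q⟩ ⟨w, hw, a, h1, h2⟩
    dsimp only at h1 h2
    refine ⟨r • w, Submodule.smul_mem _ _ hw, a, by simp [h1], ?_⟩
    simp only [Prod.smul_mk, map_smul]
    rw [smul_comm _ r w, ← smul_sub, smul_comm, h2, smul_zero]

section TT
variable [IsNoetherianRing R] {J : Ideal R} {x : R} {k : ℕ} 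

theorem TT_total (s : ℕ) {z : ρ.C k} (hz : z ∈ Gam J (ρ.C k)) : ∃ z', (z, z') ∈ TT ρ J x k s := by
  have := ρ.injE k
  obtain ⟨w, hw, b, hb⟩ := qd x s (gam_mono_map (ρ.ι k) hz)
  exact ⟨_, w, hw, b, rfl, hb⟩

theorem TT_mem {s : ℕ} {z z'} (h : (z, z') ∈ TT ρ J x k s) :
    z' ∈ Gam (J ⊔ Ideal.span {x}) (ρ.C (k+1)) := by
  obtain ⟨w, hw, a, h1, h2⟩ := h
  dsimp only at h1 h2
  subst h1
  refine mem_gam_sup.2 ⟨gam_mono_map _ hw, a + s, ?_⟩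
  have := congrArg (ρ.π k) h2
  rw [map_smul, map_sub, piι, sub_zero, map_smul, smul_smul, ← pow_add, map_zero] at this
  exact this

theorem TT_surj (hV : VV ρ J k) {z'} (h : z' ∈ Gam (J ⊔ Ideal.span {x}) (ρ.C (k+1))) :
    ∃ s, ∃ z ∈ Gam J (ρ.C k), (z, z') ∈ TT ρ J x k s := by
  obtain ⟨h1, b, hb⟩ := mem_gam_sup.1 h
  obtain ⟨w, hw, rfl⟩ := hV k le_rfl _ h1
  rw [← map_smul] at hb
  obtain ⟨z, hz⟩ := (ρ.ex _ _).1 hb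
  exact ⟨b, z, gam_of_inj (ρ.ι k) (ρ.inj k) (by rw [hz]; exact Submodule.smul_mem _ _ hw),
    w, hw, 0, rfl, by simp [hz]⟩

theorem TT_step {s : ℕ} {z z'} (h : (z, z') ∈ TT ρ J x k s) : (x • z, z') ∈ TT ρ J x k (s+1) := by
  obtain ⟨w, hw, a, h1, h2⟩ := h
  refine ⟨w, hw, a, h1, ?_⟩
  dsimp only at h2 ⊢
  rw [map_smul, pow_succ', mul_smul, ← smul_sub, smul_comm, h2, smul_zero]

theorem TT_steps {s : ℕ} {z z'} (h : (z, z') ∈ TT ρ J x k s) (j : ℕ) :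
    (x ^ j • z, z') ∈ TT ρ J x k (s+j) := by
  induction j with
  | zero => simpa using h
  | succ j ih =>
    have := TT_step ρ ih
    rwa [smul_smul, ← pow_succ'] at this

theorem TT_ker {s : ℕ} {z z'} (h : (z, z') ∈ TT ρ J x k s) :
    z' ∈ BB ρ (J ⊔ Ideal.span {x}) (k+1) ↔
      ∃ n ∈ Gam J (ρ.C k), ∃ c : ℕ, x ^ c • (z - x ^ s • n) ∈ BB ρ J k := by
  obtain ⟨w, hw, a, h1, h2⟩ := h
  dsimp only at h1 h2
  subst h1
  constructor
  · rintro ⟨w', hw', e⟩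
    obtain ⟨hw1, b, hb⟩ := mem_gam_sup.1 hw'
    have e2 : ρ.π k (w - w') = 0 := by rw [map_sub, e, sub_self]
    obtain ⟨n, hn⟩ := (ρ.ex _ _).1 e2
    refine ⟨n, gam_of_inj (ρ.ι k) (ρ.inj k) (by rw [hn]; exact Submodule.sub_mem _ hw hw1),
      a + b, ?_⟩
    convert Submodule.zero_mem _
    apply ρ.inj k
    rw [map_smul, map_sub, map_smul, hn, map_zero]
    have h3 := congrArg (x ^ b • ·) h2
    have h4 := congrArg (x ^ (a + s) • ·) hb
    simp only [smul_zero] at h3 h4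
    linear_combination (norm := module) (-1 : R) • h3 + h4
  · rintro ⟨n, hn, c, hc⟩
    obtain ⟨n', hn', c', hc'⟩ : ∃ n' ∈ Gam J (ρ.C k), ∃ c' : ℕ, x ^ c' • (z - x ^ s • n') = 0 := by
      cases k with
      | zero => exact ⟨n, hn, c, hc⟩
      | succ k =>
        obtain ⟨v, hv, e⟩ := hc
        have := ρ.injE k
        obtain ⟨v', hv', b, hb⟩ := qd x (s + c) hv
        refine ⟨n + ρ.π k v', Submodule.add_mem _ hn (gam_mono_map _ hv'), b + c, ?_⟩
        have h3 := congrArg (ρ.π k) hb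
        rw [map_smul, map_sub, e, map_smul, map_zero] at h3
        linear_combination (norm := module) (-1 : R) • h3
    have h3 := congrArg (ρ.ι k) hc'
    rw [map_smul, map_sub, map_smul, map_zero] at h3
    refine ⟨w - ρ.ι k n', mem_gam_sup.2 ⟨Submodule.sub_mem _ hw (gam_mono_map _ hn'),
      a + c' + s, ?_⟩, by rw [map_sub, piι, sub_zero]⟩
    have h4 := congrArg (x ^ a • ·) h3
    have h5 := congrArg (x ^ c' • ·) h2
    simp only [smul_zero] at h4 h5
    linear_combination (norm := module) h4 + h5
end TT

structure RelLim {d : ℕ} {C : Type u} [AddCommGroup C] [Module R C] (x : Fin d → R)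
    (Θ : ℕ → Submodule R (M × C)) (G B : Submodule R C) : Prop where
  mem : ∀ t m z, (m, z) ∈ Θ t → z ∈ G
  total : ∀ t m, ∃ z, (m, z) ∈ Θ t
  surj : ∀ z ∈ G, ∃ t m, (m, z) ∈ Θ t
  step : ∀ t m z, (m, z) ∈ Θ t → ((∏ i, x i) • m, z) ∈ Θ (t+1)
  ker : ∀ t m z, (m, z) ∈ Θ t → (z ∈ B ↔ ∃ s, (∏ i, x i) ^ s • m ∈ QQ M x (t+s))

theorem RelLim.steps {d : ℕ} {C : Type u} [AddCommGroup C] [Module R C] {x : Fin d → R}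
    {Θ : ℕ → Submodule R (M × C)} {G B : Submodule R C} (H : RelLim x Θ G B) {t m z}
    (h : (m, z) ∈ Θ t) (j : ℕ) : ((∏ i, x i) ^ j • m, z) ∈ Θ (t + j) := by
  induction j with
  | zero => simpa using h
  | succ j ih =>
    have := H.step _ _ _ ih
    rwa [smul_smul, ← pow_succ'] at this

theorem relLim_step [IsNoetherianRing R] {d k : ℕ} {J : Ideal R} {x' : Fin d → R} (x : R)
    {Θ : ℕ → Submodule R (M × ρ.C k)} (hV : VV ρ J k)
    (H : RelLim x' Θ (Gam J (ρ.C k)) (BB ρ J k)) :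
    ∃ Θ' : ℕ → Submodule R (M × ρ.C (k+1)), RelLim (Fin.cons x x' : Fin (d+1) → R) Θ'
      (Gam (J ⊔ Ideal.span {x}) (ρ.C (k+1))) (BB ρ (J ⊔ Ideal.span {x}) (k+1)) := by
  have hprod : (∏ i, (Fin.cons x x' : Fin (d+1) → R) i) = x * ∏ i, x' i := by
    rw [Fin.prod_univ_succ]; simp
  let Θ' : ℕ → Submodule R (M × ρ.C (k+1)) := fun t =>
    { carrier := {p | ∃ z, (p.1, z) ∈ Θ t ∧ (z, p.2) ∈ TT ρ J x k t}
      zero_mem' := ⟨0, Submodule.zero_mem _, Submodule.zero_mem _⟩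
      add_mem' := by
        rintro ⟨p, q⟩ ⟨p', q'⟩ ⟨z, h1, h2⟩ ⟨z', h1', h2'⟩
        exact ⟨z + z', Submodule.add_mem _ h1 h1', Submodule.add_mem _ h2 h2'⟩
      smul_mem' := by
        rintro r ⟨p, q⟩ ⟨z, h1, h2⟩
        exact ⟨r • z, Submodule.smul_mem _ r h1, Submodule.smul_mem _ r h2⟩ }
  refine ⟨Θ', ?_, ?_, ?_, ?_, ?_⟩
  · rintro t m z' ⟨z, h1, h2⟩
    exact TT_mem ρ h2
  · intro t m
    obtain ⟨z, hz⟩ := H.total t m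
    obtain ⟨z', hz'⟩ := TT_total ρ (x := x) t (H.mem _ _ _ hz)
    exact ⟨z', z, hz, hz'⟩
  · intro z' hz'
    obtain ⟨s, z, hz, h⟩ := TT_surj ρ hV hz'
    obtain ⟨t, m, hm⟩ := H.surj z hz
    have h1 := H.steps hm s
    have h2 := TT_steps ρ h t
    refine ⟨t + s, x ^ t • (∏ i, x' i) ^ s • m, x ^ t • z, Submodule.smul_mem _ (x ^ t) h1, ?_⟩
    rwa [add_comm t s]
  · rintro t m z' ⟨z, h1, h2⟩
    rw [hprod, mul_smul]
    exact ⟨x • z, Submodule.smul_mem _ x (H.step _ _ _ h1), TT_step ρ h2⟩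
  · rintro t m z' ⟨z, h1, h2⟩
    dsimp only at h1 h2
    rw [TT_ker ρ h2]
    simp only [mem_QQ_cons, hprod]
    set P := ∏ i, x' i with hP
    constructor
    · rintro ⟨n, hn, c, hc⟩
      obtain ⟨j, m1, hm1⟩ := H.surj n hn
      have e1 := H.steps h1 j
      have e2 := H.steps hm1 t
      rw [add_comm j t] at e2
      have e3 := Submodule.smul_mem _ (x ^ c) (Submodule.sub_mem _ e1 (Submodule.smul_mem _ (x ^ t) e2))
      obtain ⟨s, hs⟩ := (H.ker _ _ _ e3).1 hc
      have e4 := Submodule.smul_mem _ (x ^ (s + j)) (prod_smul_QQ x' _ c hs)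
      refine ⟨s + j + c, P ^ (c + s + t) • m1, ?_⟩
      rw [show t + j + s + c = t + (s + j + c) by ring] at e4
      change x ^ (s + j) • P ^ c • P ^ s • x ^ c • (P ^ j • m - x ^ t • P ^ t • m1) ∈ _ at e4
      convert e4 using 1
      match_scalars <;> ring
    · rintro ⟨s, m1, hs⟩
      obtain ⟨n1, hn1⟩ := H.total (t + s) m1
      have e1 := H.steps h1 s
      have e3 := Submodule.sub_mem _ (Submodule.smul_mem _ (x ^ s) e1)
        (Submodule.smul_mem _ (x ^ (t + s)) hn1)
      refine ⟨n1, H.mem _ _ _ hn1, s, ?_⟩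
      have e4 : x ^ s • (z - x ^ t • n1) = x ^ s • z - x ^ (t + s) • n1 := by
        match_scalars <;> ring
      rw [e4]
      refine (H.ker _ _ _ e3).2 ⟨0, ?_⟩
      change P ^ 0 • (x ^ s • P ^ s • m - x ^ (t + s) • m1) ∈ QQ M x' (t + s)
      convert hs using 1
      match_scalars <;> ring

theorem relLim_all [IsNoetherianRing R] {d : ℕ} (x : Fin d → R) :
    VV ρ (a ⊔ Ideal.span (Set.range x)) d ∧ ∃ Θ : ℕ → Submodule R (M × ρ.C d),
      RelLim x Θ (Gam (a ⊔ Ideal.span (Set.range x)) (ρ.C d))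
        (BB ρ (a ⊔ Ideal.span (Set.range x)) d) := by
  induction d with
  | zero =>
    have : a ⊔ Ideal.span (Set.range x) = a := by
      rw [Set.range_eq_empty, Ideal.span_empty, sup_bot_eq]
    rw [this]
    refine ⟨VV_base ρ, fun _ => LinearMap.graph (ρ.e : M →ₗ[R] ρ.C 0), ?_, ?_, ?_, ?_, ?_⟩
    · intro t m z _
      exact ρ.torC 0 z
    · intro t m
      exact ⟨ρ.e m, by simp⟩
    · intro z _
      exact ⟨0, ρ.e.symm z, by simp⟩
    · intro t m z h
      simpa using h
    · intro t m z h
      have hz : z = ρ.e m := by simpa using h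
      have hq : ∀ n, QQ M x n = ⊥ := by
        intro n
        rw [QQ, Set.range_eq_empty, Ideal.span_empty, Submodule.bot_smul]
      simp [BB, hq, hz]
  | succ d ih =>
    obtain ⟨x0, x', rfl⟩ : ∃ x0 x', x = (Fin.cons x0 x' : Fin (d+1) → R) :=
      ⟨x 0, Fin.tail x, (Fin.cons_self_tail x).symm⟩
    have hJ : a ⊔ Ideal.span (Set.range (Fin.cons x0 x' : Fin (d+1) → R)) =
        (a ⊔ Ideal.span (Set.range x')) ⊔ Ideal.span {x0} := by
      rw [Fin.range_cons, Ideal.span_insert, sup_assoc, sup_comm (Ideal.span {x0})]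
    rw [hJ]
    obtain ⟨hV, Θ, hΘ⟩ := ih x'
    exact ⟨VV_step ρ hV x0, relLim_step ρ x0 hV hΘ⟩

theorem lc_quot (J : Ideal R) (k i : ℕ) : Nonempty (LCO J (k+1) (ρ.C i) ≃ₗ[R]
    (Gam J (ρ.C (i+k+1)) ⧸ Submodule.comap (Gam J (ρ.C (i+k+1))).subtype
      (Submodule.map (ρ.π (i+k)) (Gam J (ρ.E (i+k)))))) := by
  have hinj : ∀ i, Injective (ρ.E i) := fun i =>
    (Module.injective_iff_injective_object R _).1 (ρ.injE i)
  let S : ℕ → ShortComplex (ModuleCat.{u} R) := fun i =>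
    { f := ModuleCat.ofHom (ρ.ι i)
      g := ModuleCat.ofHom (ρ.π i)
      zero := by ext c; exact piι ρ i c }
  have hS : ∀ i, (S i).ShortExact := fun i =>
    { exact := by
        rw [ShortComplex.moduleCat_exact_iff]
        intro e he
        exact (ρ.ex i e).1 he
      mono_f := (ModuleCat.mono_iff_injective _).2 (ρ.inj i)
      epi_g := (ModuleCat.epi_iff_surjective _).2 (ρ.surj i) }
  induction k generalizing i with
  | zero =>
    have : Injective (S i).X₂ := hinj i
    exact shift_equiv0 J (S i) (hS i)
  | succ k ih =>
    have : Injective (S i).X₂ := hinj i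
    obtain ⟨e1⟩ := shift_equiv J (S i) (hS i) k
    obtain ⟨e2⟩ := ih (i+1)
    rw [show i + 1 + k = i + (k + 1) by ring] at e2
    exact ⟨e1.trans e2⟩

theorem exists_isLim_of_rel {d : ℕ} {C H : Type u} [AddCommGroup C] [Module R C] [AddCommGroup H]
    [Module R H] {x : Fin d → R} {Θ : ℕ → Submodule R (M × C)} {G B : Submodule R C}
    (h : RelLim x Θ G B) (e : H ≃ₗ[R] G ⧸ Submodule.comap G.subtype B) :
    ∃ θ : ℕ → M →ₗ[R] H, IsLim x θ := by
  choose z hz using h.total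
  have key : ∀ t m c (hc : (m, c) ∈ Θ t), Submodule.mkQ (Submodule.comap G.subtype B)
      ⟨z t m, h.mem _ _ _ (hz t m)⟩ = Submodule.mkQ _ ⟨c, h.mem _ _ _ hc⟩ := by
    intro t m c hc
    rw [← sub_eq_zero, ← map_sub, Submodule.mkQ_apply, Submodule.Quotient.mk_eq_zero]
    change z t m - c ∈ B
    have := Submodule.sub_mem _ (hz t m) hc
    rw [Prod.mk_sub_mk] at this
    exact (h.ker _ _ _ this).2 ⟨0, by simp⟩
  let θ : ℕ → M →ₗ[R] H := fun t =>
    { toFun := fun m => e.symm (Submodule.mkQ _ ⟨z t m, h.mem _ _ _ (hz t m)⟩)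
      map_add' := fun m m' => by
        rw [← map_add, ← map_add, key t (m + m') _ (Submodule.add_mem _ (hz t m) (hz t m'))]
        rfl
      map_smul' := fun r m => by
        rw [← map_smul, ← map_smul, key t (r • m) _ (Submodule.smul_mem _ r (hz t m))]
        rfl }
  have hθ : ∀ t m c (hc : (m, c) ∈ Θ t), θ t m = e.symm (Submodule.mkQ _ ⟨c, h.mem _ _ _ hc⟩) :=
    fun t m c hc => congrArg e.symm (key t m c hc)
  refine ⟨θ, ?_, ?_, ?_⟩
  · intro y
    obtain ⟨⟨c, hc⟩, hy⟩ := Submodule.mkQ_surjective _ (e y)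
    obtain ⟨t, m, hm⟩ := h.surj c hc
    exact ⟨t, m, by rw [hθ t m c hm, hy, e.symm_apply_apply]⟩
  · intro t m
    rw [hθ _ _ _ (hz t m), hθ _ _ _ (h.step _ _ _ (hz t m))]
  · intro t m
    rw [← h.ker _ _ _ (hz t m), hθ _ _ _ (hz t m), LinearEquiv.map_eq_zero_iff,
      Submodule.mkQ_apply, Submodule.Quotient.mk_eq_zero]
    rfl

theorem exists_isLim_lc [IsNoetherianRing R] (I : Ideal R) {d : ℕ} (hd : 0 < d) (x : Fin d → R)
    (M : Type u) [AddCommGroup M] [Module R M]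
    (h1 : Module.annihilator R M ⊔ Ideal.span (Set.range x) ≤ I)
    (h2 : ∃ N, I ^ N ≤ Module.annihilator R M ⊔ Ideal.span (Set.range x)) :
    ∃ θ : ℕ → M →ₗ[R] ((localCohomology I d).obj (ModuleCat.of R M)), IsLim x θ := by
  obtain ⟨ρ⟩ := exists_res (Module.annihilator R M) M (fun m => ⟨1, fun a ha => by
    rw [pow_one] at ha; exact Module.mem_annihilator.1 ha m⟩)
  obtain ⟨k, rfl⟩ : ∃ k, d = k + 1 := ⟨d - 1, by omega⟩
  obtain ⟨N, hN⟩ := h2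
  have hG : ∀ (Y : Type u) [AddCommGroup Y] [Module R Y], Gam I Y =
      Gam (Module.annihilator R M ⊔ Ideal.span (Set.range x)) Y := by
    intro Y _ _
    apply le_antisymm
    · exact gam_of_pow_le (N := 1) (by rwa [pow_one]) Y
    · exact gam_of_pow_le hN Y
  obtain ⟨-, Θ, hΘ⟩ := relLim_all ρ x
  obtain ⟨e⟩ := lc_quot ρ I k 0
  have hB : BB ρ (Module.annihilator R M ⊔ Ideal.span (Set.range x)) (k+1) =
    Submodule.map (ρ.π k) (Gam (Module.annihilator R M ⊔ Ideal.span (Set.range x)) (ρ.E k)) := rfl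
  rw [hB, ← hG, ← hG] at hΘ
  rw [Nat.zero_add] at e
  have e0 : (localCohomology I (k+1)).obj (ModuleCat.of R M) ≃ₗ[R] LCO I (k+1) (ρ.C 0) :=
    ((localCohomology I (k+1)).mapIso (LinearEquiv.toModuleIso ρ.e : ModuleCat.of R M ≅ ModuleCat.of R (ρ.C 0))).toLinearEquiv
  exact exists_isLim_of_rel hΘ (e0.trans e)

end
end LC

namespace LC
open CategoryTheory Limits Opposite
noncomputable section
variable {R : Type u} [CommRing R]

theorem exists_lim [IsNoetherianRing R] (M : Type u) [AddCommGroup M] [Module R M] {d : ℕ}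
    (x : Fin d → R) : ∃ (H : Type u) (_ : AddCommGroup H) (_ : Module R H) (θ : ℕ → M →ₗ[R] H),
      IsLim x θ := by
  obtain ⟨ρ⟩ := exists_res (⊥ : Ideal R) M (fun m => ⟨1, fun a ha => by
    rw [pow_one, Ideal.mem_bot] at ha
    rw [ha, zero_smul]⟩)
  obtain ⟨-, Θ, hΘ⟩ := relLim_all ρ x
  obtain ⟨θ, h⟩ := exists_isLim_of_rel hΘ (LinearEquiv.refl R _)
  exact ⟨_, _, _, θ, h⟩

section
variable {M H N : Type*} [AddCommGroup M] [Module R M] [AddCommGroup H] [Module R H]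
  [AddCommGroup N] [Module R N] {d : ℕ} {x : Fin d → R} {θ : ℕ → M →ₗ[R] H}

theorem IsLim.steps (h : IsLim x θ) (t s : ℕ) (m : M) :
    θ (t + s) ((∏ i, x i) ^ s • m) = θ t m := by
  induction s with
  | zero => simp
  | succ s ih => rw [← add_assoc, pow_succ', mul_smul, h.step, ih]

theorem IsLim.zero (h : IsLim x θ) {t : ℕ} {m : M} (hm : m ∈ QQ M x t) : θ t m = 0 :=
  (h.ker t m).2 ⟨0, by simpa using hm⟩

theorem IsLim.desc_wd (h : IsLim x θ) (φ : ℕ → M →ₗ[R] N)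
    (h1 : ∀ t m, φ (t+1) ((∏ i, x i) • m) = φ t m) (h2 : ∀ t, ∀ m ∈ QQ M x t, φ t m = 0)
    {t t' : ℕ} {m m' : M} (e : θ t m = θ t' m') : φ t m = φ t' m' := by
  have h1' : ∀ t s m, φ (t+s) ((∏ i, x i) ^ s • m) = φ t m := by
    intro t s m
    induction s with
    | zero => simp
    | succ s ih => rw [← add_assoc, pow_succ', mul_smul, h1, ih]
  rw [← h.steps t t', ← h.steps t' t, add_comm t' t, ← sub_eq_zero, ← map_sub, h.ker] at e
  obtain ⟨s, hs⟩ := e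
  rw [← h1' t t', ← h1' t' t, add_comm t' t, ← sub_eq_zero, ← map_sub, ← h1' _ s]
  exact h2 _ _ hs

theorem IsLim.desc (h : IsLim x θ) (φ : ℕ → M →ₗ[R] N)
    (h1 : ∀ t m, φ (t+1) ((∏ i, x i) • m) = φ t m) (h2 : ∀ t, ∀ m ∈ QQ M x t, φ t m = 0) :
    ∃ f : H →ₗ[R] N, ∀ t m, f (θ t m) = φ t m := by
  choose τ μ hτ using h.surj
  have wd : ∀ t m, φ (τ (θ t m)) (μ (θ t m)) = φ t m := fun t m => h.desc_wd φ h1 h2 (hτ _)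
  have h1' : ∀ t s m, φ (t+s) ((∏ i, x i) ^ s • m) = φ t m := by
    intro t s m
    induction s with
    | zero => simp
    | succ s ih => rw [← add_assoc, pow_succ', mul_smul, h1, ih]
  refine ⟨{ toFun := fun y => φ (τ y) (μ y), map_add' := ?_, map_smul' := ?_ }, wd⟩
  · intro a b
    have : a + b = θ (τ a + τ b) ((∏ i, x i) ^ (τ b) • μ a + (∏ i, x i) ^ (τ a) • μ b) := by
      rw [map_add, h.steps, add_comm (τ a), h.steps, hτ, hτ]
    rw [this, wd, map_add, h1', add_comm (τ a), h1']
  · intro r a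
    have : r • a = θ (τ a) (r • μ a) := by rw [map_smul, hτ]
    rw [this, wd, map_smul]
    rfl
end

/-- Melkersson's lemma. -/
theorem melkersson {A : Type*} [AddCommGroup A] [Module R A] (x : R)
    (ht : ∀ a : A, ∃ n : ℕ, x ^ n • a = 0) (K : Submodule R A)
    (hK : ∀ a : A, x • a = 0 → a ∈ K) [IsArtinian R K] : IsArtinian R A := by
  rw [← monotone_stabilizes_iff_artinian]
  intro N
  have hN : ∀ i j, i ≤ j → ∀ a, a ∈ OrderDual.ofDual (N j) → a ∈ OrderDual.ofDual (N i) :=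
    fun i j hij a ha => N.monotone hij ha
  let L : ℕ → ℕ → Submodule R K := fun i j =>
    { carrier := {a | x • (a : A) = 0 ∧ ∃ n ∈ OrderDual.ofDual (N i), x ^ j • n = a}
      zero_mem' := ⟨by simp, 0, Submodule.zero_mem _, by simp⟩
      add_mem' := by
        rintro a b ⟨h1, n, hn, h2⟩ ⟨h1', n', hn', h2'⟩
        exact ⟨by simp [h1, h1'], n + n', Submodule.add_mem _ hn hn', by simp [h2, h2']⟩
      smul_mem' := by
        rintro r a ⟨h1, n, hn, h2⟩
        exact ⟨by rw [Submodule.coe_smul, smul_comm, h1, smul_zero], r • n,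
          Submodule.smul_mem _ _ hn, by rw [smul_comm, h2]; rfl⟩ }
  have Li : ∀ i i' j j', i ≤ i' → j ≤ j' → L i' j' ≤ L i j := by
    rintro i i' j j' hi hj a ⟨h1, n, hn, h2⟩
    refine ⟨h1, x ^ (j' - j) • n, Submodule.smul_mem _ _ (hN _ _ hi _ hn), ?_⟩
    rw [smul_smul, ← pow_add, Nat.add_sub_cancel' hj, h2]
  have stab : ∀ f : ℕ → Submodule R K, (∀ n m, n ≤ m → f m ≤ f n) → ∃ n, ∀ m, n ≤ m → f n = f m := by
    intro f hf
    obtain ⟨n, hn⟩ := monotone_stabilizes_iff_artinian.2 (inferInstance : IsArtinian R K)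
      ⟨fun n => OrderDual.toDual (f n), fun a b hab => hf a b hab⟩
    exact ⟨n, hn⟩
  obtain ⟨j0, hj0⟩ := stab (fun n => L n n) (fun n m h => Li _ _ _ _ h h)
  choose I hI using fun j => stab (fun n => L n j) (fun n m h => Li _ _ _ _ h le_rfl)
  let T := j0 + ∑ j ∈ Finset.range j0, I j
  have hT : ∀ j i, T ≤ i → L T j ≤ L i j := by
    intro j i hi
    by_cases hj : j < j0
    · have hT' : I j ≤ T := (Finset.single_le_sum (fun _ _ => Nat.zero_le _)
        (Finset.mem_range.2 hj)).trans (Nat.le_add_left _ _)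
      exact ((hI j T hT').symm.trans (hI j i (hT'.trans hi))).le
    · push Not at hj
      have h1 : L T j ≤ L j0 j0 := Li _ _ _ _ (Nat.le_add_right _ _) hj
      have h2 : L (i + j) (i + j) ≤ L i j := Li _ _ _ _ (by omega) (by omega)
      exact h1.trans ((hj0 (i + j) (by omega)).le.trans h2)
  refine ⟨T, fun i hi => le_antisymm (N.monotone hi) ?_⟩
  have key : ∀ e : ℕ, ∀ n ∈ OrderDual.ofDual (N T), x ^ e • n = 0 → n ∈ OrderDual.ofDual (N i) := by
    intro e
    induction e with
    | zero =>
      intro n _ h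
      rw [pow_zero, one_smul] at h
      rw [h]; exact Submodule.zero_mem _
    | succ e ih =>
      intro n hn h
      have h0 : x • x ^ e • n = 0 := by rw [smul_smul, ← pow_succ', h]
      obtain ⟨-, n', hn', e2⟩ := hT e i hi (show (⟨x ^ e • n, hK _ h0⟩ : K) ∈ L T e from
        ⟨h0, n, hn, rfl⟩)
      have := ih (n - n') (Submodule.sub_mem _ hn (hN _ _ hi _ hn')) (by
        rw [smul_sub, e2, sub_self])
      simpa using Submodule.add_mem _ this hn'
  intro n hn
  obtain ⟨e, he⟩ := ht n
  exact key e n hn he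

theorem isArtinian_lim [IsNoetherianRing R] {d : ℕ} (x : Fin d → R) : ∀ {M H : Type u}
    [AddCommGroup M] [Module R M] [AddCommGroup H] [Module R H]
    {θ : ℕ → M →ₗ[R] H} (_ : IsLim x θ) (_ : IsArtinian R (M ⧸ QQ M x 1)), IsArtinian R H := by
  induction d with
  | zero =>
    intro M H _ _ _ _ θ h hA
    have e : ∀ t m, θ t m = θ 0 m := by
      intro t m
      induction t with
      | zero => rfl
      | succ t ih => rw [← ih, ← h.step t m]; simp
    let f : (M ⧸ QQ M x 1) →ₗ[R] H := (QQ M x 1).liftQ (θ 1) (fun m hm => h.zero hm)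
    refine isArtinian_of_surjective _ f fun y => ?_
    obtain ⟨t, m, rfl⟩ := h.surj y
    refine ⟨Submodule.mkQ _ m, ?_⟩
    rw [e t]
    exact e 1 m
  | succ d ih =>
    obtain ⟨x0, x', rfl⟩ : ∃ x0 x', x = (Fin.cons x0 x' : Fin (d+1) → R) :=
      ⟨x 0, Fin.tail x, (Fin.cons_self_tail x).symm⟩
    intro M H _ _ _ _ θ h hA
    let M0 : Submodule R M := LinearMap.range (LinearMap.lsmul R M x0)
    obtain ⟨H', _, _, θ', h'⟩ := exists_lim (M ⧸ M0) x'
    have hprod : (∏ i, (Fin.cons x0 x' : Fin (d+1) → R) i) = x0 * ∏ i, x' i := by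
      rw [Fin.prod_univ_succ]; simp
    have hA' : IsArtinian R ((M ⧸ M0) ⧸ QQ (M ⧸ M0) x' 1) := by
      let f : M →ₗ[R] ((M ⧸ M0) ⧸ QQ (M ⧸ M0) x' 1) := Submodule.mkQ _ ∘ₗ Submodule.mkQ _
      have hf : QQ M (Fin.cons x0 x' : Fin (d+1) → R) 1 ≤ LinearMap.ker f := by
        apply mem_QQ_ind
        intro i m
        rw [LinearMap.mem_ker, LinearMap.comp_apply]
        refine Fin.cases ?_ (fun i => ?_) i
        · rw [Fin.cons_zero, pow_one]
          have : M0.mkQ (x0 • m) = 0 := by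
            rw [Submodule.mkQ_apply, Submodule.Quotient.mk_eq_zero]; exact ⟨m, rfl⟩
          rw [this, map_zero]
        · rw [Fin.cons_succ, map_smul, Submodule.mkQ_apply, Submodule.Quotient.mk_eq_zero]
          exact smul_mem_QQ x' 1 i _
      refine isArtinian_of_surjective _ (Submodule.liftQ _ f hf) fun y => ?_
      obtain ⟨y, rfl⟩ := Submodule.mkQ_surjective _ y
      obtain ⟨y, rfl⟩ := Submodule.mkQ_surjective _ y
      exact ⟨Submodule.mkQ _ y, rfl⟩
    have := ih x' h' hA'
    set P := ∏ i, x' i with hP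
    let φ : ℕ → (M ⧸ M0) →ₗ[R] H := fun t => M0.liftQ ((x0 ^ t * P) • θ (t+1)) (by
      rintro _ ⟨m, rfl⟩
      rw [LinearMap.mem_ker, LinearMap.smul_apply, ← map_smul]
      apply h.zero
      rw [LinearMap.lsmul_apply, smul_smul, show x0 ^ t * P * x0 = x0 ^ (t+1) * P by ring, mul_smul]
      exact smul_mem_QQ (Fin.cons x0 x' : Fin (d+1) → R) (t+1) 0 (P • m))
    have hφ : ∀ t m, φ t (M0.mkQ m) = θ (t+1) ((x0 ^ t * P) • m) := fun t m => by
      rw [map_smul]; rfl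
    obtain ⟨f, hf⟩ := h'.desc φ (by
      intro t m
      obtain ⟨m, rfl⟩ := Submodule.mkQ_surjective _ m
      rw [← map_smul, hφ, hφ, ← h.step (t+1), hprod, smul_smul, smul_smul]
      congr 2
      ring) (by
      intro t
      apply mem_QQ_ind (N := LinearMap.ker (φ t))
      intro i m
      obtain ⟨m, rfl⟩ := Submodule.mkQ_surjective _ m
      rw [LinearMap.mem_ker, ← map_smul, hφ]
      apply h.zero
      rw [mem_QQ_cons]
      refine ⟨0, ?_⟩
      rw [smul_zero, sub_zero, mul_smul]
      apply Submodule.smul_mem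
      have := prod_smul_QQ x' t 1 (smul_mem_QQ x' t i m)
      rwa [pow_one] at this)
    have := isArtinian_of_surjective _ f.rangeRestrict f.surjective_rangeRestrict
    refine melkersson x0 ?_ (LinearMap.range f) ?_
    · intro y
      obtain ⟨t, m, rfl⟩ := h.surj y
      refine ⟨t, ?_⟩
      rw [← map_smul]
      exact h.zero (smul_mem_QQ (Fin.cons x0 x' : Fin (d+1) → R) t 0 m)
    · intro y hy
      obtain ⟨t0, m0, rfl⟩ := h.surj y
      rw [← map_smul, h.ker] at hy
      obtain ⟨s, hs⟩ := hy
      obtain ⟨m1, hm1⟩ := (mem_QQ_cons _ _ _ _).1 hs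
      rw [← h.steps t0 s]
      set m := (∏ i, (Fin.cons x0 x' : Fin (d+1) → R) i) ^ s • m0 with hm
      set t := t0 + s with ht
      refine ⟨θ' t (M0.mkQ m1), ?_⟩
      rw [hf, hφ, ← h.step t m, ← sub_eq_zero, ← map_sub]
      apply h.zero
      rw [mem_QQ_cons]
      refine ⟨0, ?_⟩
      have e2 := Submodule.neg_mem _ (prod_smul_QQ x' _ 1 hm1)
      rw [pow_one, ← hP] at e2
      convert e2 using 1
      rw [smul_comm _ x0 m0, ← hm, hprod, smul_zero, sub_zero]
      module
end
end LC

namespace LC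
open CategoryTheory Limits Opposite
noncomputable section
variable {R : Type u} [CommRing R]

open Matrix in
theorem det_lemma_one {A : Type*} [CommRing A] {d : ℕ} (C D : Matrix (Fin d) (Fin d) A)
    (k : Fin d) (u w : Fin d → A) (hC : ∀ i, ∑ j, C i j * u j = w i)
    (hD : ∀ i, i ≠ k → ∑ j, D i j * u j = w i) (hk : ∑ j, D k j * u j = 0) :
    (∏ i, w i) * D.det ∈ Ideal.span (Set.range fun i => w i ^ 2) := by
  classical
  have hu : ∀ j, D.det * u j ∈ Ideal.span (w '' {i | i ≠ k}) := by
    intro j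
    have h1 : D.det • u = D.adjugate *ᵥ (D *ᵥ u) := by
      rw [mulVec_mulVec, adjugate_mul, smul_mulVec, one_mulVec]
    have h2 := congrFun h1 j
    rw [Pi.smul_apply, smul_eq_mul] at h2
    rw [h2]
    change ∑ i, D.adjugate j i * (D *ᵥ u) i ∈ _
    refine Ideal.sum_mem (Ideal.span (w '' {i | i ≠ k})) fun i _ => Ideal.mul_mem_left _ _ ?_
    by_cases hi : i = k
    · subst hi
      have : (D *ᵥ u) i = 0 := hk
      rw [this]; exact Submodule.zero_mem _
    · have : (D *ᵥ u) i = w i := hD i hi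
      rw [this]; exact Ideal.subset_span ⟨i, hi, rfl⟩
  have hwk : w k * D.det ∈ Ideal.span (w '' {i | i ≠ k}) := by
    rw [← hC k, Finset.sum_mul]
    refine Submodule.sum_mem _ fun j _ => ?_
    rw [mul_assoc, mul_comm (u j)]
    exact Ideal.mul_mem_left _ _ (hu j)
  have hP : ∀ z ∈ Ideal.span (w '' {i | i ≠ k}), (∏ i ∈ Finset.univ.erase k, w i) * z ∈
      Ideal.span (Set.range fun i => w i ^ 2) := by
    intro z hz
    induction hz using Submodule.span_induction with
    | mem z hz =>
      obtain ⟨i, hi, rfl⟩ := hz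
      rw [← Finset.mul_prod_erase _ w (Finset.mem_erase.2 ⟨hi, Finset.mem_univ i⟩),
        mul_comm, ← mul_assoc, ← sq]
      exact Ideal.mul_mem_right _ _ (Ideal.subset_span ⟨i, rfl⟩)
    | zero => rw [mul_zero]; exact Submodule.zero_mem _
    | add r s _ _ h1 h2 => rw [mul_add]; exact Submodule.add_mem _ h1 h2
    | smul c r _ h1 => rw [smul_eq_mul, mul_left_comm]; exact Ideal.mul_mem_left _ _ h1
  rw [← Finset.mul_prod_erase _ w (Finset.mem_univ k), mul_comm (w k), mul_assoc]
  exact hP _ hwk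

theorem det_lemma {A : Type*} [CommRing A] {d : ℕ} (C C' : Matrix (Fin d) (Fin d) A)
    (u w : Fin d → A) (hC : ∀ i, ∑ j, C i j * u j = w i) (hC' : ∀ i, ∑ j, C' i j * u j = w i) :
    (∏ i, w i) * (C.det - C'.det) ∈ Ideal.span (Set.range fun i => w i ^ 2) := by
  classical
  let CS : Finset (Fin d) → Matrix (Fin d) (Fin d) A := fun S i => if i ∈ S then C' i else C i
  have hCS : ∀ S i, ∑ j, CS S i j * u j = w i := by
    intro S i
    dsimp only [CS]
    split_ifs
    · exact hC' i
    · exact hC i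
  have key : ∀ S, (∏ i, w i) * (C.det - (CS S).det) ∈ Ideal.span (Set.range fun i => w i ^ 2) := by
    intro S
    induction S using Finset.induction with
    | empty =>
      have : CS ∅ = C := by funext i; simp [CS]
      rw [this, sub_self, mul_zero]; exact Submodule.zero_mem _
    | insert k S hk ih =>
      have e1 : CS (insert k S) = (CS S).updateRow k (C' k) := by
        funext i
        by_cases hi : i = k
        · subst hi; rw [Matrix.updateRow_self]; simp [CS]
        · rw [Matrix.updateRow_ne hi]; simp [CS, hi]
      have e0 : CS S = (CS S).updateRow k ((CS S k - C' k) + C' k) := by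
        rw [sub_add_cancel, Matrix.updateRow_eq_self]
      have e2 : (CS S).det = ((CS S).updateRow k (CS S k - C' k)).det + (CS (insert k S)).det := by
        rw [e1, ← Matrix.det_updateRow_add, ← e0]
      have e3 : C.det - (CS (insert k S)).det = (C.det - (CS S).det) +
        ((CS S).updateRow k (CS S k - C' k)).det := by rw [e2]; ring
      rw [e3, mul_add]
      refine Submodule.add_mem _ ih (det_lemma_one (CS S) _ k u w (hCS S) ?_ ?_)
      · intro i hi
        rw [Matrix.updateRow_ne hi]; exact hCS S i
      · rw [Matrix.updateRow_self]
        simp only [Pi.sub_apply, sub_mul, Finset.sum_sub_distrib]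
        rw [hCS, hC', sub_self]
  have : CS Finset.univ = C' := by funext i; simp [CS]
  rw [← this]
  exact key _

section
variable {M : Type*} [AddCommGroup M] [Module R M]

/-- `w ≡ C u` modulo the annihilator of `M`. -/
def Cong (M : Type*) [AddCommGroup M] [Module R M] {d : ℕ} (C : Matrix (Fin d) (Fin d) R)
    (u w : Fin d → R) : Prop := ∀ i, w i - ∑ j, C i j * u j ∈ Module.annihilator R M

theorem Cong.smul {d : ℕ} {C : Matrix (Fin d) (Fin d) R} {u w : Fin d → R} (h : Cong M C u w)
    (i : Fin d) (m : M) : w i • m = ∑ j, C i j • u j • m := by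
  have := Module.mem_annihilator.1 (h i) m
  rw [sub_smul, sub_eq_zero] at this
  rw [this, Finset.sum_smul]
  simp only [mul_smul]

theorem Cong.comp {d : ℕ} {C D : Matrix (Fin d) (Fin d) R} {u v w : Fin d → R} (h : Cong M C u v)
    (h' : Cong M D v w) : Cong M (D * C) u w := by
  intro i
  have e : w i - ∑ j, (D * C) i j * u j = (w i - ∑ j, D i j * v j) +
      ∑ j, D i j * (v j - ∑ k, C j k * u k) := by
    simp only [Matrix.mul_apply, Finset.sum_mul, mul_sub, Finset.sum_sub_distrib, Finset.mul_sum]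
    rw [Finset.sum_comm]
    simp only [mul_assoc]
    ring
  rw [e]
  exact Submodule.add_mem _ (h' i) (Submodule.sum_mem _ fun j _ => Ideal.mul_mem_left _ _ (h j))

theorem Cong.diag {d : ℕ} (c u : Fin d → R) : Cong M (Matrix.diagonal c) u (fun i => c i * u i) := by
  intro i
  convert Submodule.zero_mem _
  rw [sub_eq_zero]
  simp [Matrix.diagonal_apply]

theorem sup_ann_smul (I : Ideal R) {r : R} (h : r ∈ I ⊔ Module.annihilator R M) (m : M) :
    r • m ∈ I • (⊤ : Submodule R M) := by
  obtain ⟨a, ha, b, hb, rfl⟩ := Submodule.mem_sup.1 h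
  rw [add_smul, Module.mem_annihilator.1 hb m, add_zero]
  exact Submodule.smul_mem_smul ha trivial

theorem Cong.det_sub {d : ℕ} {C C' : Matrix (Fin d) (Fin d) R} {u w : Fin d → R} (h : Cong M C u w)
    (h' : Cong M C' u w) (m : M) : ((∏ i, w i) * (C.det - C'.det)) • m ∈ QQ M w 2 := by
  apply sup_ann_smul
  let π := Ideal.Quotient.mk (Module.annihilator R M)
  have hh : ∀ {C : Matrix (Fin d) (Fin d) R}, Cong M C u w →
      ∀ i, ∑ j, (π.mapMatrix C) i j * (π ∘ u) j = (π ∘ w) i := by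
    intro C h i
    have := Ideal.Quotient.eq_zero_iff_mem.2 (h i)
    rw [map_sub, sub_eq_zero, map_sum] at this
    simp only [map_mul] at this
    exact this.symm
  have := det_lemma (π.mapMatrix C) (π.mapMatrix C') (π ∘ u) (π ∘ w) (hh h) (hh h')
  have e : Set.range (fun i => (π ∘ w) i ^ 2) = π '' Set.range (fun i => w i ^ 2) := by
    rw [← Set.range_comp]; congr 1
  rw [← RingHom.map_det, ← RingHom.map_det, ← map_sub, e, ← Ideal.map_span] at this
  have e2 : ∏ i, (π ∘ w) i = π (∏ i, w i) := by rw [map_prod]; rfl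
  rw [e2, ← map_mul, ← Ideal.mem_comap, Ideal.comap_map_of_surjective' π Ideal.Quotient.mk_surjective,
    Ideal.mk_ker] at this
  exact this

theorem Cong.det_mem {d : ℕ} {C : Matrix (Fin d) (Fin d) R} {u w : Fin d → R} (h : Cong M C u w)
    {m : M} (hm : m ∈ QQ M u 1) : C.det • m ∈ QQ M w 1 := by
  have : QQ M u 1 ≤ Submodule.comap (LinearMap.lsmul R M C.det) (QQ M w 1) := by
    apply mem_QQ_ind
    intro k m
    change C.det • u k ^ 1 • m ∈ QQ M w 1
    have e : C.det * u k = ∑ i, C.adjugate k i * ∑ j, C i j * u j := by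
      have h1 : C.det • u = C.adjugate.mulVec (C.mulVec u) := by
        rw [Matrix.mulVec_mulVec, Matrix.adjugate_mul, Matrix.smul_mulVec, Matrix.one_mulVec]
      exact congrFun h1 k
    rw [pow_one, smul_smul, e, Finset.sum_smul]
    refine Submodule.sum_mem _ fun i _ => ?_
    rw [mul_smul]
    apply Submodule.smul_mem
    rw [Finset.sum_smul]
    simp only [mul_smul]
    rw [← h.smul, ← pow_one (w i)]
    exact smul_mem_QQ w 1 i m
  exact this hm

theorem exists_cong {d : ℕ} {u w : Fin d → R}
    (h : ∀ i, w i ∈ Ideal.span (Set.range u) ⊔ Module.annihilator R M) :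
    ∃ C : Matrix (Fin d) (Fin d) R, Cong M C u w := by
  have : ∀ i, ∃ c : Fin d → R, w i - ∑ j, c j * u j ∈ Module.annihilator R M := by
    intro i
    obtain ⟨a, ha, b, hb, e⟩ := Submodule.mem_sup.1 (h i)
    obtain ⟨c, rfl⟩ := (Ideal.mem_span_range_iff_exists_fun).1 ha
    exact ⟨c, by rw [← e, add_sub_cancel_left]; exact hb⟩
  choose c hc using this
  exact ⟨c, hc⟩

theorem QQ_pow {d : ℕ} (x : Fin d → R) (t s : ℕ) : QQ M (fun i => x i ^ t) s = QQ M x (t * s) := by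
  unfold QQ
  simp only [← pow_mul]

end

section transfer
variable {M H H' : Type*} [AddCommGroup M] [Module R M] [AddCommGroup H] [Module R H]
  [AddCommGroup H'] [Module R H'] {d : ℕ} {x y : Fin d → R} {θ : ℕ → M →ₗ[R] H}
  {θ' : ℕ → M →ₗ[R] H'}

theorem IsLim.cong_eq (h : IsLim y θ') {t : ℕ} {C C' : Matrix (Fin d) (Fin d) R} {u : Fin d → R}
    (hC : Cong M C u (fun i => y i ^ t)) (hC' : Cong M C' u (fun i => y i ^ t)) (m : M) :
    θ' t (C.det • m) = θ' t (C'.det • m) := by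
  rw [← sub_eq_zero, ← map_sub, ← sub_smul, h.ker]
  refine ⟨t, ?_⟩
  have := hC.det_sub hC' m
  rw [QQ_pow, Finset.prod_pow, mul_smul, mul_two] at this
  exact this

theorem transfer (h : IsLim x θ) (h' : IsLim y θ')
    (hyx : ∀ s, ∃ t, ∀ i, y i ^ t ∈ Ideal.span (Set.range fun i => x i ^ s) ⊔ Module.annihilator R M)
    (hxy : ∀ s, ∃ t, ∀ i, x i ^ t ∈ Ideal.span (Set.range fun i => y i ^ s) ⊔ Module.annihilator R M) :
    ∃ f : H →ₗ[R] H', Function.Injective f ∧ ∀ s t (C : Matrix (Fin d) (Fin d) R),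
      Cong M C (fun i => x i ^ s) (fun i => y i ^ t) → ∀ m, f (θ s m) = θ' t (C.det • m) := by
  have dg : ∀ (z : Fin d → R) (e s : ℕ), Cong M (Matrix.diagonal fun i => z i ^ e) (fun i => z i ^ s)
      (fun i => z i ^ (s + e)) := by
    intro z e s
    have := Cong.diag (M := M) (fun i => z i ^ e) (fun i => z i ^ s)
    simpa only [← pow_add, add_comm e s] using this
  have dd : ∀ (z : Fin d → R) (e : ℕ), (Matrix.diagonal fun i => z i ^ e).det = (∏ i, z i) ^ e := by
    intro z e
    rw [Matrix.det_diagonal, Finset.prod_pow]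
  have hA : ∀ s, ∃ t C, Cong M C (fun i => x i ^ s) (fun i => y i ^ t) := by
    intro s
    obtain ⟨t, ht⟩ := hyx s
    exact ⟨t, exists_cong ht⟩
  have hB : ∀ s, ∃ t C, Cong M C (fun i => y i ^ s) (fun i => x i ^ t) := by
    intro s
    obtain ⟨t, ht⟩ := hxy s
    exact ⟨t, exists_cong ht⟩
  choose τ A hA using hA
  -- comparison
  have cmp : ∀ s s' e t t' C C', s' = s + e → Cong M C (fun i => x i ^ s) (fun i => y i ^ t) →
      Cong M C' (fun i => x i ^ s') (fun i => y i ^ t') → ∀ m,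
      θ' t (C.det • m) = θ' t' (C'.det • (∏ i, x i) ^ e • m) := by
    rintro s _ e t t' C C' rfl hC hC' m
    have c1 := hC.comp (dg y t' t)
    have c2 := (dg x e s).comp (hC'.comp (dg y t t'))
    rw [add_comm t' t] at c2
    have := h'.cong_eq c1 c2 m
    rw [Matrix.det_mul, Matrix.det_mul, Matrix.det_mul, dd, dd, dd] at this
    rw [← h'.steps t t', ← h'.steps t' t, smul_smul, this, smul_smul, smul_smul, mul_assoc,
      add_comm t t']
  let φ : ℕ → M →ₗ[R] H' := fun s => (A s).det • θ' (τ s)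
  have hφ : ∀ s m, φ s m = θ' (τ s) ((A s).det • m) := fun s m => by rw [map_smul]; rfl
  obtain ⟨f, hf⟩ := h.desc φ (by
    intro s m
    rw [hφ, hφ]
    have := cmp s (s+1) 1 _ _ _ _ rfl (hA s) (hA (s+1)) m
    rw [pow_one] at this
    exact this.symm) (by
    intro s m hm
    rw [hφ]
    apply h'.zero
    have := (hA s).det_mem (m := m) (by rw [QQ_pow, mul_one]; exact hm)
    rwa [QQ_pow, mul_one] at this)
  refine ⟨f, ?_, ?_⟩
  · rw [injective_iff_map_eq_zero]
    intro a ha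
    obtain ⟨s, m, rfl⟩ := h.surj a
    rw [hf, hφ, h'.ker] at ha
    obtain ⟨e, he⟩ := ha
    obtain ⟨r, B, hB⟩ := hB (τ s + e)
    have c1 := (hA s).comp ((dg y e (τ s)).comp (hB.comp (dg x s r)))
    have c2 := dg x r s
    rw [add_comm s r] at c2
    have e1 := h.cong_eq c1 c2 m
    rw [dd, add_comm r s, h.steps] at e1
    rw [← e1]
    apply h.zero
    rw [Matrix.det_mul, Matrix.det_mul, Matrix.det_mul, dd, dd, add_comm s r]
    have e2 := hB.det_mem (m := (∏ i, y i) ^ e • (A s).det • m) (by rw [QQ_pow, mul_one]; exact he)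
    rw [QQ_pow, mul_one] at e2
    have e3 := prod_smul_QQ x _ s e2
    convert e3 using 1
    simp only [smul_smul]
    congr 1
    ring
  · intro s t C hC m
    rw [hf, hφ]
    have := cmp s s 0 _ _ _ _ rfl (hA s) hC m
    rwa [pow_zero, one_smul] at this
end transfer

end
end LC

namespace LC
open CategoryTheory Limits Opposite IsLocalRing
noncomputable section
variable {R : Type u} [CommRing R]

theorem chain_lemma {A : Type*} [AddCommGroup A] [Module R A] (F : ℕ → Submodule R A)
    (hF : ∀ n, F n ≤ F (n+1)) (K : Submodule R A) [IsNoetherian R K]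
    (h : ∀ a ∈ K, ∃ n, a ∈ F n) : ∃ n, K ≤ F n := by
  have hF := monotone_nat_of_le_succ hF
  obtain ⟨n, hn⟩ := monotone_stabilizes_iff_noetherian.2 (inferInstance : IsNoetherian R K)
    ⟨fun n => Submodule.comap K.subtype (F n), fun a b hab x hx => hF hab hx⟩
  refine ⟨n, fun a ha => ?_⟩
  obtain ⟨k, hk⟩ := h a ha
  have h1 : (⟨a, ha⟩ : K) ∈ Submodule.comap K.subtype (F (max n k)) := hF (le_max_right n k) hk
  have h2 := hn (max n k) (le_max_left _ _)
  change Submodule.comap K.subtype (F n) = Submodule.comap K.subtype (F (max n k)) at h2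
  rw [← h2] at h1
  exact h1

variable [IsLocalRing R]

/-- the socle -/
abbrev Soc (N : Type*) [AddCommGroup N] [Module R N] : Submodule R N :=
  Submodule.torsionBySet R N (maximalIdeal R : Set R)

theorem mem_Soc {N : Type*} [AddCommGroup N] [Module R N] {n : N} :
    n ∈ Soc (R := R) N ↔ ∀ r ∈ maximalIdeal R, r • n = 0 := by
  rw [Submodule.mem_torsionBySet_iff]
  exact ⟨fun h r hr => h ⟨r, hr⟩, fun h r => h r.1 r.2⟩

theorem soc_finite {N : Type*} [AddCommGroup N] [Module R N] [IsArtinian R N] :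
    Module.Finite (R ⧸ maximalIdeal R) (Soc (R := R) N) := by
  letI := Ideal.Quotient.field (maximalIdeal R)
  have : IsArtinian (R ⧸ maximalIdeal R) (Soc (R := R) N) := isArtinian_of_tower R inferInstance
  exact (IsSemisimpleModule.finite_tfae (R := R ⧸ maximalIdeal R) (M := Soc (R := R) N)).out 2 0 |>.1 this

theorem soc_map {N N' : Type*} [AddCommGroup N] [Module R N] [AddCommGroup N'] [Module R N']
    (g : N →ₗ[R] N') : ∃ g' : Soc (R := R) N →ₗ[R ⧸ maximalIdeal R] Soc (R := R) N',
      ∀ n, (g' n : N') = g n := by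
  let g0 : Soc (R := R) N →ₗ[R] Soc (R := R) N' := g.restrict (by
    intro n hn
    rw [mem_Soc] at hn ⊢
    intro r hr
    rw [← map_smul, hn r hr, map_zero])
  exact ⟨g0.extendScalarsOfSurjective Ideal.Quotient.mk_surjective, fun n => rfl⟩

theorem soc_surj {N N' : Type*} [AddCommGroup N] [Module R N] [AddCommGroup N'] [Module R N']
    [Module.Finite (R ⧸ maximalIdeal R) (Soc (R := R) N)]
    (g : N →ₗ[R] N') (hg : ∀ h ∈ Soc (R := R) N', ∃ n ∈ Soc (R := R) N, g n = h) :
    Module.finrank (R ⧸ maximalIdeal R) (Soc (R := R) N') ≤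
      Module.finrank (R ⧸ maximalIdeal R) (Soc (R := R) N) ∧
    (Module.finrank (R ⧸ maximalIdeal R) (Soc (R := R) N) ≤
      Module.finrank (R ⧸ maximalIdeal R) (Soc (R := R) N') →
      ∀ n ∈ Soc (R := R) N, g n = 0 → n = 0) := by
  letI := Ideal.Quotient.field (maximalIdeal R)
  obtain ⟨g', hg'⟩ := soc_map g
  have hs : Function.Surjective g' := by
    rintro ⟨h, hh⟩
    obtain ⟨n, hn, e⟩ := hg h hh
    exact ⟨⟨n, hn⟩, Subtype.ext (by rw [hg']; exact e)⟩
  have : Module.Finite (R ⧸ maximalIdeal R) (Soc (R := R) N') := Module.Finite.of_surjective g' hs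
  refine ⟨LinearMap.finrank_le_finrank_of_surjective hs, fun hle n hn e => ?_⟩
  have heq := le_antisymm hle (LinearMap.finrank_le_finrank_of_surjective hs)
  have hi := (LinearMap.injective_iff_surjective_of_finrank_eq_finrank heq).2 hs
  have : (⟨n, hn⟩ : Soc (R := R) N) = 0 := hi (Subtype.ext (by rw [hg', map_zero]; exact e))
  exact congrArg Subtype.val this

/-- a nonzero submodule of a module of m-torsion meets the socle -/
theorem exists_soc {N : Type*} [AddCommGroup N] [Module R N] {a : N} (ha : a ≠ 0) {n : ℕ}
    (hn : ∀ r ∈ maximalIdeal R ^ n, r • a = 0) : ∃ r : R, r • a ≠ 0 ∧ r • a ∈ Soc (R := R) N := by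
  induction n with
  | zero => exact absurd (by simpa using hn 1 (by simp)) ha
  | succ n ih =>
    by_cases h : ∀ r ∈ maximalIdeal R ^ n, r • a = 0
    · exact ih h
    · push Not at h
      obtain ⟨r, hr, hra⟩ := h
      refine ⟨r, hra, mem_Soc.2 fun s hs => ?_⟩
      rw [smul_smul]
      apply hn
      rw [pow_succ']
      exact Ideal.mul_mem_mul hs hr

/-- system-of-parameters type condition -/
def Par (M : Type*) [AddCommGroup M] [Module R M] {d : ℕ} (x : Fin d → R) : Prop :=
  maximalIdeal R ≤ (Ideal.span (Set.range x) ⊔ Module.annihilator R M).radical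

section
variable {M : Type*} [AddCommGroup M] [Module R M] {d : ℕ}

theorem Par.pow {x : Fin d → R} (h : Par M x) (t : ℕ) : Par M (fun i => x i ^ t) := by
  refine h.trans (Ideal.radical_le_radical_iff.2 (sup_le ?_ (le_sup_right.trans Ideal.le_radical)))
  rw [Ideal.span_le]
  rintro _ ⟨i, rfl⟩
  exact ⟨t, Ideal.mem_sup_left (Ideal.subset_span ⟨i, rfl⟩)⟩

theorem Par.exists_pow [IsNoetherianRing R] {x : Fin d → R} (h : Par M x) :
    ∃ N, maximalIdeal R ^ N ≤ Ideal.span (Set.range x) ⊔ Module.annihilator R M :=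
  Ideal.exists_pow_le_of_le_radical_of_fg h (IsNoetherian.noetherian _)

theorem pow_ann_of_artinian (N : Type*) [AddCommGroup N] [Module R N] [IsArtinian R N]
    [Module.Finite R N] [IsNoetherianRing R] : ∃ n, maximalIdeal R ^ n ≤ Module.annihilator R N := by
  obtain ⟨n, hn⟩ := monotone_stabilizes_iff_artinian.2 (inferInstance : IsArtinian R N)
    ⟨fun n => OrderDual.toDual (maximalIdeal R ^ n • (⊤ : Submodule R N)), fun a b hab =>
      Submodule.smul_mono_left (Ideal.pow_le_pow_right hab)⟩
  have h1 : maximalIdeal R ^ n • (⊤ : Submodule R N) = maximalIdeal R ^ (n+1) • ⊤ := hn (n+1) (Nat.le_succ n)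
  have h2 : maximalIdeal R ^ n • (⊤ : Submodule R N) = ⊥ := by
    refine Submodule.eq_bot_of_le_smul_of_le_jacobson_bot (maximalIdeal R) _
      (IsNoetherian.noetherian _) ?_ (maximalIdeal_le_jacobson _)
    rw [← Submodule.mul_smul, ← pow_succ', ← h1]
  refine ⟨n, fun r hr => Module.mem_annihilator.2 fun m => ?_⟩
  have := Submodule.smul_mem_smul hr (Submodule.mem_top : m ∈ (⊤ : Submodule R N))
  rw [h2] at this
  exact this

theorem par_of_artinian [IsNoetherianRing R] [Module.Finite R M] {x : Fin d → R}
    (h : IsArtinian R (M ⧸ (Ideal.span (Set.range x) • ⊤ : Submodule R M))) : Par M x := by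
  obtain ⟨n, hn⟩ := pow_ann_of_artinian (R := R) (M ⧸ (Ideal.span (Set.range x) • ⊤ : Submodule R M))
  intro r hr
  rw [Ideal.radical_eq_sInf]
  rw [Ideal.mem_sInf]
  rintro p ⟨hp, hpp⟩
  have h1 : (⟨p, hpp⟩ : PrimeSpectrum R) ∈ Module.support R
      (M ⧸ (Ideal.span (Set.range x) • ⊤ : Submodule R M)) := by
    rw [Module.support_quotient, Module.support_eq_zeroLocus]
    exact ⟨le_sup_right.trans hp, le_sup_left.trans hp⟩
  rw [Module.support_eq_zeroLocus] at h1
  exact hpp.mem_of_pow_mem n (h1 (hn (Ideal.pow_mem_pow hr n)))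

theorem artinian_of_pow_ann [IsNoetherianRing R] (N : Type*) [AddCommGroup N] [Module R N]
    [Module.Finite R N] {n : ℕ} (h : maximalIdeal R ^ n ≤ Module.annihilator R N) :
    IsArtinian R N := by
  induction n generalizing N with
  | zero =>
    have : Subsingleton N := by
      refine subsingleton_of_forall_eq 0 fun a => ?_
      have := Module.mem_annihilator.1 (h (by simp : (1:R) ∈ maximalIdeal R ^ 0)) a
      simpa using this
    infer_instance
  | succ n ih =>
    let K : Submodule R N := maximalIdeal R • ⊤
    have h1 : IsArtinian R K := by
      apply ih
      intro r hr
      rw [Module.mem_annihilator]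
      rintro ⟨k, hk⟩
      apply Subtype.ext
      change r • k = 0
      refine Submodule.smul_induction_on hk (fun s hs m _ => ?_) (fun a b ha hb => by
        rw [smul_add, ha, hb, add_zero])
      rw [smul_smul]
      exact Module.mem_annihilator.1 (h (by rw [pow_succ]; exact Ideal.mul_mem_mul hr hs)) m
    have h2 : IsArtinian R (N ⧸ K) := by
      letI := Ideal.Quotient.field (maximalIdeal R)
      have : Module.Finite (R ⧸ maximalIdeal R) (N ⧸ K) :=
        Module.Finite.of_restrictScalars_finite R _ _
      have h3 : IsArtinian (R ⧸ maximalIdeal R) (N ⧸ K) := inferInstance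
      exact (LinearMap.isArtinian_iff_of_bijective
        (σ := Ideal.Quotient.mk (maximalIdeal R))
        (l := { toFun := id, map_add' := fun _ _ => rfl, map_smul' := fun _ _ => rfl})
          (hl := Function.bijective_id)).2 h3
    exact (isArtinian_iff_submodule_quotient K).2 ⟨h1, h2⟩

theorem Par.ann [IsNoetherianRing R] [Module.Finite R M] {x : Fin d → R} (h : Par M x) :
    ∃ n, maximalIdeal R ^ n ≤ Module.annihilator R (M ⧸ (Ideal.span (Set.range x) • ⊤ : Submodule R M)) := by
  obtain ⟨n, hn⟩ := h.exists_pow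
  refine ⟨n, fun r hr => Module.mem_annihilator.2 fun m => ?_⟩
  obtain ⟨m, rfl⟩ := Submodule.mkQ_surjective _ m
  rw [← map_smul, Submodule.mkQ_apply, Submodule.Quotient.mk_eq_zero]
  exact sup_ann_smul _ (hn hr) m

theorem Par.artinian [IsNoetherianRing R] [Module.Finite R M] {x : Fin d → R} (h : Par M x) :
    IsArtinian R (M ⧸ (Ideal.span (Set.range x) • ⊤ : Submodule R M)) := by
  obtain ⟨n, hn⟩ := h.ann
  exact artinian_of_pow_ann _ hn

theorem QQ_one (x : Fin d → R) : QQ M x 1 = Ideal.span (Set.range x) • ⊤ := by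
  unfold QQ; simp only [pow_one]

theorem Par.artinian' [IsNoetherianRing R] [Module.Finite R M] {x : Fin d → R} (h : Par M x) :
    IsArtinian R (M ⧸ QQ M x 1) := by
  rw [QQ_one]; exact h.artinian

theorem Par.rel [IsNoetherianRing R] {x y : Fin d → R} (h : Par M x) (hy : ∀ i, y i ∈ maximalIdeal R)
    (s : ℕ) : ∃ t, ∀ i, y i ^ t ∈ Ideal.span (Set.range fun i => x i ^ s) ⊔ Module.annihilator R M := by
  obtain ⟨t, ht⟩ := (h.pow s).exists_pow
  exact ⟨t, fun i => ht (Ideal.pow_mem_pow (hy i) t)⟩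
end

variable [IsNoetherianRing R]

theorem goto_sakurai {M H : Type u} [AddCommGroup M] [Module R M] [Module.Finite R M]
    [AddCommGroup H] [Module R H] {d : ℕ} {x : Fin d → R} {θ : ℕ → M →ₗ[R] H} (h : IsLim x θ)
    (hx : ∀ i, x i ∈ maximalIdeal R) (hP : Par M x) :
    ∃ ℓ, ∀ (y : Fin d → R) (_ : Par M y) (_ : ∀ i, y i ∈ maximalIdeal R)
      (_ : Ideal.span (Set.range y) ≤ maximalIdeal R ^ ℓ)
      (θ' : ℕ → M →ₗ[R] H) (_ : IsLim y θ'), ∀ a ∈ Soc (R := R) H, ∃ m, θ' 1 m = a ∧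
        ∀ r ∈ maximalIdeal R, r • m ∈ QQ M y 1 := by
  have hAr : IsArtinian R H := isArtinian_lim x h hP.artinian'
  have hN : IsNoetherian R (Soc (R := R) H) := by
    have := soc_finite (R := R) (N := H)
    have : IsNoetherian (R ⧸ maximalIdeal R) (Soc (R := R) H) := isNoetherian_of_isNoetherianRing_of_finite _ _
    exact (LinearMap.isNoetherian_iff_of_bijective
        (σ := Ideal.Quotient.mk (maximalIdeal R))
        (l := { toFun := id, map_add' := fun _ _ => rfl, map_smul' := fun _ _ => rfl})
          (hl := Function.bijective_id)).2 this
  let F : ℕ → Submodule R H := fun T =>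
    { carrier := {a | ∃ m, θ T m = a ∧ ∀ r ∈ maximalIdeal R, r • m ∈ QQ M x T}
      zero_mem' := ⟨0, map_zero _, fun r _ => by rw [smul_zero]; exact Submodule.zero_mem _⟩
      add_mem' := by
        rintro a b ⟨m, rfl, h⟩ ⟨m', rfl, h'⟩
        exact ⟨m + m', map_add _ _ _, fun r hr => by
          rw [smul_add]; exact Submodule.add_mem _ (h r hr) (h' r hr)⟩
      smul_mem' := by
        rintro c a ⟨m, rfl, h⟩
        exact ⟨c • m, map_smul _ _ _, fun r hr => by
          rw [smul_comm]; exact Submodule.smul_mem _ _ (h r hr)⟩ }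
  obtain ⟨T, hT⟩ := chain_lemma F (by
      rintro n a ⟨m, rfl, hm⟩
      refine ⟨(∏ i, x i) • m, h.step n m, fun r hr => ?_⟩
      rw [smul_comm]
      have := prod_smul_QQ x n 1 (hm r hr)
      rwa [pow_one] at this) (Soc (R := R) H) (by
      intro a ha
      obtain ⟨t, m, rfl⟩ := h.surj a
      let I : ℕ → Submodule R R := fun s => Submodule.comap
        (LinearMap.toSpanSingleton R M ((∏ i, x i) ^ s • m)) (QQ M x (t + s))
      obtain ⟨S, hS⟩ := chain_lemma I (by
          intro s r hr
          have := prod_smul_QQ x _ 1 (show r • (∏ i, x i) ^ s • m ∈ QQ M x (t + s) from hr)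
          rw [pow_one] at this
          change r • (∏ i, x i) ^ (s + 1) • m ∈ QQ M x (t + (s + 1))
          rw [pow_succ', mul_smul, smul_comm]
          exact this) (maximalIdeal R) (by
          intro r hr
          have := mem_Soc.1 ha r hr
          rw [← map_smul, h.ker] at this
          obtain ⟨s, hs⟩ := this
          refine ⟨s, ?_⟩
          change r • (∏ i, x i) ^ s • m ∈ QQ M x (t + s)
          rw [smul_comm]; exact hs)
      exact ⟨t + S, (∏ i, x i) ^ S • m, h.steps t S m, fun r hr => hS hr⟩)
  obtain ⟨ℓ, hℓ⟩ := (hP.pow T).exists_pow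
  refine ⟨ℓ, fun y hPy hy hyl θ' h' a ha => ?_⟩
  obtain ⟨A, hA⟩ := exists_cong (M := M) (u := fun i => x i ^ T) (w := fun i => y i ^ 1) (fun i =>
    hℓ (hyl (by rw [pow_one]; exact Ideal.subset_span ⟨i, rfl⟩)))
  obtain ⟨f, hf, hfA⟩ := transfer h h' (hP.rel hy) (hPy.rel hx)
  let g : Soc (R := R) H →ₗ[R] Soc (R := R) H := f.restrict (by
    intro n hn
    rw [mem_Soc] at hn ⊢
    intro r hr
    rw [← map_smul, hn r hr, map_zero])
  have hg : Function.Injective g := fun a b hab => Subtype.ext (hf (congrArg Subtype.val hab))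
  obtain ⟨⟨b, hb⟩, hgb⟩ := IsArtinian.surjective_of_injective_endomorphism g hg ⟨a, ha⟩
  obtain ⟨m, rfl, hm⟩ := hT hb
  have e : f (θ T m) = a := congrArg Subtype.val hgb
  refine ⟨A.det • m, by rw [← e, hfA T 1 A hA m], fun r hr => ?_⟩
  have := hA.det_mem (m := r • m) (by rw [QQ_pow, mul_one]; exact hm r hr)
  rw [QQ_pow, mul_one, smul_comm] at this
  exact this

/-- the injectivity conclusion -/
theorem inj_of_finrank_le {M H : Type u} [AddCommGroup M] [Module R M] [Module.Finite R M]
    [AddCommGroup H] [Module R H] {d : ℕ} {y : Fin d → R} {θ' : ℕ → M →ₗ[R] H} (h : IsLim y θ')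
    (hP : Par M y)
    (hs : ∀ a ∈ Soc (R := R) H, ∃ m, θ' 1 m = a ∧ ∀ r ∈ maximalIdeal R, r • m ∈ QQ M y 1)
    (hle : Module.finrank (R ⧸ maximalIdeal R) (Soc (R := R) (M ⧸ (Ideal.span (Set.range y) • ⊤ : Submodule R M))) ≤
      Module.finrank (R ⧸ maximalIdeal R) (Soc (R := R) H)) :
    ∀ s m, (∏ i, y i) ^ s • m ∈ QQ M y (1 + s) → m ∈ QQ M y 1 := by
  intro s m hm
  rw [← QQ_one] at hle
  have h0 : θ' 1 m = 0 := (h.ker 1 m).2 ⟨s, hm⟩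
  let g : (M ⧸ QQ M y 1) →ₗ[R] H := (QQ M y 1).liftQ (θ' 1) (fun m hm => h.zero hm)
  have := hP.artinian'
  have := soc_finite (R := R) (N := M ⧸ QQ M y 1)
  have hinj := (soc_surj g (by
    intro a ha
    obtain ⟨m, e, hm⟩ := hs a ha
    refine ⟨Submodule.mkQ _ m, mem_Soc.2 fun r hr => ?_, e⟩
    rw [← map_smul, Submodule.mkQ_apply, Submodule.Quotient.mk_eq_zero]
    exact hm r hr)).2 hle
  by_contra hne
  have hne' : (QQ M y 1).mkQ m ≠ 0 := by
    rwa [Ne, Submodule.mkQ_apply, Submodule.Quotient.mk_eq_zero]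
  obtain ⟨n, hn⟩ := hP.ann
  rw [← QQ_one] at hn
  obtain ⟨r, hr1, hr2⟩ := exists_soc hne' (n := n) (fun r hr => Module.mem_annihilator.1 (hn hr) _)
  refine hr1 (hinj _ hr2 ?_)
  rw [map_smul]
  have : g ((QQ M y 1).mkQ m) = θ' 1 m := rfl
  rw [this, h0, smul_zero]

end
end LC

namespace LC
open CategoryTheory Limits Opposite IsLocalRing
noncomputable section
open RingTheory.Sequence
open scoped Pointwise

section
variable {R : Type u} [CommRing R] {M : Type*} [AddCommGroup M] [Module R M] {d : ℕ}

theorem mk_mem_QQ (a : R) (x : Fin d → R) (t : ℕ) (m : M) :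
    (Submodule.Quotient.mk m : QuotSMulTop a M) ∈ QQ (QuotSMulTop a M) x t ↔
      ∃ m1, m - a • m1 ∈ QQ M x t := by
  have h : QQ (QuotSMulTop a M) x t = (QQ M x t).map (a • (⊤ : Submodule R M)).mkQ := by
    unfold QQ
    rw [Submodule.map_smul'', Submodule.map_top, Submodule.range_mkQ]
  rw [h, ← Submodule.mkQ_apply, ← Submodule.mem_comap, Submodule.comap_map_mkQ, Submodule.mem_sup]
  constructor
  · rintro ⟨y, hy, z, hz, rfl⟩
    obtain ⟨m1, -, rfl⟩ := (Submodule.mem_smul_pointwise_iff_exists _ _ _).1 hy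
    exact ⟨m1, by simpa using hz⟩
  · rintro ⟨m1, h⟩
    exact ⟨a • m1, Submodule.smul_mem_pointwise_smul _ _ _ Submodule.mem_top, _, h, by abel⟩

theorem ofList_ofFn (x : Fin d → R) : Ideal.ofList (List.ofFn x) = Ideal.span (Set.range x) := by
  unfold Ideal.ofList
  congr 1
  ext r
  simp [List.mem_ofFn]

theorem wr_snoc (a : R) (z : Fin d → R) : IsWeaklyRegular M (List.ofFn z ++ [a]) ↔
    IsWeaklyRegular M (List.ofFn z) ∧ ∀ m : M, a • m ∈ QQ M z 1 → m ∈ QQ M z 1 := by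
  rw [isWeaklyRegular_append_iff, isWeaklyRegular_singleton_iff, isSMulRegular_quotient_iff_mem_of_smul_mem,
    ofList_ofFn]
  simp only [QQ, pow_one]

variable [IsLocalRing R] [IsNoetherianRing R] [Module.Finite R M]

theorem wr_cons (a : R) (z : Fin d → R) (ha : a ∈ maximalIdeal R) (hz : ∀ i, z i ∈ maximalIdeal R) :
    IsWeaklyRegular M (List.ofFn (Fin.cons a z : Fin (d+1) → R)) ↔
    IsWeaklyRegular M (List.ofFn z) ∧ ∀ m : M, a • m ∈ QQ M z 1 → m ∈ QQ M z 1 := by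
  rw [← wr_snoc, List.ofFn_succ]
  simp only [Fin.cons_zero, Fin.cons_succ]
  have h : List.Perm (a :: List.ofFn z) (List.ofFn z ++ [a]) := (List.perm_append_singleton _ _).symm
  have hm : ∀ r ∈ (a :: List.ofFn z), r ∈ maximalIdeal R := by
    intro r hr
    rcases List.mem_cons.1 hr with rfl | hr
    · exact ha
    · obtain ⟨i, rfl⟩ := List.mem_ofFn.1 hr
      exact hz i
  exact ⟨fun H => isWeaklyRegular_of_perm_of_subset_maximalIdeal H h hm,
    fun H => isWeaklyRegular_of_perm_of_subset_maximalIdeal H h.symm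
      (fun r hr => hm r (h.mem_iff.2 hr))⟩

theorem wr_cons' (a : R) (z : Fin d → R) :
    IsWeaklyRegular M (List.ofFn (Fin.cons a z : Fin (d+1) → R)) ↔
    IsSMulRegular M a ∧ IsWeaklyRegular (QuotSMulTop a M) (List.ofFn z) := by
  rw [List.ofFn_succ]
  simp only [Fin.cons_zero, Fin.cons_succ]
  exact isWeaklyRegular_cons_iff _ _ _

/-- Krull intersection, relative to a submodule -/
theorem krull_mem {a : R} (ha : a ∈ maximalIdeal R) (L : Submodule R M) {m : M}
    (h : ∀ n : ℕ, 1 ≤ n → ∃ m1 : M, m - a ^ n • m1 ∈ L) : m ∈ L := by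
  have key := Ideal.iInf_pow_smul_eq_bot_of_isLocalRing (R := R) (M := M ⧸ L) (maximalIdeal R)
    (Ideal.IsPrime.ne_top inferInstance)
  rw [← Submodule.Quotient.mk_eq_zero, ← Submodule.mem_bot R, ← key, Submodule.mem_iInf]
  intro n
  obtain ⟨m1, h1⟩ := h (n + 1) (by omega)
  have e : (Submodule.Quotient.mk m : M ⧸ L) = a ^ (n+1) • Submodule.Quotient.mk m1 := by
    rw [← Submodule.Quotient.mk_smul]
    exact (Submodule.Quotient.eq L).2 h1
  rw [e]
  exact Submodule.smul_mem_smul (Ideal.pow_le_pow_right (Nat.le_succ n) (Ideal.pow_mem_pow ha _)) Submodule.mem_top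
end

/-- the equivalence swapping two quotients -/
theorem quot_comm {R : Type u} [CommRing R] (M : Type*) [AddCommGroup M] [Module R M] (a b : R) :
    Nonempty (QuotSMulTop a (QuotSMulTop b M) ≃ₗ[R] QuotSMulTop b (QuotSMulTop a M)) := by
  have key : ∀ a b : R, Nonempty (QuotSMulTop a (QuotSMulTop b M) ≃ₗ[R]
      M ⧸ (b • (⊤ : Submodule R M) ⊔ a • (⊤ : Submodule R M))) := fun a b =>
    ⟨(Submodule.quotEquivOfEq _ _ (by
        rw [Submodule.map_pointwise_smul, Submodule.map_top, Submodule.range_mkQ])).symm ≪≫ₗ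
      Submodule.quotientQuotientEquivQuotientSup (b • (⊤ : Submodule R M)) (a • (⊤ : Submodule R M))⟩
  obtain ⟨e⟩ := key a b
  obtain ⟨e'⟩ := key b a
  exact ⟨e ≪≫ₗ Submodule.quotEquivOfEq _ _ (sup_comm _ _) ≪≫ₗ e'.symm⟩

section
variable {R : Type u} [CommRing R] [IsLocalRing R] [IsNoetherianRing R]

theorem krull_wr {a : R} (ha : a ∈ maximalIdeal R) (rs : List R) (M : Type*) [AddCommGroup M]
    [Module R M] [Module.Finite R M]
    (h : ∀ n : ℕ, 1 ≤ n → IsWeaklyRegular (QuotSMulTop (a ^ n) M) rs) : IsWeaklyRegular M rs := by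
  induction rs generalizing M with
  | nil => exact IsWeaklyRegular.nil _ _
  | cons r rs ih =>
    simp only [isWeaklyRegular_cons_iff] at h ⊢
    refine ⟨?_, ih _ fun n hn => ?_⟩
    · rw [isSMulRegular_iff_right_eq_zero_of_smul]
      intro m hm
      rw [← Submodule.mem_bot R]
      refine krull_mem ha ⊥ fun n hn => ?_
      have h1 := (h n hn).1
      rw [isSMulRegular_quotient_iff_mem_of_smul_mem] at h1
      obtain ⟨m1, -, e⟩ := (Submodule.mem_smul_pointwise_iff_exists _ _ _).1
        (h1 m (by rw [hm]; exact Submodule.zero_mem _))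
      exact ⟨m1, by rw [e, sub_self]; exact Submodule.zero_mem _⟩
    · obtain ⟨e⟩ := quot_comm M (a ^ n) r
      exact (e.isWeaklyRegular_congr rs).2 (h n hn).2

theorem wr_of_P {d : ℕ} (M : Type*) [AddCommGroup M] [Module R M] [Module.Finite R M]
    (y : Fin d → R) (hy : ∀ i, y i ∈ maximalIdeal R)
    (hP : ∀ (s : ℕ) (m : M), (∏ i, y i) ^ s • m ∈ QQ M y (1 + s) → m ∈ QQ M y 1) :
    IsWeaklyRegular M (List.ofFn y) := by
  induction d generalizing M with
  | zero => rw [List.ofFn_zero]; exact IsWeaklyRegular.nil _ _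
  | succ d ih =>
    obtain ⟨a, z, rfl⟩ : ∃ (a : R) (z : Fin d → R), y = Fin.cons a z :=
      ⟨y 0, fun i => y i.succ, (Fin.cons_self_tail y).symm⟩
    have ha : a ∈ maximalIdeal R := by simpa using hy 0
    have hz : ∀ i, z i ∈ maximalIdeal R := fun i => by simpa using hy i.succ
    simp only [mem_QQ_cons, Fin.prod_univ_succ, Fin.cons_zero, Fin.cons_succ, pow_one] at hP
    have K : ∀ (n : ℕ) (s : ℕ) (m m1 : M), a ^ s • (∏ i, z i) ^ s • m - a ^ (n + s) • m1 ∈ QQ M z (1 + s) →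
        ∃ m2, m - a ^ n • m2 ∈ QQ M z 1 := by
      intro n
      induction n with
      | zero =>
        intro s m m1 _
        exact ⟨m, by rw [pow_zero, one_smul, sub_self]; exact Submodule.zero_mem _⟩
      | succ n ihn =>
        intro s m m1 h
        obtain ⟨m', hm'⟩ := hP s m ⟨a ^ n • m1, by
          rw [mul_pow, mul_smul, smul_smul (a ^ (1 + s)), ← pow_add]
          rwa [show 1 + s + n = n + 1 + s by ring]⟩
        obtain ⟨m2, h2⟩ := ihn (s + 1) m' ((∏ i, z i) • m1) (by
          have h3 := prod_smul_QQ z 1 s hm'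
          have h4 := Submodule.sub_mem _ h (Submodule.smul_mem _ (a ^ s) h3)
          have h5 := prod_smul_QQ z (1 + s) 1 h4
          rw [show 1 + (s + 1) = 1 + s + 1 by ring]
          convert h5 using 1
          module)
        refine ⟨m2, ?_⟩
        have := Submodule.add_mem _ hm' (Submodule.smul_mem _ a h2)
        convert this using 1
        module
    rw [wr_cons a z ha hz]
    refine ⟨krull_wr ha _ _ fun n hn => ih _ z hz ?_, fun m hm => ?_⟩
    · intro s m
      obtain ⟨m, rfl⟩ := Submodule.Quotient.mk_surjective _ m
      rw [← Submodule.Quotient.mk_smul, mk_mem_QQ, mk_mem_QQ]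
      rintro ⟨m1, h⟩
      refine K n s m m1 ?_
      have := Submodule.smul_mem _ (a ^ s) h
      convert this using 1
      module
    · refine krull_mem ha _ fun n hn => K n 1 m 0 ?_
      have := prod_smul_QQ z 1 1 hm
      convert this using 1
      module

theorem wr_facts {d : ℕ} {M : Type*} [AddCommGroup M] [Module R M] [Module.Finite R M]
    {a : R} {z : Fin d → R} (ha : a ∈ maximalIdeal R) (hz : ∀ i, z i ∈ maximalIdeal R)
    (h : IsWeaklyRegular M (List.ofFn (Fin.cons a z : Fin (d+1) → R)))
    (hpow : ∀ t, 1 ≤ t → IsWeaklyRegular (QuotSMulTop a M) (List.ofFn fun i => z i ^ t))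
    (t : ℕ) (ht : 1 ≤ t) : IsWeaklyRegular M (List.ofFn fun i => z i ^ t) ∧
      ∀ (k : ℕ) (m : M), a ^ k • m ∈ QQ M z t → m ∈ QQ M z t := by
  have hzt : ∀ i, z i ^ t ∈ maximalIdeal R := fun i => Ideal.pow_mem_of_mem _ (hz i) _ ht
  rw [wr_cons'] at h
  have h1 := (wr_cons' a (fun i => z i ^ t)).2 ⟨h.1, hpow t ht⟩
  rw [wr_cons a _ ha hzt] at h1
  refine ⟨h1.1, fun k => ?_⟩
  rw [QQ_pow, mul_one] at h1
  induction k with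
  | zero => intro m hm; rwa [pow_zero, one_smul] at hm
  | succ k ih =>
    intro m hm
    rw [pow_succ, mul_smul] at hm
    exact h1.2 m (ih _ hm)

theorem wr_pow {d : ℕ} (M : Type*) [AddCommGroup M] [Module R M] [Module.Finite R M]
    (y : Fin d → R) (hy : ∀ i, y i ∈ maximalIdeal R) (h : IsWeaklyRegular M (List.ofFn y)) (t : ℕ)
    (ht : 1 ≤ t) : IsWeaklyRegular M (List.ofFn fun i => y i ^ t) := by
  induction d generalizing M t with
  | zero => rw [List.ofFn_zero]; exact IsWeaklyRegular.nil _ _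
  | succ d ih =>
    obtain ⟨a, z, rfl⟩ : ∃ (a : R) (z : Fin d → R), y = Fin.cons a z :=
      ⟨y 0, fun i => y i.succ, (Fin.cons_self_tail y).symm⟩
    have ha : a ∈ maximalIdeal R := by simpa using hy 0
    have hz : ∀ i, z i ∈ maximalIdeal R := fun i => by simpa using hy i.succ
    have hzt : ∀ i, z i ^ t ∈ maximalIdeal R := fun i => Ideal.pow_mem_of_mem _ (hz i) _ ht
    obtain ⟨h1, h2⟩ := wr_facts ha hz h (ih _ z hz ((wr_cons' _ _).1 h).2) t ht
    rw [cons_pow, wr_cons _ _ (Ideal.pow_mem_of_mem _ ha _ ht) hzt, QQ_pow, mul_one]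
    exact ⟨h1, h2 t⟩

theorem wr_facts' {d : ℕ} {M : Type*} [AddCommGroup M] [Module R M] [Module.Finite R M]
    {a : R} {z : Fin d → R} (ha : a ∈ maximalIdeal R) (hz : ∀ i, z i ∈ maximalIdeal R)
    (h : IsWeaklyRegular M (List.ofFn (Fin.cons a z : Fin (d+1) → R))) :
    (∀ (t : ℕ) (_ : 1 ≤ t) (k : ℕ) (m : M), a ^ k • m ∈ QQ M z t → m ∈ QQ M z t) ∧
    ∀ t, 1 ≤ t → IsWeaklyRegular (QuotSMulTop (a ^ t) M) (List.ofFn z) := by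
  have F := wr_facts ha hz h (wr_pow _ z hz ((wr_cons' _ _).1 h).2)
  refine ⟨fun t ht => (F t ht).2, fun t ht => ?_⟩
  have h1 := (F 1 le_rfl)
  simp only [pow_one] at h1
  exact ((wr_cons' _ _).1 ((wr_cons (a ^ t) z (Ideal.pow_mem_of_mem _ ha _ ht) hz).2
    ⟨h1.1, h1.2 t⟩)).2

theorem reg_inj {d : ℕ} (M : Type*) [AddCommGroup M] [Module R M] [Module.Finite R M]
    (y : Fin d → R) (hy : ∀ i, y i ∈ maximalIdeal R) (h : IsWeaklyRegular M (List.ofFn y)) (t : ℕ)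
    (ht : 1 ≤ t) (s : ℕ) (m : M) (hm : (∏ i, y i) ^ s • m ∈ QQ M y (t + s)) : m ∈ QQ M y t := by
  induction d generalizing M with
  | zero =>
    unfold QQ at hm ⊢
    simpa using hm
  | succ d ih =>
    obtain ⟨a, z, rfl⟩ : ∃ (a : R) (z : Fin d → R), y = Fin.cons a z :=
      ⟨y 0, fun i => y i.succ, (Fin.cons_self_tail y).symm⟩
    have ha : a ∈ maximalIdeal R := by simpa using hy 0
    have hz : ∀ i, z i ∈ maximalIdeal R := fun i => by simpa using hy i.succ
    obtain ⟨F1, F2⟩ := wr_facts' ha hz h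
    simp only [mem_QQ_cons, Fin.prod_univ_succ, Fin.cons_zero, Fin.cons_succ] at hm ⊢
    obtain ⟨m1, hm⟩ := hm
    have h1 := F1 (t + s) (by omega) s ((∏ i, z i) ^ s • m - a ^ t • m1) (by
      convert hm using 1
      module)
    have := ih _ z hz (F2 t ht) (Submodule.Quotient.mk m) (by
      rw [← Submodule.Quotient.mk_smul, mk_mem_QQ]
      exact ⟨m1, h1⟩)
    rwa [mk_mem_QQ] at this

theorem reg_soc {d : ℕ} (M : Type*) [AddCommGroup M] [Module R M] [Module.Finite R M]
    (y : Fin d → R) (hy : ∀ i, y i ∈ maximalIdeal R) (h : IsWeaklyRegular M (List.ofFn y)) (t : ℕ)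
    (m : M) (hm : ∀ i, y i • m ∈ QQ M y (t + 1)) : ∃ m', m - (∏ i, y i) ^ t • m' ∈ QQ M y (t + 1) := by
  induction d generalizing M with
  | zero => exact ⟨m, by simp⟩
  | succ d ih =>
    obtain ⟨a, z, rfl⟩ : ∃ (a : R) (z : Fin d → R), y = Fin.cons a z :=
      ⟨y 0, fun i => y i.succ, (Fin.cons_self_tail y).symm⟩
    have ha : a ∈ maximalIdeal R := by simpa using hy 0
    have hz : ∀ i, z i ∈ maximalIdeal R := fun i => by simpa using hy i.succ
    obtain ⟨F1, F2⟩ := wr_facts' ha hz h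
    simp only [mem_QQ_cons, Fin.prod_univ_succ, Fin.cons_zero, Fin.cons_succ] at hm ⊢
    obtain ⟨m1, hm1⟩ := hm 0
    have h1 := F1 (t + 1) (by omega) 1 (m - a ^ t • m1) (by
      rw [Fin.cons_zero] at hm1
      convert hm1 using 1
      module)
    have F3 := F2 1 le_rfl
    rw [pow_one] at F3
    obtain ⟨m', hm'⟩ := ih _ z hz F3 (Submodule.Quotient.mk m1) (by
      intro i
      rw [← Submodule.Quotient.mk_smul, mk_mem_QQ]
      obtain ⟨m2, h2⟩ := hm i.succ
      rw [Fin.cons_succ] at h2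
      refine ⟨m2, F1 (t + 1) (by omega) t _ ?_⟩
      have := Submodule.sub_mem _ h2 (Submodule.smul_mem _ (z i) h1)
      convert this using 1
      module)
    obtain ⟨m', rfl⟩ := Submodule.Quotient.mk_surjective _ m'
    rw [← Submodule.Quotient.mk_smul, ← Submodule.Quotient.mk_sub, mk_mem_QQ] at hm'
    obtain ⟨m3, h3⟩ := hm'
    refine ⟨m', m3, ?_⟩
    have := Submodule.add_mem _ h1 (Submodule.smul_mem _ (a ^ t) h3)
    convert this using 1
    module

/-- for a regular sequence the socle dimension of `M/yM` is that of the limit -/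
theorem reg_ir {M H : Type u} [AddCommGroup M] [Module R M] [Module.Finite R M]
    [AddCommGroup H] [Module R H] {d : ℕ} {y : Fin d → R} {θ : ℕ → M →ₗ[R] H} (h : IsLim y θ)
    (hy : ∀ i, y i ∈ maximalIdeal R) (hr : IsWeaklyRegular M (List.ofFn y)) :
    Module.finrank (R ⧸ maximalIdeal R) (Soc (R := R) (M ⧸ (Ideal.span (Set.range y) • ⊤ : Submodule R M))) =
      Module.finrank (R ⧸ maximalIdeal R) (Soc (R := R) H) := by
  rw [← QQ_one]
  let g : (M ⧸ QQ M y 1) →ₗ[R] H := (QQ M y 1).liftQ (θ 1) (fun m hm => h.zero hm)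
  have hk : ∀ t, 1 ≤ t → ∀ m, θ t m = 0 → m ∈ QQ M y t := by
    intro t ht m hm
    obtain ⟨s, hs⟩ := (h.ker t m).1 hm
    exact reg_inj M y hy hr t ht s m hs
  have hg : Function.Injective g := by
    rw [← LinearMap.ker_eq_bot, LinearMap.ker_eq_bot']
    intro m hm
    obtain ⟨m, rfl⟩ := Submodule.Quotient.mk_surjective _ m
    rw [Submodule.Quotient.mk_eq_zero]
    exact hk 1 le_rfl m hm
  obtain ⟨g', hg'⟩ := soc_map g
  refine LinearEquiv.finrank_eq (LinearEquiv.ofBijective g' ⟨fun a b hab => ?_, ?_⟩)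
  · apply Subtype.ext
    apply hg
    rw [← hg', ← hg', hab]
  · rintro ⟨a, ha⟩
    obtain ⟨t, m, rfl⟩ := h.surj a
    have e1 := h.steps t 1 m
    rw [← e1] at ha
    obtain ⟨m', hm'⟩ := reg_soc M y hy hr t ((∏ i, y i) ^ 1 • m) (fun i => hk (t + 1) (by omega) _ (by
      rw [map_smul]; exact mem_Soc.1 ha _ (hy i)))
    have e2 : θ t m = θ 1 m' := by
      have := h.zero hm'
      rw [map_sub, sub_eq_zero, add_comm t 1, h.steps 1 t m'] at this
      rw [← e1, ← this, add_comm t 1]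
    have h3 : Submodule.Quotient.mk m' ∈ Soc (R := R) (M ⧸ QQ M y 1) := by
      rw [mem_Soc]
      intro r hr
      apply hg
      rw [map_zero, map_smul]
      change r • θ 1 m' = 0
      rw [← e2, ← e1]
      exact mem_Soc.1 ha r hr
    exact ⟨⟨_, h3⟩, Subtype.ext (by rw [hg']; exact e2.symm)⟩
end

end
end LC

namespace LC
open CategoryTheory Limits Opposite IsLocalRing
noncomputable section
open RingTheory.Sequence
open scoped Pointwise

section
variable {R : Type u} [CommRing R] [IsLocalRing R] [IsNoetherianRing R]

/-- there is a weakly regular sequence of length `n` in the maximal ideal -/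
def DD (n : ℕ) (C : Type*) [AddCommGroup C] [Module R C] : Prop :=
  ∃ rs : List R, rs.length = n ∧ (∀ r ∈ rs, r ∈ maximalIdeal R) ∧ IsWeaklyRegular C rs

theorem DD.congr {n : ℕ} {C C' : Type*} [AddCommGroup C] [Module R C] [AddCommGroup C'] [Module R C']
    (e : C ≃ₗ[R] C') (h : DD (R := R) n C) : DD (R := R) n C' := by
  obtain ⟨rs, h1, h2, h3⟩ := h
  exact ⟨rs, h1, h2, (e.isWeaklyRegular_congr rs).1 h3⟩

theorem DD.succ {n : ℕ} {C : Type*} [AddCommGroup C] [Module R C] {r : R} (hr : r ∈ maximalIdeal R)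
    (hreg : IsSMulRegular C r) (h : DD (R := R) n (QuotSMulTop r C)) : DD (R := R) (n+1) C := by
  obtain ⟨rs, h1, h2, h3⟩ := h
  refine ⟨r :: rs, by simp [h1], ?_, (isWeaklyRegular_cons_iff _ _ _).2 ⟨hreg, h3⟩⟩
  intro s hs
  rcases List.mem_cons.1 hs with rfl | hs
  exacts [hr, h2 s hs]

theorem DD.exists {n : ℕ} {C : Type*} [AddCommGroup C] [Module R C] (h : DD (R := R) (n+1) C) :
    ∃ r ∈ maximalIdeal R, IsSMulRegular C r ∧ DD (R := R) n (QuotSMulTop r C) := by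
  obtain ⟨rs, h1, h2, h3⟩ := h
  match rs, h1 with
  | r :: rs, h1 =>
    rw [isWeaklyRegular_cons_iff] at h3
    exact ⟨r, h2 r (by simp), h3.1, rs, by simpa using h1, fun s hs => h2 s (by simp [hs]), h3.2⟩

theorem common_regular {A B : Type*} [AddCommGroup A] [Module R A] [Module.Finite R A]
    [AddCommGroup B] [Module R B] [Module.Finite R B]
    (hA : ∀ a : A, (∀ r ∈ maximalIdeal R, r • a = 0) → a = 0)
    (hB : ∀ a : B, (∀ r ∈ maximalIdeal R, r • a = 0) → a = 0) :
    ∃ z ∈ maximalIdeal R, IsSMulRegular A z ∧ IsSMulRegular B z := by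
  have : Subsingleton ((R ⧸ maximalIdeal R) →ₗ[R] (A × B)) := by
    refine subsingleton_of_forall_eq 0 fun f => ?_
    have key : ∀ r ∈ maximalIdeal R, r • f 1 = 0 := by
      intro r hr
      rw [← map_smul]
      have : r • (1 : R ⧸ maximalIdeal R) = 0 := by
        rw [Algebra.smul_def, mul_one]
        exact Ideal.Quotient.eq_zero_iff_mem.2 hr
      rw [this, map_zero]
    have h1 : f 1 = 0 := Prod.ext (hA (f 1).1 fun r hr => congrArg Prod.fst (key r hr))
      (hB (f 1).2 fun r hr => congrArg Prod.snd (key r hr))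
    refine LinearMap.ext fun q => ?_
    obtain ⟨r, rfl⟩ := Ideal.Quotient.mk_surjective q
    have : Ideal.Quotient.mk (maximalIdeal R) r = r • 1 := by rw [Algebra.smul_def, mul_one]; rfl
    rw [this, map_smul, h1, smul_zero, LinearMap.zero_apply]
  obtain ⟨z, hz, hreg⟩ := IsSMulRegular.subsingleton_linearMap_iff.1 this
  rw [Ideal.annihilator_quotient] at hz
  refine ⟨z, hz, fun a a' h => ?_, fun a a' h => ?_⟩
  · have := @hreg (a, 0) (a', 0) (Prod.ext h rfl)
    exact congrArg Prod.fst this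
  · have := @hreg (0, a) (0, a') (Prod.ext rfl h)
    exact congrArg Prod.snd this

theorem swap_reg {C : Type*} [AddCommGroup C] [Module R C] [Module.Finite R C] {x z : R}
    (hx : x ∈ maximalIdeal R) (hz : z ∈ maximalIdeal R) (h1 : IsSMulRegular C x)
    (h2 : IsSMulRegular (QuotSMulTop x C) z) :
    IsSMulRegular C z ∧ IsSMulRegular (QuotSMulTop z C) x := by
  have : IsWeaklyRegular C [x, z] := (isWeaklyRegular_cons_iff _ _ _).2 ⟨h1,
    (isWeaklyRegular_singleton_iff _ _).2 h2⟩
  have := isWeaklyRegular_of_perm_of_subset_maximalIdeal this (List.Perm.swap z x []) (by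
    intro r hr
    simp only [List.mem_cons, List.not_mem_nil, or_false] at hr
    rcases hr with rfl | rfl <;> assumption)
  rwa [isWeaklyRegular_cons_iff, isWeaklyRegular_singleton_iff] at this

theorem exchange {n : ℕ} (C : Type*) [AddCommGroup C] [Module R C] [Module.Finite R C]
    (h : DD (R := R) (n+1) C) {y : R} (hy : y ∈ maximalIdeal R) (hreg : IsSMulRegular C y) :
    DD (R := R) n (QuotSMulTop y C) := by
  induction n generalizing C y with
  | zero => exact ⟨[], rfl, by simp, IsWeaklyRegular.nil _ _⟩
  | succ n ih =>
    obtain ⟨x, hx, hxr, hD⟩ := h.exists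
    obtain ⟨x2, hx2, hx2r, -⟩ := hD.exists
    have hA : ∀ a : QuotSMulTop x C, (∀ r ∈ maximalIdeal R, r • a = 0) → a = 0 := fun a ha =>
      hx2r.right_eq_zero_of_smul (ha x2 hx2)
    have memx : ∀ (x : R) (c : C), (Submodule.Quotient.mk c : QuotSMulTop x C) = 0 ↔ ∃ c', x • c' = c := by
      intro x c
      rw [Submodule.Quotient.mk_eq_zero, Submodule.mem_smul_pointwise_iff_exists]
      simp
    have hB : ∀ a : QuotSMulTop y C, (∀ r ∈ maximalIdeal R, r • a = 0) → a = 0 := by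
      intro c hc
      obtain ⟨c, rfl⟩ := Submodule.Quotient.mk_surjective _ c
      simp only [← Submodule.Quotient.mk_smul, memx] at hc ⊢
      obtain ⟨c', hc'⟩ := hc x hx
      have : (Submodule.Quotient.mk c' : QuotSMulTop x C) = 0 := by
        apply hA
        intro r hr
        rw [← Submodule.Quotient.mk_smul, memx]
        obtain ⟨e, he⟩ := hc r hr
        refine ⟨e, hreg ?_⟩
        change y • x • e = y • r • c'
        rw [smul_comm y r, hc', smul_comm y x, he, smul_comm]
      rw [memx] at this
      obtain ⟨e, rfl⟩ := this
      refine ⟨e, hxr ?_⟩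
      change x • y • e = x • c
      rw [smul_comm, hc']
    obtain ⟨z, hz, hzA, hzB⟩ := common_regular hA hB
    obtain ⟨hz1, hz2⟩ := swap_reg hx hz hxr hzA
    obtain ⟨-, hz3⟩ := swap_reg hy hz hreg hzB
    have h1 : DD (R := R) n (QuotSMulTop z (QuotSMulTop x C)) := ih _ hD hz hzA
    obtain ⟨e⟩ := quot_comm C z x
    have h2 : DD (R := R) (n+1) (QuotSMulTop z C) := DD.succ hx hz2 (h1.congr e)
    have h3 := ih _ h2 hy hz3
    obtain ⟨e⟩ := quot_comm C y z
    exact DD.succ hz hzB (h3.congr e)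

theorem dim_lemma {n : ℕ} (C : Type*) [AddCommGroup C] [Module R C] [Module.Finite R C]
    (h : DD (R := R) n C) (I : Submodule R C) (hI : I ≠ ⊥) : (n : WithBot ℕ∞) ≤ Module.supportDim R I := by
  induction n generalizing C with
  | zero =>
    have : Nontrivial I := (Submodule.nontrivial_iff_ne_bot).2 hI
    have : Nonempty (Module.support R I) := Module.nonempty_support_of_nontrivial.to_subtype
    rw [Nat.cast_zero]
    exact Order.krullDim_nonneg
  | succ n ih =>
    obtain ⟨x, hx, hxr, hD⟩ := h.exists
    let N : Submodule R C := Submodule.torsionBySet R C (Module.annihilator R I : Set R)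
    have memN : ∀ c, c ∈ N ↔ ∀ r ∈ Module.annihilator R I, r • c = 0 := by
      intro c
      rw [Submodule.mem_torsionBySet_iff]
      exact ⟨fun h r hr => h ⟨r, hr⟩, fun h r => h r.1 r.2⟩
    have hIN : I ≤ N := by
      intro c hc
      rw [memN]
      intro r hr
      exact congrArg Subtype.val (Module.mem_annihilator.1 hr ⟨c, hc⟩)
    have hann : Module.annihilator R N = Module.annihilator R I := by
      apply le_antisymm
      · exact LinearMap.annihilator_le_of_injective (Submodule.inclusion hIN)
          (Submodule.inclusion_injective hIN)
      · intro r hr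
        rw [Module.mem_annihilator]
        rintro ⟨c, hc⟩
        exact Subtype.ext ((memN c).1 hc r hr)
    have hNI : Nontrivial I := (Submodule.nontrivial_iff_ne_bot).2 hI
    have hNN : Nontrivial N := (Submodule.inclusion_injective hIN).nontrivial
    have hdim : Module.supportDim R I = Module.supportDim R N := by
      rw [Module.supportDim_eq_ringKrullDim_quotient_annihilator,
        Module.supportDim_eq_ringKrullDim_quotient_annihilator, hann]
    have hxN : IsSMulRegular N x := fun a b hab => Subtype.ext (hxr (congrArg Subtype.val hab))
    rw [hdim, ← Module.supportDim_quotSMulTop_succ_eq_supportDim hxN hx]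
    have := nontrivial_quotSMulTop_of_mem_maximalIdeal N hx
    let f : QuotSMulTop x N →ₗ[R] QuotSMulTop x C := QuotSMulTop.map x N.subtype
    have hf : Function.Injective f := by
      rw [← LinearMap.ker_eq_bot, LinearMap.ker_eq_bot']
      intro c hc
      obtain ⟨c, rfl⟩ := Submodule.Quotient.mk_surjective _ c
      have hc : (Submodule.Quotient.mk (c : C) : QuotSMulTop x C) = 0 := hc
      rw [Submodule.Quotient.mk_eq_zero, Submodule.mem_smul_pointwise_iff_exists] at hc ⊢
      obtain ⟨e, -, he⟩ := hc
      refine ⟨⟨e, (memN e).2 fun r hr => hxr ?_⟩, Submodule.mem_top, Subtype.ext he⟩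
      change x • r • e = x • 0
      rw [smul_comm, he, smul_zero]
      exact (memN c).1 c.2 r hr
    have hJ := ih (QuotSMulTop x C) hD (LinearMap.range f) (by
      rw [← Submodule.nontrivial_iff_ne_bot]
      exact (LinearEquiv.ofInjective f hf).injective.nontrivial)
    rw [← Module.supportDim_eq_of_equiv (LinearEquiv.ofInjective f hf)] at hJ
    push_cast
    gcongr

end
end
end LC

namespace LC
open CategoryTheory Limits Opposite IsLocalRing
noncomputable section
open RingTheory.Sequence
open scoped Pointwise

theorem wb_cancel {a : WithBot ℕ∞} {n k : ℕ} (h : a + k = (n : WithBot ℕ∞) + k) : a = n := by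
  match a with
  | ⊥ => 
    rw [WithBot.bot_add] at h
    exact absurd h (WithBot.bot_ne_coe (a := ((n : ℕ∞) + (k : ℕ∞))))
  | some a =>
    have h : ((a + k : ℕ∞) : WithBot ℕ∞) = ((n + k : ℕ∞) : WithBot ℕ∞) := h
    have h1 := WithBot.coe_injective h
    have h2 : a = n := (ENat.add_left_injective_of_ne_top (ENat.coe_ne_top k)) h1
    rw [h2]; rfl

section
variable {R : Type u} [CommRing R] [IsLocalRing R] [IsNoetherianRing R]

theorem QQ_le {d : ℕ} (M : Type*) [AddCommGroup M] [Module R M] (x : Fin d → R)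
    (hx : ∀ i, x i ∈ maximalIdeal R) (s : ℕ) : QQ M x s ≤ maximalIdeal R ^ s • ⊤ :=
  mem_QQ_ind _ _ _ fun i _ => Submodule.smul_mem_smul (Ideal.pow_mem_pow (hx i) s) Submodule.mem_top

theorem QQ_map {d : ℕ} {M C : Type*} [AddCommGroup M] [Module R M] [AddCommGroup C] [Module R C]
    (φ : M →ₗ[R] C) (x : Fin d → R) (s : ℕ) {m : M} (h : m ∈ QQ M x s) : φ m ∈ QQ C x s := by
  have : QQ M x s ≤ (QQ C x s).comap φ := mem_QQ_ind _ _ _ fun i m => by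
    rw [Submodule.mem_comap, map_smul]
    exact smul_mem_QQ _ _ _ _
  exact this h

theorem par_of_wr {n : ℕ} {M C : Type*} [AddCommGroup M] [Module R M] [Module.Finite R M]
    [AddCommGroup C] [Module R C] [Module.Finite R C] [Nontrivial C] {x : Fin n → R}
    (hx : ∀ i, x i ∈ maximalIdeal R) (hw : IsWeaklyRegular C (List.ofFn x))
    (hdim : Module.supportDim R C = n) (hs : Module.support R M ⊆ Module.support R C) : Par M x := by
  have hr : IsRegular C (List.ofFn x) := .of_isWeaklyRegular_of_mem_maximalIdeal _ (by
    intro r hr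
    obtain ⟨i, rfl⟩ := List.mem_ofFn.1 hr
    exact hx i) hw
  have h1 := Module.supportDim_add_length_eq_supportDim_of_isRegular _ hr
  rw [hdim, List.length_ofFn, ofList_ofFn] at h1
  have h2 := wb_cancel (n := 0) (k := n) (by rw [h1, Nat.cast_zero, zero_add])
  rw [Nat.cast_zero] at h2
  have h3 := support_of_supportDim_eq_zero _ _ h2
  rw [Module.support_quotient] at h3
  intro r hr
  rw [Ideal.radical_eq_sInf, Ideal.mem_sInf]
  rintro p ⟨hp, hpp⟩
  have h4 : (⟨p, hpp⟩ : PrimeSpectrum R) ∈ Module.support R C ∩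
      PrimeSpectrum.zeroLocus (Ideal.span (Set.range x)) := by
    refine ⟨hs ?_, le_sup_left.trans hp⟩
    rw [Module.support_eq_zeroLocus]
    exact le_sup_right.trans hp
  rw [h3] at h4
  exact h4 hr

theorem supportDim_mono {M C : Type*} [AddCommGroup M] [Module R M]
    [AddCommGroup C] [Module R C] (hs : Module.support R M ⊆ Module.support R C) :
    Module.supportDim R M ≤ Module.supportDim R C :=
  Order.krullDim_le_of_strictMono (fun a => ⟨a.1, hs a.2⟩) (fun {_ _} lt => lt)

theorem nonvanish_hom {n : ℕ} (M : Type*) [AddCommGroup M] [Module R M] [Module.Finite R M]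
    (C : Type*) [AddCommGroup C] [Module R C] [Module.Finite R C] [Nontrivial C] (hD : DD (R := R) n C)
    (hdim : Module.supportDim R C = n) (hs : Module.support R M ⊆ Module.support R C)
    (φ : M →ₗ[R] C) (hφ : φ ≠ 0) :
    ∃ (d : ℕ) (x : Fin d → R), (∀ i, x i ∈ maximalIdeal R) ∧ Par M x ∧ Module.supportDim R M = d ∧
      ∃ (m : M) (s : ℕ), ∀ r, (∏ i, x i) ^ r • m ∉ QQ M x (s + r) := by
  have h1 : (n : WithBot ℕ∞) ≤ Module.supportDim R M :=
    (dim_lemma C hD (LinearMap.range φ) (by rwa [Ne, LinearMap.range_eq_bot])).trans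
      (Module.supportDim_le_of_surjective φ.rangeRestrict φ.surjective_rangeRestrict)
  have h2 : Module.supportDim R M = n := le_antisymm ((supportDim_mono hs).trans hdim.le) h1
  obtain ⟨rs, rfl, hm, hw⟩ := hD
  have hx : ∀ i, rs.get i ∈ maximalIdeal R := fun i => hm _ (List.get_mem _ _)
  have hw' : IsWeaklyRegular C (List.ofFn rs.get) := by rwa [List.ofFn_get]
  refine ⟨rs.length, rs.get, hx, par_of_wr hx hw' hdim hs, h2, ?_⟩
  obtain ⟨m, hm⟩ : ∃ m, φ m ≠ 0 := by
    by_contra! h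
    exact hφ (LinearMap.ext h)
  have key := Ideal.iInf_pow_smul_eq_bot_of_isLocalRing (R := R) (M := C) (maximalIdeal R)
    (Ideal.IsPrime.ne_top inferInstance)
  by_contra! hcon
  apply hm
  rw [← Submodule.mem_bot R, ← key, Submodule.mem_iInf]
  intro s
  refine Submodule.smul_mono_left (Ideal.pow_le_pow_right (Nat.le_succ s)) ?_
  obtain ⟨r, hr⟩ := hcon m (s + 1)
  have := QQ_map φ _ _ hr
  rw [map_smul] at this
  exact QQ_le C rs.get hx (s + 1) (reg_inj C _ hx hw' (s+1) (by omega) r _ this)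

theorem nonvanish_aux {n : ℕ} (M : Type*) [AddCommGroup M] [Module R M] [Module.Finite R M] [Nontrivial M]
    (C : Type*) [AddCommGroup C] [Module R C] [Module.Finite R C] (hD : DD (R := R) n C)
    (hdim : Module.supportDim R C = n) (hs : Module.support R M ⊆ Module.support R C) :
    ∃ (d : ℕ) (x : Fin d → R), (∀ i, x i ∈ maximalIdeal R) ∧ Par M x ∧ Module.supportDim R M = d ∧
      ∃ (m : M) (s : ℕ), ∀ r, (∏ i, x i) ^ r • m ∉ QQ M x (s + r) := by
  have hCn : Nontrivial C := by
    rw [← Module.nonempty_support_iff (R := R)]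
    exact (Module.nonempty_support_of_nontrivial (R := R) (M := M)).mono hs
  by_cases hsub : Subsingleton (M →ₗ[R] C)
  · obtain ⟨r, hr, hreg⟩ := IsSMulRegular.subsingleton_linearMap_iff.1 hsub
    have hrm : r ∈ maximalIdeal R := by
      refine le_maximalIdeal (fun h => ?_) hr
      rw [Module.annihilator_eq_top_iff] at h
      exact not_subsingleton M h
    have hd := Module.supportDim_quotSMulTop_succ_eq_supportDim hreg hrm
    have hQ := nontrivial_quotSMulTop_of_mem_maximalIdeal C hrm
    rw [hdim] at hd
    match n with
    | 0 =>
      exfalso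
      have : Nonempty (Module.support R (QuotSMulTop r C)) :=
        Module.nonempty_support_of_nontrivial.to_subtype
      have h0 : 0 ≤ Module.supportDim R (QuotSMulTop r C) := Order.krullDim_nonneg
      have h1 : (0 : WithBot ℕ∞) + 1 ≤ 0 := by
        rw [Nat.cast_zero] at hd
        exact (add_le_add_left h0 1).trans hd.le
      exact absurd h1 (by decide)
    | n + 1 =>
      refine nonvanish_aux (n := n) M (QuotSMulTop r C) (exchange C hD hrm hreg)
        (wb_cancel (k := 1) (by rw [Nat.cast_one, hd]; push_cast; rfl)) ?_
      rw [Module.support_quotSMulTop]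
      refine Set.subset_inter hs ?_
      rw [Module.support_eq_zeroLocus]
      exact PrimeSpectrum.zeroLocus_anti_mono (Set.singleton_subset_iff.2 hr)
  · rw [not_subsingleton_iff_nontrivial] at hsub
    obtain ⟨φ, hφ⟩ := exists_ne (0 : M →ₗ[R] C)
    exact nonvanish_hom M C hD hdim hs φ hφ
end
end
end LC

namespace LC
open CategoryTheory Limits Opposite IsLocalRing
noncomputable section
open RingTheory.Sequence Paper
open scoped Pointwise

section
variable {R : Type u} [CommRing R] [IsLocalRing R] [IsNoetherianRing R]

theorem mdim_eq (M : Type u) [AddCommGroup M] [Module R M] [Module.Finite R M] :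
    mdim R M = Module.supportDim R M :=
  (Module.supportDim_eq_ringKrullDim_quotient_annihilator R M).symm

theorem nontrivial_of_dim {M : Type u} [AddCommGroup M] [Module R M] [Module.Finite R M] {n : ℕ}
    (h : Module.supportDim R M = n) : Nontrivial M := by
  rw [← Module.supportDim_ne_bot_iff_nontrivial R, h]
  exact WithBot.coe_ne_bot (a := (n : ℕ∞))

theorem isCM_iff {M : Type u} [AddCommGroup M] [Module R M] [Module.Finite R M] {n : ℕ}
    (h : Module.supportDim R M = n) : IsCM R M ↔ DD (R := R) n M := by
  have hN := nontrivial_of_dim h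
  unfold IsCM
  rw [mdim_eq, h]
  have hlub : IsLUB _ (depth R M) := WithTop.isLUB_sSup' (β := ℕ) (s := {n : WithTop ℕ | ∃ rs : List R, (rs.length : WithTop ℕ) = n ∧
    (∀ r ∈ rs, r ∈ maximalIdeal R) ∧ RingTheory.Sequence.IsRegular M rs}) ⟨_, [], rfl, by simp, IsRegular.nil R M⟩
  have hle : ∀ rs : List R, RingTheory.Sequence.IsRegular M rs → rs.length ≤ n := by
    intro rs hrs
    have h1 := Module.supportDim_add_length_eq_supportDim_of_isRegular _ hrs
    rw [h] at h1
    have := hrs.quot_ofList_smul_nontrivial ⊤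
    have : Nonempty (Module.support R (M ⧸ (Ideal.ofList rs • ⊤ : Submodule R M))) :=
      Module.nonempty_support_of_nontrivial.to_subtype
    have h0 : 0 ≤ Module.supportDim R (M ⧸ (Ideal.ofList rs • ⊤ : Submodule R M)) := Order.krullDim_nonneg
    have h2 := (add_le_add_left h0 (rs.length : WithBot ℕ∞)).trans h1.le
    rw [zero_add] at h2
    exact_mod_cast h2
  constructor
  · intro hdep
    have hdep : depth R M = (n : WithTop ℕ) := WithBot.coe_injective hdep
    match n with
    | 0 => exact ⟨[], rfl, by simp, IsWeaklyRegular.nil _ _⟩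
    | n + 1 =>
      by_contra hcon
      have : depth R M ≤ (n : WithTop ℕ) := by
        refine hlub.2 ?_
        rintro _ ⟨rs, rfl, h1, h2⟩
        have h3 := hle rs h2
        rcases Nat.lt_or_ge n rs.length with h4 | h4
        · exact absurd ⟨rs, by omega, h1, h2.toIsWeaklyRegular⟩ hcon
        · exact_mod_cast h4
      rw [hdep] at this
      have : n + 1 ≤ n := by exact_mod_cast this
      omega
  · rintro ⟨rs, rfl, h1, h2⟩
    have : depth R M = (rs.length : WithTop ℕ) := by
      apply le_antisymm
      · refine hlub.2 ?_
        rintro _ ⟨rs', rfl, h1, h2⟩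
        exact_mod_cast hle rs' h2
      · exact hlub.1 ⟨rs, rfl, h1, .of_isWeaklyRegular_of_mem_maximalIdeal _ h1 h2⟩
    rw [this]; rfl

theorem isSOP_iff {M : Type u} [AddCommGroup M] [Module R M] [Module.Finite R M] {d : ℕ} (x : Fin d → R) :
    IsSOP R M d x ↔ (∀ i, x i ∈ maximalIdeal R) ∧ Par M x := by
  unfold IsSOP
  rw [isFiniteLength_iff_isNoetherian_isArtinian]
  exact and_congr_right fun _ => ⟨fun h => par_of_artinian h.2, fun h => ⟨inferInstance, h.artinian⟩⟩

theorem exists_theta {M : Type u} [AddCommGroup M] [Module R M] [Module.Finite R M] [Nontrivial M]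
    {d : ℕ} (hd : 0 < d) (x : Fin d → R) (hx : ∀ i, x i ∈ maximalIdeal R) (hP : Par M x) :
    ∃ θ : ℕ → M →ₗ[R] ((localCohomology (maximalIdeal R) d).obj (ModuleCat.of R M)), IsLim x θ := by
  refine exists_isLim_lc _ hd x M (sup_le ?_ ?_) ?_
  · refine le_maximalIdeal fun h => ?_
    rw [Module.annihilator_eq_top_iff] at h
    exact not_subsingleton M h
  · rw [Ideal.span_le]
    rintro _ ⟨i, rfl⟩
    exact hx i
  · obtain ⟨N, hN⟩ := hP.exists_pow
    exact ⟨N, by rwa [sup_comm]⟩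

theorem nonvanish (hCM : IsQuotientOfCMLocalRing R) (M : Type u) [AddCommGroup M] [Module R M]
    [Module.Finite R M] {d : ℕ} (hdim : Module.supportDim R M = d) :
    ∃ x : Fin d → R, (∀ i, x i ∈ maximalIdeal R) ∧ Par M x ∧
      ∃ (m : M) (s : ℕ), ∀ r, (∏ i, x i) ^ r • m ∉ QQ M x (s + r) := by
  have hN := nontrivial_of_dim hdim
  obtain ⟨S, _, _, ⟨hS, hScm⟩, f, hf⟩ := hCM
  letI : Module S M := Module.compHom M f
  have hsm : ∀ (s : S) (m : M), s • m = f s • m := fun _ _ => rfl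
  have hfin : Module.Finite S M := by
    obtain ⟨t, ht⟩ := (Module.Finite.fg_top : (⊤ : Submodule R M).FG)
    refine ⟨⟨t, ?_⟩⟩
    rw [eq_top_iff]
    rintro m -
    have hm : m ∈ Submodule.span R (t : Set M) := by rw [ht]; exact Submodule.mem_top
    induction hm using Submodule.span_induction with
    | mem m hm => exact Submodule.subset_span hm
    | zero => exact Submodule.zero_mem _
    | add a b _ _ ha hb => exact Submodule.add_mem _ ha hb
    | smul r a _ ha =>
      obtain ⟨s, rfl⟩ := hf r
      exact Submodule.smul_mem _ s ha
  have hmem : ∀ s : S, s ∈ maximalIdeal S ↔ f s ∈ maximalIdeal R := by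
    have := IsLocalHom.of_surjective f hf
    intro s
    rw [mem_maximalIdeal, mem_maximalIdeal, mem_nonunits_iff, mem_nonunits_iff, isUnit_map_iff]
  have hann : ∀ s : S, s ∈ Module.annihilator S M ↔ f s ∈ Module.annihilator R M := by
    intro s
    rw [Module.mem_annihilator, Module.mem_annihilator]
    rfl
  have hdimS : Module.supportDim S M = d := by
    rw [← hdim, Module.supportDim_eq_ringKrullDim_quotient_annihilator,
      Module.supportDim_eq_ringKrullDim_quotient_annihilator]
    have hc : Module.annihilator S M = (Module.annihilator R M).comap f := by
      ext s; rw [hann, Ideal.mem_comap]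
    rw [hc]
    refine ringKrullDim_eq_of_ringEquiv (RingEquiv.ofBijective (Ideal.quotientMap _ f le_rfl)
      ⟨Ideal.quotientMap_injective, Ideal.quotientMap_surjective hf⟩)
  obtain ⟨n, hn⟩ : ∃ n : ℕ, Module.supportDim S S = n := by
    rw [Module.supportDim_self_eq_ringKrullDim]
    have h1 := ringKrullDim_lt_top (R := S)
    have h2 := ringKrullDim_nonneg_of_nontrivial (R := S)
    generalize ringKrullDim S = D at h1 h2 ⊢
    match D, h1, h2 with
    | ⊥, h1, h2 => exact absurd h2 (by decide)
    | ((⊤ : ℕ∞) : WithBot ℕ∞), h1, h2 => exact absurd h1 (lt_irrefl _)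
    | (((n : ℕ) : ℕ∞) : WithBot ℕ∞), h1, h2 => exact ⟨n, rfl⟩
  obtain ⟨d', x, hx, hP, hd', m, s, hms⟩ := nonvanish_aux (R := S) M S ((isCM_iff hn).1 hScm) hn
    (by rw [Module.support_eq_zeroLocus (M := S), Module.annihilator_eq_bot.2 inferInstance]; simp)
  have : d' = d := by
    rw [hd'] at hdimS
    exact_mod_cast hdimS
  subst this
  have hQ : ∀ t m, m ∈ QQ M (fun i => f (x i)) t → m ∈ QQ M x t := by
    intro t
    let N : Submodule R M :=
      { carrier := QQ M x t
        zero_mem' := Submodule.zero_mem _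
        add_mem' := Submodule.add_mem _
        smul_mem' := by
          intro r m hm
          obtain ⟨s, rfl⟩ := hf r
          exact Submodule.smul_mem _ s hm }
    have : QQ M (fun i => f (x i)) t ≤ N := mem_QQ_ind _ _ _ fun i m => by
      have := smul_mem_QQ x t i m
      rw [hsm, map_pow] at this
      exact this
    exact fun m hm => this hm
  refine ⟨fun i => f (x i), fun i => (hmem _).1 (hx i), ?_, m, s, fun r hr => hms r ?_⟩
  · intro r hr
    obtain ⟨r, rfl⟩ := hf r
    obtain ⟨k, hk⟩ := hP ((hmem r).2 hr)
    refine ⟨k, ?_⟩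
    rw [← map_pow]
    have : Ideal.span (Set.range x) ⊔ Module.annihilator S M ≤
        (Ideal.span (Set.range fun i => f (x i)) ⊔ Module.annihilator R M).comap f := by
      refine sup_le ?_ fun s hs => Ideal.mem_sup_right ((hann s).1 hs)
      rw [Ideal.span_le]
      rintro _ ⟨i, rfl⟩
      exact Ideal.mem_sup_left (Ideal.subset_span ⟨i, rfl⟩)
    exact this hk
  · rw [hsm, map_pow, map_prod]
    exact hQ _ _ hr

theorem socH_ne_zero (M : Type u) [AddCommGroup M] [Module R M]
    [Module.Finite R M] [Nontrivial M] {d : ℕ} (hd : 0 < d) (x : Fin d → R)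
    (hx : ∀ i, x i ∈ maximalIdeal R) (hP : Par M x) (m : M) (s : ℕ)
    (hm : ∀ r, (∏ i, x i) ^ r • m ∉ QQ M x (s + r)) : socH R M d ≠ 0 := by
  obtain ⟨θ, h⟩ := exists_theta hd x hx hP
  have h0 : θ s m ≠ 0 := by
    rw [Ne, h.ker]
    rintro ⟨r, hr⟩
    exact hm r hr
  obtain ⟨n, hn⟩ := (hP.pow s).ann
  obtain ⟨r, hr1, hr2⟩ := exists_soc h0 (n := n) (by
    intro r hr
    rw [← map_smul]
    apply h.zero
    have := Module.mem_annihilator.1 (hn hr) (Submodule.Quotient.mk m)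
    rwa [← Submodule.Quotient.mk_smul, Submodule.Quotient.mk_eq_zero] at this)
  have hAr := isArtinian_lim x h hP.artinian'
  have := soc_finite (R := R) (N := ((localCohomology (maximalIdeal R) d).obj (ModuleCat.of R M)))
  letI := Ideal.Quotient.field (maximalIdeal R)
  unfold socH socDim
  refine (Module.finrank_pos_iff_exists_ne_zero.2 ⟨⟨_, hr2⟩, fun h => hr1 (congrArg Subtype.val h)⟩).ne'

theorem soc_le {M H : Type u} [AddCommGroup M] [Module R M] [Module.Finite R M]
    [AddCommGroup H] [Module R H] {d : ℕ} {y : Fin d → R} {θ' : ℕ → M →ₗ[R] H} (h : IsLim y θ')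
    (hP : Par M y)
    (hs : ∀ a ∈ Soc (R := R) H, ∃ m, θ' 1 m = a ∧ ∀ r ∈ maximalIdeal R, r • m ∈ QQ M y 1) :
      Module.finrank (R ⧸ maximalIdeal R) (Soc (R := R) H) ≤
    Module.finrank (R ⧸ maximalIdeal R) (Soc (R := R) (M ⧸ (Ideal.span (Set.range y) • ⊤ : Submodule R M))) := by
  rw [← QQ_one]
  let g : (M ⧸ QQ M y 1) →ₗ[R] H := (QQ M y 1).liftQ (θ' 1) (fun m hm => h.zero hm)
  have := hP.artinian'
  have := soc_finite (R := R) (N := M ⧸ QQ M y 1)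
  exact (soc_surj g (by
    intro a ha
    obtain ⟨m, e, hm⟩ := hs a ha
    refine ⟨Submodule.mkQ _ m, mem_Soc.2 fun r hr => ?_, e⟩
    rw [← map_smul, Submodule.mkQ_apply, Submodule.Quotient.mk_eq_zero]
    exact hm r hr)).1

theorem span_pow_le {d : ℕ} (x : Fin d → R) (hx : ∀ i, x i ∈ maximalIdeal R) (n : ℕ) :
    Ideal.span (Set.range fun i => x i ^ n) ≤ maximalIdeal R ^ n := by
  rw [Ideal.span_le]
  rintro _ ⟨i, rfl⟩
  exact Ideal.pow_mem_pow (hx i) n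

theorem main (hCM : IsQuotientOfCMLocalRing R) (M : Type u) [AddCommGroup M] [Module R M]
    [Module.Finite R M] (d : ℕ) (hd : 0 < d) (hdim : mdim R M = d) :
    alphaLim R M d = socH R M d ↔ IsCM R M := by
  rw [mdim_eq] at hdim
  have hN := nontrivial_of_dim hdim
  rw [isCM_iff hdim]
  obtain ⟨x, hx, hP, m, s, hms⟩ := nonvanish hCM M hdim
  have hne : ∀ n, {r : ℕ | ∃ x : Fin d → R, IsSOP R M d x ∧
      Ideal.span (Set.range x) ≤ (maximalIdeal R) ^ n ∧ r = ir R M (Ideal.span (Set.range x))}.Nonempty := by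
    intro n
    refine ⟨_, fun i => x i ^ (n+1), (isSOP_iff _).2 ⟨fun i => Ideal.pow_mem_of_mem _ (hx i) _ (by omega),
      hP.pow _⟩, (span_pow_le x hx (n+1)).trans (Ideal.pow_le_pow_right (by omega)), rfl⟩
  obtain ⟨θ, h⟩ := exists_theta hd x hx hP
  obtain ⟨ℓ, hℓ⟩ := goto_sakurai h hx hP
  constructor
  · intro heq
    have hbdd : BddAbove (Set.range fun n => alphaN R M d (n+1)) := by
      by_contra hb
      apply socH_ne_zero M hd x hx hP m s hms
      rw [← heq]
      unfold alphaLim iSup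
      exact Nat.sSup_of_not_bddAbove hb
    have hle : alphaN R M d (ℓ + 1) ≤ socH R M d := by
      rw [← heq]
      exact le_ciSup hbdd ℓ
    obtain ⟨y, hy, hyl, hyr⟩ := Nat.sInf_mem (hne (ℓ + 1))
    rw [isSOP_iff] at hy
    obtain ⟨θ', h'⟩ := exists_theta hd y hy.1 hy.2
    have hs := hℓ y hy.2 hy.1 (hyl.trans (Ideal.pow_le_pow_right (by omega))) θ' h'
    have := inj_of_finrank_le h' hy.2 hs (hyr.symm.le.trans hle)
    refine ⟨List.ofFn y, by simp, ?_, wr_of_P M y hy.1 this⟩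
    intro r hr
    obtain ⟨i, rfl⟩ := List.mem_ofFn.1 hr
    exact hy.1 i
  · rintro ⟨rs, hl, hrm, hw⟩
    subst hl
    have hz : ∀ i, rs.get i ∈ maximalIdeal R := fun i => hrm _ (List.get_mem _ _)
    have hw' : IsWeaklyRegular M (List.ofFn rs.get) := by rwa [List.ofFn_get]
    have hPz := par_of_wr (M := M) hz hw' hdim subset_rfl
    have hup : ∀ n, alphaN R M rs.length (n + 1) ≤ socH R M rs.length := by
      intro n
      have hzn : ∀ i, rs.get i ^ (n+1) ∈ maximalIdeal R := fun i =>
        Ideal.pow_mem_of_mem _ (hz i) _ (by omega)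
      refine Nat.sInf_le ⟨fun i => rs.get i ^ (n+1), (isSOP_iff _).2 ⟨hzn,
        hPz.pow _⟩, span_pow_le _ hz (n+1), ?_⟩
      obtain ⟨θ', h'⟩ := exists_theta hd _ hzn (hPz.pow (n+1))
      exact (reg_ir h' hzn (wr_pow M _ hz hw' (n+1) (by omega))).symm
    apply le_antisymm
    · exact ciSup_le hup
    · refine le_trans ?_ (le_ciSup ⟨_, by rintro _ ⟨n, rfl⟩; exact hup n⟩ ℓ)
      refine le_csInf (hne _) ?_
      rintro _ ⟨y, hy, hyl, rfl⟩
      rw [isSOP_iff] at hy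
      obtain ⟨θ', h'⟩ := exists_theta hd y hy.1 hy.2
      exact soc_le h' hy.2 (hℓ y hy.2 hy.1 (hyl.trans (Ideal.pow_le_pow_right (by omega))) θ' h')
end
end
end LC

open Paper IsLocalRing

/-- `α(M) = dim_k Soc(H^d_m(M))` iff `M` is Cohen-Macaulay. -/
theorem stmt9 (R : Type u) [CommRing R] [IsLocalRing R] [IsNoetherianRing R]
    (hCM : IsQuotientOfCMLocalRing R)
    (M : Type u) [AddCommGroup M] [Module R M] [Module.Finite R M]
    (d : ℕ) (hd : 0 < d) (hdim : mdim R M = d) :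
    alphaLim R M d = socH R M d ↔ IsCM R M := by
  exact LC.main hCM M d hd hdim
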